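/- (Uniqueness in the inverse source problem.) Under the assumptions of the Hölder stability theorem, if u = (u^s,u^f) satisfies Biot's system with sources F_ℓ(x,t) = p_ℓ(x)R_ℓ(x,t), zero initial data, boundary conditions u^s = 0, u^f·ν = 0, and u(x,t) = 0 for all (x,t) ∈ ω×(−T,T), then p₁(x) = p₂(x) = 0 for all x ∈ Ω and u(x,t) = 0 in Q. -/

import Mathlib

noncomputable section

open MeasureTheory Real Set

/-- Spatial points of `ℝ³`. -/
abbrev V3 := Fin 3 → ℝ

/-- Space-time points `z = (t, x)` with `z.1` the time and `z.2` the space variable. -/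
abbrev P4 := ℝ × V3

/-- The unit time direction in space-time. -/
def et : P4 := (1, 0)

/-- The `i`-th unit spatial direction in space-time. -/
def ex (i : Fin 3) : P4 := (0, Pi.single i 1)

/-- Directional derivative of a scalar function on space-time. -/
def pd (f : P4 → ℝ) (d : P4) : P4 → ℝ := fun z => fderiv ℝ f z d

/-- Spatial partial derivative of a scalar function on `ℝ³`. -/
def pdx (c : V3 → ℝ) (i : Fin 3) : V3 → ℝ := fun x => fderiv ℝ c x (Pi.single i 1)

/-- Time derivative `∂ₜ` of a space-time vector field (componentwise). -/
def Dt (u : P4 → V3) : P4 → V3 := fun z i => pd (fun y => u y i) et z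

/-- Second time derivative `∂ₜ²` of a scalar function on space-time. -/
def dtt (f : P4 → ℝ) : P4 → ℝ := pd (pd f et) et

/-- Spatial divergence of a space-time vector field. -/
def sdiv (u : P4 → V3) : P4 → ℝ := fun z => ∑ i, pd (fun y => u y i) (ex i) z

/-- Spatial divergence of a vector field on `ℝ³`. -/
def sdivX (u : V3 → V3) : V3 → ℝ := fun x => ∑ i, pdx (fun y => u y i) i x

/-- Spatial Laplacian of a scalar function on space-time. -/
def slap (f : P4 → ℝ) : P4 → ℝ := fun z => ∑ i, pd (pd f (ex i)) (ex i) z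

/-- The elasticity operator `Δ_{μ,λ}v = μΔv + (μ+λ)∇(div v) + (div v)∇λ + (∇v + (∇v)ᵀ)∇μ`. -/
def lameOp (μ lam : V3 → ℝ) (u : P4 → V3) : P4 → V3 := fun z i =>
  μ z.2 * slap (fun y => u y i) z
    + (μ z.2 + lam z.2) * pd (sdiv u) (ex i) z
    + sdiv u z * pdx lam i z.2
    + ∑ j, (pd (fun y => u y i) (ex j) z + pd (fun y => u y j) (ex i) z) * pdx μ j z.2

/-- Biot's system of poro-elasticity on the space-time set `Q`, with solid displacement `us`,
fluid displacement `uf` and sources `F1, F2`. -/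
def BiotSystem (ρ11 ρ12 ρ22 μ lam q r : V3 → ℝ)
    (us uf F1 F2 : P4 → V3) (Q : Set P4) : Prop :=
  ∀ z ∈ Q, ∀ i : Fin 3,
    (ρ11 z.2 * dtt (fun y => us y i) z + ρ12 z.2 * dtt (fun y => uf y i) z
        - lameOp μ lam us z i - pd (fun y => q y.2 * sdiv uf y) (ex i) z = F1 z i)
    ∧ (ρ12 z.2 * dtt (fun y => us y i) z + ρ22 z.2 * dtt (fun y => uf y i) z
        - pd (fun y => q y.2 * sdiv us y) (ex i) z
        - pd (fun y => r y.2 * sdiv uf y) (ex i) z = F2 z i)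

/-- The squared Euclidean distance `|x - x₀|²`. -/
def sqd (x0 x : V3) : ℝ := ∑ i, (x i - x0 i) ^ 2

/-- The Carleman weight `φ(x,t) = exp(γ(|x-x₀|² - βt²))`. -/
def wphi (x0 : V3) (β γ : ℝ) (z : P4) : ℝ := Real.exp (γ * (sqd x0 z.2 - β * z.1 ^ 2))

/-- The spatial weight `ρ(x) = exp(γ|x-x₀|²)`. -/
def wrho (x0 : V3) (γ : ℝ) (x : V3) : ℝ := Real.exp (γ * sqd x0 x)

/-- The admissible class `𝒞(m,θ)` of coefficients (with lower bound `cstar`). -/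
def CClass (Ω : Set V3) (x0 : V3) (m θ cstar : ℝ) (c : V3 → ℝ) : Prop :=
  ContDiff ℝ 2 c ∧ (0 < cstar) ∧ (∀ x ∈ closure Ω, cstar < c x) ∧
    (∀ x ∈ closure Ω,
      |c x| ≤ m ∧ ‖fderiv ℝ c x‖ ≤ m ∧ ‖iteratedFDeriv ℝ 2 c x‖ ≤ m) ∧
    (∀ x ∈ closure Ω, (∑ i, pdx c i x * (x i - x0 i)) / (2 * c x) ≤ 1 - θ)

/-- Assumption A.1 on the coefficients of Biot's system. -/
def AssumpA1 (Ω : Set V3) (ρ11 ρ12 ρ22 μ lam q r : V3 → ℝ) : Prop :=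
  ContDiff ℝ 2 ρ11 ∧ ContDiff ℝ 2 ρ12 ∧ ContDiff ℝ 2 ρ22 ∧ ContDiff ℝ 2 μ ∧
    ContDiff ℝ 2 lam ∧ ContDiff ℝ 2 q ∧ ContDiff ℝ 2 r ∧
    (∀ x ∈ closure Ω, 0 < ρ11 x ∧ 0 < ρ22 x ∧ 0 < q x ∧ 0 < r x ∧
      0 < μ x ∧ 0 < lam x + μ x) ∧
    (∀ x ∈ closure Ω, 0 < ρ11 x * ρ22 x - ρ12 x ^ 2) ∧
    (∀ x ∈ closure Ω, 0 < lam x * r x - q x ^ 2)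

/-- The matrix `A(x)` of (1.9). -/
def Amat (ρ11 ρ12 ρ22 μ lam q r : V3 → ℝ) (x : V3) : Matrix (Fin 2) (Fin 2) ℝ :=
  (ρ11 x * ρ22 x - ρ12 x ^ 2)⁻¹ •
    (Matrix.of ![![ρ22 x, -ρ12 x], ![-ρ12 x, ρ11 x]] *
      Matrix.of ![![2 * μ x + lam x, q x], ![q x, r x]])

/-- Assumption A.2: `A(x)` has two distinct positive eigenvalues `μ₂(x) ≠ μ₃(x)`, and
`μ₁ = ϱ⁻¹ϱ₂₂μ`, `μ₂`, `μ₃` all belong to the class `𝒞(m,θ)`. -/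
def AssumpA2 (Ω : Set V3) (x0 : V3) (ρ11 ρ12 ρ22 μ lam q r μ2 μ3 : V3 → ℝ)
    (m θ c1 c2 c3 : ℝ) : Prop :=
  (∀ x ∈ closure Ω,
      (Amat ρ11 ρ12 ρ22 μ lam q r x - μ2 x • (1 : Matrix (Fin 2) (Fin 2) ℝ)).det = 0 ∧
      (Amat ρ11 ρ12 ρ22 μ lam q r x - μ3 x • (1 : Matrix (Fin 2) (Fin 2) ℝ)).det = 0 ∧
      0 < μ2 x ∧ 0 < μ3 x ∧ μ2 x ≠ μ3 x) ∧
    CClass Ω x0 m θ c1 (fun x => (ρ11 x * ρ22 x - ρ12 x ^ 2)⁻¹ * ρ22 x * μ x) ∧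
    CClass Ω x0 m θ c2 μ2 ∧ CClass Ω x0 m θ c3 μ3

/-- `d² = min_{Ω̄} |x-x₀|²` and `D² = max_{Ω̄} |x-x₀|²`. -/
def dGeom (Ω : Set V3) (x0 : V3) (d D : ℝ) : Prop :=
  0 ≤ d ∧ 0 ≤ D ∧ IsLeast ((fun x => sqd x0 x) '' closure Ω) (d ^ 2) ∧
    IsGreatest ((fun x => sqd x0 x) '' closure Ω) (D ^ 2)

/-- Condition (1.16) on the parameter `β` (with `D₀ = √(D² - d²)`). -/
def BetaCond (m θ c0 d D β : ℝ) : Prop :=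
  0 < β ∧ β + (m * Real.sqrt (D ^ 2 - d ^ 2) / Real.sqrt c0) * Real.sqrt β < θ * c0 ∧
    0 < c0 * d ^ 2 - β * D ^ 2

/-- Squared Euclidean norm of a vector of `ℝ³`. -/
def n2 (v : V3) : ℝ := ∑ i, (v i) ^ 2

/-- Squared space-time gradient `|∇_{x,t} f|²` of a scalar function. -/
def gradT2 (f : P4 → ℝ) (z : P4) : ℝ := (pd f et z) ^ 2 + ∑ j, (pd f (ex j) z) ^ 2

/-- Squared spatial gradient `|∇f|²` of a scalar function on space-time. -/
def gradX2 (f : P4 → ℝ) (z : P4) : ℝ := ∑ j, (pd f (ex j) z) ^ 2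

/-- Squared space-time gradient of a vector field. -/
def vGradT2 (u : P4 → V3) (z : P4) : ℝ := ∑ i, gradT2 (fun y => u y i) z

/-- Squared spatial gradient of a vector field. -/
def vGradX2 (u : P4 → V3) (z : P4) : ℝ := ∑ i, gradX2 (fun y => u y i) z

/-- The weighted Carleman functional appearing on the left-hand side of the Carleman
estimate for Biot's system (also denoted `N_{τ,φ}(v)`). -/
def CarlemanN (x0 : V3) (β γ τ : ℝ) (us uf : P4 → V3) (Q : Set P4) : ℝ :=
  ∫ z in Q,
    (τ * (vGradT2 us z + gradT2 (sdiv us) z + gradT2 (sdiv uf) z)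
      + τ ^ 3 * (n2 (us z) + (sdiv us z) ^ 2 + (sdiv uf z) ^ 2))
      * Real.exp (2 * τ * wphi x0 β γ z)

/-- The weighted source term `∫_Q (|F|² + |∇F|²) e^{2τφ}`. -/
def srcN (x0 : V3) (β γ τ : ℝ) (F1 F2 : P4 → V3) (Q : Set P4) : ℝ :=
  ∫ z in Q,
    (n2 (F1 z) + n2 (F2 z) + vGradX2 F1 z + vGradX2 F2 z)
      * Real.exp (2 * τ * wphi x0 β γ z)

/-- Squared `H²`-norm of a space-time vector field over a set. -/
def H2sq (w : P4 → V3) (S : Set P4) : ℝ :=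
  ∫ z in S, (‖w z‖ ^ 2 + ‖fderiv ℝ w z‖ ^ 2 + ‖iteratedFDeriv ℝ 2 w z‖ ^ 2)

/-- The observation quantity `E_ω(u) = Σ_{j=2}^3 ‖∂ₜʲu‖²_{H²(ω×(-T,T))}`. -/
def Eobs (us uf : P4 → V3) (S : Set P4) : ℝ :=
  H2sq (Dt (Dt us)) S + H2sq (Dt (Dt uf)) S
    + H2sq (Dt (Dt (Dt us))) S + H2sq (Dt (Dt (Dt uf))) S

/-- Squared `H₀¹(Ω)`-norm of a scalar function. -/
def H01sq (Ω : Set V3) (p : V3 → ℝ) : ℝ :=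
  ∫ x in Ω, ((p x) ^ 2 + ∑ i, (pdx p i x) ^ 2)


/-! ### Directional derivatives -/

/-- A function vanishes outside the set `Z`. -/
def VanOff {E : Type*} (Z : Set E) (f : E → ℝ) : Prop := ∀ z, z ∉ Z → f z = 0

theorem VanOff.hasCompactSupport {E : Type*} [TopologicalSpace E] [R1Space E] {Z : Set E}
    {f : E → ℝ} (h : VanOff Z f) (hZ : IsCompact Z) : HasCompactSupport f :=
  HasCompactSupport.intro hZ h

section Generic

variable {E : Type*} [NormedAddCommGroup E] [NormedSpace ℝ E]

theorem VanOff.fderiv_apply {Z : Set E} {f : E → ℝ} (h : VanOff Z f) (hZ : IsClosed Z) (d : E) :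
    VanOff Z (fun z => fderiv ℝ f z d) := by
  intro z hz
  have : f =ᶠ[nhds z] fun _ => (0 : ℝ) := by
    filter_upwards [hZ.isOpen_compl.mem_nhds hz] with y hy using h y hy
  simp [this.fderiv_eq]

theorem contDiff_dirDeriv {n : ℕ} {f : E → ℝ} (hf : ContDiff ℝ (n + 1 : ℕ) f) (d : E) :
    ContDiff ℝ n (fun z => fderiv ℝ f z d) := by
  have h : ContDiff ℝ n (fderiv ℝ f) := hf.fderiv_right (by norm_cast)
  exact h.clm_apply contDiff_const

theorem integral_fderiv_apply_eq_zero [FiniteDimensional ℝ E] [MeasurableSpace E] [BorelSpace E]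
    {μ : Measure E} [μ.IsAddHaarMeasure] {f : E → ℝ} (hf : ContDiff ℝ 1 f)
    (hc : HasCompactSupport f) (d : E) : ∫ z, fderiv ℝ f z d ∂μ = 0 := by
  have hcont : Continuous fun z => fderiv ℝ f z d :=
    (hf.continuous_fderiv one_ne_zero).clm_apply continuous_const
  have hc' : HasCompactSupport fun z => fderiv ℝ f z d := by
    refine (hc.fderiv (𝕜 := ℝ)).mono ?_
    intro z hz h0
    exact hz (by simp [h0])
  have := integral_mul_fderiv_eq_neg_fderiv_mul_of_integrable (μ := μ) (f := fun _ : E => (1 : ℝ))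
    (g := f) (v := d) (by simp) (by simpa using hcont.integrable_of_hasCompactSupport hc')
    (by simpa using hf.continuous.integrable_of_hasCompactSupport hc)
    (fun _ _ => differentiableAt_const _) (fun z _ => hf.differentiable one_ne_zero z)
  simpa using this

end Generic

theorem ContDiff.pd {n : ℕ} {f : P4 → ℝ} (hf : ContDiff ℝ (n + 1 : ℕ) f) (d : P4) :
    ContDiff ℝ n (pd f d) := contDiff_dirDeriv hf d

theorem ContDiff.pdx {n : ℕ} {f : V3 → ℝ} (hf : ContDiff ℝ (n + 1 : ℕ) f) (i : Fin 3) :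
    ContDiff ℝ n (pdx f i) := contDiff_dirDeriv hf _

theorem VanOff.pd {Z : Set P4} {f : P4 → ℝ} (h : VanOff Z f) (hZ : IsClosed Z) (d : P4) :
    VanOff Z (pd f d) := h.fderiv_apply hZ d

theorem VanOff.pdx {Z : Set V3} {f : V3 → ℝ} (h : VanOff Z f) (hZ : IsClosed Z) (i : Fin 3) :
    VanOff Z (pdx f i) := h.fderiv_apply hZ _

theorem pd_add {f g : P4 → ℝ} (hf : Differentiable ℝ f) (hg : Differentiable ℝ g) (d : P4) :
    pd (fun z => f z + g z) d = fun z => pd f d z + pd g d z := by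
  funext z; simp [pd, fderiv_fun_add (hf z) (hg z)]

theorem pd_sub {f g : P4 → ℝ} (hf : Differentiable ℝ f) (hg : Differentiable ℝ g) (d : P4) :
    pd (fun z => f z - g z) d = fun z => pd f d z - pd g d z := by
  funext z; simp [pd, fderiv_fun_sub (hf z) (hg z)]

theorem pd_neg (f : P4 → ℝ) (d : P4) : pd (fun z => - f z) d = fun z => - pd f d z := by
  funext z; simp [pd, fderiv_fun_neg]

theorem pd_const (c : ℝ) (d : P4) : pd (fun _ => c) d = fun _ => 0 := by
  funext z; simp [pd]

theorem pd_mul {f g : P4 → ℝ} (hf : Differentiable ℝ f) (hg : Differentiable ℝ g) (d : P4) :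
    pd (fun z => f z * g z) d = fun z => pd f d z * g z + f z * pd g d z := by
  funext z
  simp only [pd, fderiv_fun_mul (hf z) (hg z)]
  simp; ring

theorem pd_const_mul {f : P4 → ℝ} (c : ℝ) (hf : Differentiable ℝ f) (d : P4) :
    pd (fun z => c * f z) d = fun z => c * pd f d z := by
  rw [pd_mul (by fun_prop) hf]; funext z; simp [pd_const]

theorem pd_pow {f : P4 → ℝ} (hf : Differentiable ℝ f) (n : ℕ) (d : P4) :
    pd (fun z => f z ^ n) d = fun z => n * f z ^ (n - 1) * pd f d z := by
  funext z
  simp [pd, fderiv_fun_pow n (hf z)]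

theorem pd_exp {f : P4 → ℝ} (hf : Differentiable ℝ f) (d : P4) :
    pd (fun z => Real.exp (f z)) d = fun z => Real.exp (f z) * pd f d z := by
  funext z
  simp only [pd, fderiv_exp (hf z)]
  simp

theorem pd_sum {ι : Type*} (s : Finset ι) {f : ι → P4 → ℝ} (hf : ∀ i, Differentiable ℝ (f i))
    (d : P4) : pd (fun z => ∑ i ∈ s, f i z) d = fun z => ∑ i ∈ s, pd (f i) d z := by
  funext z
  simp [pd, fderiv_fun_sum fun i _ => hf i z]

theorem pd_snd_et (c : V3 → ℝ) (hc : Differentiable ℝ c) :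
    pd (fun z => c z.2) et = fun _ => 0 := by
  funext z
  have : HasFDerivAt (fun z : P4 => c z.2) ((fderiv ℝ c z.2).comp (ContinuousLinearMap.snd ℝ ℝ V3)) z :=
    (hc z.2).hasFDerivAt.comp z hasFDerivAt_snd
  simp [pd, this.fderiv, et]

theorem pd_snd_ex (c : V3 → ℝ) (hc : Differentiable ℝ c) (i : Fin 3) :
    pd (fun z => c z.2) (ex i) = fun z => pdx c i z.2 := by
  funext z
  have : HasFDerivAt (fun z : P4 => c z.2) ((fderiv ℝ c z.2).comp (ContinuousLinearMap.snd ℝ ℝ V3)) z :=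
    (hc z.2).hasFDerivAt.comp z hasFDerivAt_snd
  simp [pd, pdx, this.fderiv, ex]

theorem pd_coord_et (i : Fin 3) : pd (fun z => z.2 i) et = fun _ => 0 :=
  pd_snd_et (fun x => x i) (by fun_prop)

theorem pdx_coord (i j : Fin 3) : pdx (fun x => x j) i = fun _ => if j = i then 1 else 0 := by
  funext x
  have : fderiv ℝ (fun x : V3 => x j) x = ContinuousLinearMap.proj j :=
    (ContinuousLinearMap.proj (R := ℝ) (φ := fun _ : Fin 3 => ℝ) j).fderiv
  simp [pdx, this, Pi.single_apply]

theorem pd_coord_ex (i j : Fin 3) :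
    pd (fun z => z.2 j) (ex i) = fun _ => if j = i then 1 else 0 := by
  rw [pd_snd_ex (fun x => x j) (by fun_prop), pdx_coord]

theorem pd_fst (c : ℝ → ℝ) (hc : Differentiable ℝ c) :
    pd (fun z => c z.1) et = fun z => deriv c z.1 := by
  funext z
  have : HasFDerivAt (fun z : P4 => c z.1) ((fderiv ℝ c z.1).comp (ContinuousLinearMap.fst ℝ ℝ V3)) z :=
    (hc z.1).hasFDerivAt.comp z hasFDerivAt_fst
  simp [pd, this.fderiv, et]

theorem pd_fst_ex (c : ℝ → ℝ) (hc : Differentiable ℝ c) (i : Fin 3) :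
    pd (fun z => c z.1) (ex i) = fun _ => 0 := by
  funext z
  have : HasFDerivAt (fun z : P4 => c z.1) ((fderiv ℝ c z.1).comp (ContinuousLinearMap.fst ℝ ℝ V3)) z :=
    (hc z.1).hasFDerivAt.comp z hasFDerivAt_fst
  simp [pd, this.fderiv, ex]

theorem pd_time_et : pd (fun z => z.1) et = fun _ => 1 := by
  rw [pd_fst (fun t => t) (by fun_prop)]; simp

theorem pd_time_ex (i : Fin 3) : pd (fun z => z.1) (ex i) = fun _ => 0 :=
  pd_fst_ex (fun t => t) (by fun_prop) i

theorem pd_comm {f : P4 → ℝ} (hf : ContDiff ℝ 2 f) (a b : P4) :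
    pd (pd f a) b = pd (pd f b) a := by
  funext z
  have hs := (hf.contDiffAt (x := z)).isSymmSndFDerivAt (by simp)
  have hd : DifferentiableAt ℝ (fderiv ℝ f) z :=
    (hf.fderiv_right (m := 1) (by norm_num)).differentiable one_ne_zero z
  have key : ∀ a b : P4, pd (pd f a) b z = fderiv ℝ (fderiv ℝ f) z b a := by
    intro a b
    have : pd (pd f a) b z = fderiv ℝ (fun y => fderiv ℝ f y a) z b := rfl
    rw [this, fderiv_clm_apply hd (by fun_prop)]
    simp
  rw [key, key]
  exact hs b a

theorem pd_congr {f g : P4 → ℝ} {z : P4} (h : f =ᶠ[nhds z] g) (d : P4) :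
    pd f d =ᶠ[nhds z] pd g d := by
  filter_upwards [h.fderiv (𝕜 := ℝ)] with y hy
  simp only [pd, hy]

instance volumeP4_isAddHaar : (volume : Measure P4).IsAddHaarMeasure :=
  Measure.prod.instIsAddHaarMeasure volume volume

theorem integral_pd {f : P4 → ℝ} (hf : ContDiff ℝ 1 f) {Z : Set P4} (hZ : IsCompact Z)
    (h : VanOff Z f) (d : P4) : ∫ z, pd f d z = 0 :=
  integral_fderiv_apply_eq_zero hf (h.hasCompactSupport hZ) d

theorem pdx_add {f g : V3 → ℝ} (hf : Differentiable ℝ f) (hg : Differentiable ℝ g) (i : Fin 3) :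
    pdx (fun z => f z + g z) i = fun z => pdx f i z + pdx g i z := by
  funext z; simp [pdx, fderiv_fun_add (hf z) (hg z)]

theorem pdx_sub {f g : V3 → ℝ} (hf : Differentiable ℝ f) (hg : Differentiable ℝ g) (i : Fin 3) :
    pdx (fun z => f z - g z) i = fun z => pdx f i z - pdx g i z := by
  funext z; simp [pdx, fderiv_fun_sub (hf z) (hg z)]

theorem pdx_const (c : ℝ) (i : Fin 3) : pdx (fun _ => c) i = fun _ => 0 := by
  funext z; simp [pdx]

theorem pdx_mul {f g : V3 → ℝ} (hf : Differentiable ℝ f) (hg : Differentiable ℝ g) (i : Fin 3) :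
    pdx (fun z => f z * g z) i = fun z => pdx f i z * g z + f z * pdx g i z := by
  funext z
  simp only [pdx, fderiv_fun_mul (hf z) (hg z)]
  simp; ring

theorem pdx_pow {f : V3 → ℝ} (hf : Differentiable ℝ f) (n : ℕ) (i : Fin 3) :
    pdx (fun z => f z ^ n) i = fun z => n * f z ^ (n - 1) * pdx f i z := by
  funext z
  simp [pdx, fderiv_fun_pow n (hf z)]

theorem pdx_exp {f : V3 → ℝ} (hf : Differentiable ℝ f) (i : Fin 3) :
    pdx (fun z => Real.exp (f z)) i = fun z => Real.exp (f z) * pdx f i z := by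
  funext z
  simp only [pdx, fderiv_exp (hf z)]
  simp

theorem pdx_sum {ι : Type*} (s : Finset ι) {f : ι → V3 → ℝ} (hf : ∀ i, Differentiable ℝ (f i))
    (i : Fin 3) : pdx (fun z => ∑ j ∈ s, f j z) i = fun z => ∑ j ∈ s, pdx (f j) i z := by
  funext z
  simp [pdx, fderiv_fun_sum fun i _ => hf i z]

theorem pdx_comm {f : V3 → ℝ} (hf : ContDiff ℝ 2 f) (i j : Fin 3) :
    pdx (pdx f i) j = pdx (pdx f j) i := by
  funext z
  have hs := (hf.contDiffAt (x := z)).isSymmSndFDerivAt (by simp)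
  have hd : DifferentiableAt ℝ (fderiv ℝ f) z :=
    (hf.fderiv_right (m := 1) (by norm_num)).differentiable one_ne_zero z
  have key : ∀ i j : Fin 3, pdx (pdx f i) j z =
      fderiv ℝ (fderiv ℝ f) z (Pi.single j 1) (Pi.single i 1) := by
    intro i j
    have : pdx (pdx f i) j z = fderiv ℝ (fun y => fderiv ℝ f y (Pi.single i 1)) z (Pi.single j 1) := rfl
    rw [this, fderiv_clm_apply hd (by fun_prop)]
    simp
  rw [key, key]
  exact hs _ _

theorem pdx_congr {f g : V3 → ℝ} {z : V3} (h : f =ᶠ[nhds z] g) (i : Fin 3) :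
    pdx f i =ᶠ[nhds z] pdx g i := by
  filter_upwards [h.fderiv (𝕜 := ℝ)] with y hy
  simp only [pdx, hy]

theorem integral_pdx {f : V3 → ℝ} (hf : ContDiff ℝ 1 f) {Z : Set V3} (hZ : IsCompact Z)
    (h : VanOff Z f) (i : Fin 3) : ∫ z, pdx f i z = 0 :=
  integral_fderiv_apply_eq_zero hf (h.hasCompactSupport hZ) _

theorem VanOff.integrable {E : Type*} [NormedAddCommGroup E] [MeasurableSpace E]
    [BorelSpace E] {μ : Measure E} [IsFiniteMeasureOnCompacts μ] {f : E → ℝ} {Z : Set E}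
    (h : VanOff Z f) (hZ : IsCompact Z) (hf : Continuous f) : Integrable f μ :=
  hf.integrable_of_hasCompactSupport (h.hasCompactSupport hZ)

/-! ### The quadratic form in the Carleman estimate -/

theorem carleman_gradient_form_lower {b t β θ η κ' Gg P gw yg wt : ℝ}
    (hκ : 0 ≤ κ') (hb : 0 < b) (hη : β * b ≤ η) (hyg : -2 * b * (1 - θ) ≤ yg)
    (hG : (β * t) ^ 2 * Gg ≤ 4 * κ' ^ 2 * b) (hP : 0 ≤ P) (hgw : gw ^ 2 ≤ Gg * P) :
    2 * ((θ - η) / 2 - κ') * (b * wt ^ 2 + P) ≤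
      (yg - 2 * β * b ^ 2 + 2 * (1 - (θ - η) / 2) * b) * wt ^ 2
        + (2 - 2 * (1 - (θ - η) / 2)) * P + 2 * β * t * gw * wt := by
  have h1 : (2 * (β * t * gw * wt)) ^ 2 ≤ (2 * κ' * (b * wt ^ 2 + P)) ^ 2 := by
    have h2 : (β * t) ^ 2 * gw ^ 2 ≤ 4 * κ' ^ 2 * b * P := by
      calc (β * t) ^ 2 * gw ^ 2 ≤ (β * t) ^ 2 * (Gg * P) := by gcongr
        _ = ((β * t) ^ 2 * Gg) * P := by ring
        _ ≤ _ := by gcongr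
    have h3 : (2 * (β * t * gw * wt)) ^ 2 ≤ 4 * (4 * κ' ^ 2 * b * P) * wt ^ 2 := by
      calc (2 * (β * t * gw * wt)) ^ 2 = 4 * ((β * t) ^ 2 * gw ^ 2) * wt ^ 2 := by ring
        _ ≤ _ := by gcongr
    nlinarith [mul_nonneg (sq_nonneg κ') (sq_nonneg (b * wt ^ 2 - P))]
  have h4 := (abs_le_of_sq_le_sq' h1 (by positivity)).1
  have h5 : (2 * ((θ - η) / 2) * b) * wt ^ 2 ≤
      (yg - 2 * β * b ^ 2 + 2 * (1 - (θ - η) / 2) * b) * wt ^ 2 := by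
    gcongr
    nlinarith
  nlinarith

theorem carleman_zero_order_lower {b t β θ η κ' σ Gg Y yg : ℝ} (hβ : 0 < β)
    (hκ : 0 ≤ κ') (hb : 0 < b) (hη : β * b ≤ η) (hσ : 0 ≤ σ) (hκθ : η + κ' ≤ θ)
    (hG : (β * t) ^ 2 * Gg ≤ 4 * κ' ^ 2 * b) (hY : 0 ≤ Y) (hyY : yg ^ 2 ≤ Y * Gg)
    (hX : (β * t) ^ 2 * b ≤ Y) :
    (1 - θ) * Y ≤ (1 + σ) * Y - (β * t) ^ 2 * b * (β * b + σ) - (β * t) ^ 2 * yg / 2 := by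
  have h1 : ((β * t) ^ 2 * yg) ^ 2 ≤ (2 * κ' * Y) ^ 2 := by
    calc ((β * t) ^ 2 * yg) ^ 2 = (β * t) ^ 4 * yg ^ 2 := by ring
      _ ≤ (β * t) ^ 4 * (Y * Gg) := by gcongr
      _ = (β * t) ^ 2 * Y * ((β * t) ^ 2 * Gg) := by ring
      _ ≤ (β * t) ^ 2 * Y * (4 * κ' ^ 2 * b) := by gcongr
      _ = 4 * κ' ^ 2 * Y * ((β * t) ^ 2 * b) := by ring
      _ ≤ 4 * κ' ^ 2 * Y * Y := by gcongr
      _ = _ := by ring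
  have h2 := (abs_le_of_sq_le_sq' h1 (by positivity)).2
  have h3 : (β * t) ^ 2 * b * (β * b + σ) ≤ Y * (η + σ) := by
    gcongr
  nlinarith

theorem carleman_form_lower {β θ η κ' bmin G d0 : ℝ} (hβ : 0 < β) (hθ : θ < 1)
    (hη0 : 0 < η) (hκ : 0 ≤ κ') (hκκ : κ' < (θ - η) / 2) (hbmin : 0 < bmin) (hG0 : 0 ≤ G)
    (hd0 : 0 < d0) :
    ∃ ε > 0, ∃ τ0 ≥ 1, ∀ τ ≥ τ0, ∀ b t Gg P gw yg wt Y w s : ℝ, bmin ≤ b → β * b ≤ η →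
      -2 * b * (1 - θ) ≤ yg → (β * t) ^ 2 * Gg ≤ 4 * κ' ^ 2 * b → 0 ≤ P → gw ^ 2 ≤ Gg * P →
      yg ^ 2 ≤ Y * Gg → (β * t) ^ 2 * b ≤ Y → d0 ≤ Y → Gg ≤ G →
      ε * (τ * (wt ^ 2 + P) + τ ^ 3 * w ^ 2) ≤
        s ^ 2 + 4 * τ * ((yg - 2 * β * b ^ 2 + 2 * (1 - (θ - η) / 2) * b) * wt ^ 2
          + (2 - 2 * (1 - (θ - η) / 2)) * P + 2 * β * t * gw * wt)
        + 4 * τ * β * w * gw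
        + 32 * τ ^ 3 * ((1 + (1 - (θ - η) / 2)) * Y
            - (β * t) ^ 2 * b * (β * b + (1 - (θ - η) / 2)) - (β * t) ^ 2 * yg / 2) * w ^ 2
        + 8 * τ * (1 - (θ - η) / 2) * w * s := by
  set δ := (θ - η) / 2 - κ' with hδ
  set σ := 1 - (θ - η) / 2 with hσ
  have hδ0 : 0 < δ := by linarith
  have hθ0 : 0 < 1 - θ := by linarith
  set L := 16 * σ ^ 2 + β ^ 2 * G / δ with hL
  have hL0 : 0 ≤ L := by positivity
  refine ⟨min (min (8 * δ * bmin) (4 * δ)) (16 * (1 - θ) * d0), by positivity,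
    max 1 (L / (16 * (1 - θ) * d0)), le_max_left _ _, ?_⟩
  intro τ hτ b t Gg P gw yg wt Y w s hb hη hyg hG hP hgw hyY hX hY hGG
  have hτ1 : 1 ≤ τ := (le_max_left _ _).trans hτ
  have hτ2 : L ≤ τ * (16 * (1 - θ) * d0) := by
    have := (le_max_right _ _).trans hτ
    rwa [div_le_iff₀ (by positivity)] at this
  have hb0 : 0 < b := hbmin.trans_le hb
  have h1 := carleman_gradient_form_lower (wt := wt) hκ hb0 hη hyg hG hP hgw
  have h2 := carleman_zero_order_lower (σ := σ) (θ := θ) hβ hκ hb0 hη (by linarith) (by linarith) hG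
    (by linarith) hyY hX
  rw [← hδ] at h1
  have h3 : -(4 * δ * P + β ^ 2 * G / δ * w ^ 2) ≤ 4 * β * w * gw := by
    have hgw' : gw ^ 2 ≤ G * P := hgw.trans (by gcongr)
    have h30 : (4 * β * w * gw) ^ 2 ≤ (4 * δ * P + β ^ 2 * G / δ * w ^ 2) ^ 2 := by
      calc (4 * β * w * gw) ^ 2 = 16 * β ^ 2 * w ^ 2 * gw ^ 2 := by ring
        _ ≤ 16 * β ^ 2 * w ^ 2 * (G * P) := by gcongr
        _ = 4 * (4 * δ * P) * (β ^ 2 * G / δ * w ^ 2) := by field_simp; ring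
        _ ≤ _ := four_mul_le_sq_add _ _
    exact (abs_le_of_sq_le_sq' h30 (by positivity)).1
  have h4 : -(16 * τ ^ 2 * σ ^ 2 * w ^ 2) ≤ s ^ 2 + 8 * τ * σ * w * s := by
    linarith [sq_nonneg (s + 4 * τ * σ * w)]
  have h5 : τ ^ 3 * ((1 - θ) * d0) * w ^ 2 ≤ τ ^ 3 * ((1 + σ) * Y
            - (β * t) ^ 2 * b * (β * b + σ) - (β * t) ^ 2 * yg / 2) * w ^ 2 := by
    have : (1 - θ) * d0 ≤ (1 - θ) * Y := by gcongr
    gcongr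
    linarith
  have h6 : 16 * τ ^ 2 * σ ^ 2 * w ^ 2 + τ * (β ^ 2 * G / δ * w ^ 2) ≤
      τ ^ 3 * (16 * (1 - θ) * d0) * w ^ 2 := by
    have h60 : τ * (β ^ 2 * G / δ * w ^ 2) ≤ τ ^ 2 * (β ^ 2 * G / δ * w ^ 2) := by
      gcongr; exact le_self_pow₀ hτ1 two_ne_zero
    have h61 : τ ^ 2 * w ^ 2 * L ≤ τ ^ 2 * w ^ 2 * (τ * (16 * (1 - θ) * d0)) := by gcongr
    rw [hL] at h61
    linarith
  have h7 : 4 * τ * (2 * δ * (b * wt ^ 2 + P)) ≤ 4 * τ *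
      ((yg - 2 * β * b ^ 2 + 2 * σ * b) * wt ^ 2 + (2 - 2 * σ) * P + 2 * β * t * gw * wt) := by
    gcongr
  have h8 : τ * -(4 * δ * P + β ^ 2 * G / δ * w ^ 2) ≤ τ * (4 * β * w * gw) := by gcongr
  have h9 : 4 * τ * (2 * δ * (bmin * wt ^ 2 + P)) ≤ 4 * τ * (2 * δ * (b * wt ^ 2 + P)) := by
    gcongr
  set ε := min (min (8 * δ * bmin) (4 * δ)) (16 * (1 - θ) * d0)
  have e1 : ε ≤ 8 * δ * bmin := (min_le_left _ _).trans (min_le_left _ _)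
  have e2 : ε ≤ 4 * δ := (min_le_left _ _).trans (min_le_right _ _)
  have e3 : ε ≤ 16 * (1 - θ) * d0 := min_le_right _ _
  have h10 : ε * (τ * wt ^ 2) ≤ 8 * δ * bmin * (τ * wt ^ 2) := by gcongr
  have h11 : ε * (τ * P) ≤ 4 * δ * (τ * P) := by gcongr
  have h12 : ε * (τ ^ 3 * w ^ 2) ≤ 16 * (1 - θ) * d0 * (τ ^ 3 * w ^ 2) := by gcongr
  linarith

/-! ### The Carleman identity for `b ∂ₜ² - Δ` -/

/-- The wave operator `b ∂ₜ² - Δ`. -/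
def waveOp (b : V3 → ℝ) (f : P4 → ℝ) : P4 → ℝ := fun z => b z.2 * dtt f z - slap f z

/-- Time component of the flux in the Carleman identity. -/
def fluxT (τ β σ : ℝ) (x0 : V3) (b : V3 → ℝ) (w : P4 → ℝ) : P4 → ℝ := fun z =>
  4 * τ * β * (z.1 * (b z.2 ^ 2 * pd w et z ^ 2))
    + 8 * τ * (b z.2 * (pd w et z * ((z.2 0 - x0 0) * pd w (ex 0) z
      + (z.2 1 - x0 1) * pd w (ex 1) z + (z.2 2 - x0 2) * pd w (ex 2) z)))
    + 4 * τ * β * (z.1 * (b z.2 * (pd w (ex 0) z ^ 2 + pd w (ex 1) z ^ 2 + pd w (ex 2) z ^ 2)))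
    + 4 * τ * (b z.2 * ((β * b z.2 + 3) * (w z * pd w et z)))
    + 16 * τ ^ 3 * β * ((β ^ 2 * (b z.2 * z.1 ^ 2) - ((z.2 0 - x0 0) ^ 2 + (z.2 1 - x0 1) ^ 2
      + (z.2 2 - x0 2) ^ 2)) * (z.1 * (b z.2 * w z ^ 2)))
    - 8 * τ * σ * (b z.2 * (w z * pd w et z))

/-- Space components of the flux in the Carleman identity. -/
def fluxX (τ β σ : ℝ) (x0 : V3) (b : V3 → ℝ) (w : P4 → ℝ) (i : Fin 3) : P4 → ℝ := fun z =>
  4 * τ * ((z.2 i - x0 i) * (pd w (ex 0) z ^ 2 + pd w (ex 1) z ^ 2 + pd w (ex 2) z ^ 2))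
    - 4 * τ * (b z.2 * ((z.2 i - x0 i) * pd w et z ^ 2))
    - 8 * τ * β * (z.1 * (b z.2 * (pd w et z * pd w (ex i) z)))
    - 8 * τ * (pd w (ex i) z * ((z.2 0 - x0 0) * pd w (ex 0) z
      + (z.2 1 - x0 1) * pd w (ex 1) z + (z.2 2 - x0 2) * pd w (ex 2) z))
    - 4 * τ * ((β * b z.2 + 3) * (w z * pd w (ex i) z))
    + 16 * τ ^ 3 * ((β ^ 2 * (b z.2 * z.1 ^ 2) - ((z.2 0 - x0 0) ^ 2 + (z.2 1 - x0 1) ^ 2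
      + (z.2 2 - x0 2) ^ 2)) * ((z.2 i - x0 i) * w z ^ 2))
    + 8 * τ * σ * (w z * pd w (ex i) z)

/-- Symmetric part of the conjugated wave operator. -/
def symPart (τ β : ℝ) (x0 : V3) (b : V3 → ℝ) (w : P4 → ℝ) : P4 → ℝ := fun z =>
  waveOp b w z + 4 * τ ^ 2 * (β ^ 2 * b z.2 * z.1 ^ 2 - sqd x0 z.2) * w z

/-- Antisymmetric part of the conjugated wave operator. -/
def antiPart (τ β : ℝ) (x0 : V3) (b : V3 → ℝ) (w : P4 → ℝ) : P4 → ℝ := fun z =>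
  4 * τ * (β * z.1 * b z.2 * pd w et z + ∑ i, (z.2 i - x0 i) * pd w (ex i) z)
    + 2 * τ * (β * b z.2 + 3) * w z

set_option maxHeartbeats 4000000 in
theorem carleman_identity (τ β σ : ℝ) (x0 : V3) {b : V3 → ℝ} (hb : ContDiff ℝ 1 b)
    {w : P4 → ℝ} (hw : ContDiff ℝ 2 w) (z : P4) :
    2 * symPart τ β x0 b w z * antiPart τ β x0 b w z =
      pd (fluxT τ β σ x0 b w) et z + ∑ i, pd (fluxX τ β σ x0 b w i) (ex i) z
      + 4 * τ * ((∑ i, (z.2 i - x0 i) * pdx b i z.2 - 2 * β * b z.2 ^ 2 + 2 * σ * b z.2)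
            * pd w et z ^ 2
          + (2 - 2 * σ) * gradX2 w z
          + 2 * β * z.1 * (∑ i, pdx b i z.2 * pd w (ex i) z) * pd w et z)
      + 4 * τ * β * w z * (∑ i, pdx b i z.2 * pd w (ex i) z)
      + 32 * τ ^ 3 * ((1 + σ) * sqd x0 z.2 - (β * z.1) ^ 2 * b z.2 * (β * b z.2 + σ)
          - (β * z.1) ^ 2 * (∑ i, (z.2 i - x0 i) * pdx b i z.2) / 2) * w z ^ 2
      + 8 * τ * σ * w z * symPart τ β x0 b w z := by
  have dw : Differentiable ℝ w := hw.differentiable two_ne_zero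
  have dwd : ∀ d, Differentiable ℝ (pd w d) := fun d =>
    (ContDiff.pd (n := 1) hw d).differentiable one_ne_zero
  have dwt := dwd et
  have dw0 := dwd (ex 0)
  have dw1 := dwd (ex 1)
  have dw2 := dwd (ex 2)
  have db : Differentiable ℝ b := hb.differentiable one_ne_zero
  have dbs : Differentiable ℝ (fun z : P4 => b z.2) := db.comp differentiable_snd
  have c0 := fun i => pd_comm hw (ex i) et
  have c10 := pd_comm hw (ex 1) (ex 0)
  have c20 := pd_comm hw (ex 2) (ex 0)
  have c21 := pd_comm hw (ex 2) (ex 1)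
  have hbt := pd_snd_et b db
  have hbx := pd_snd_ex b db
  simp only [Fin.sum_univ_three]
  unfold fluxT fluxX symPart antiPart waveOp dtt slap sqd gradX2
  simp (disch := fun_prop) only [pd_add, pd_sub, pd_mul, pd_const, pd_pow, pd_coord_et,
      pd_coord_ex, pd_time_et, pd_time_ex, hbt, hbx, c0, Fin.sum_univ_three, c10, c20, c21]
  simp
  ring

/-! ### The Carleman estimate for a scalar wave operator -/

/-- The quadratic weight `ψ(t,x) = |x - x₀|² - β t²`. -/
def psi (x0 : V3) (β : ℝ) (z : P4) : ℝ := sqd x0 z.2 - β * z.1 ^ 2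

theorem contDiff_sqd (x0 : V3) {n : WithTop ℕ∞} : ContDiff ℝ n (sqd x0) := by
  unfold sqd; fun_prop

theorem contDiff_psi (x0 : V3) (β : ℝ) {n : WithTop ℕ∞} : ContDiff ℝ n (psi x0 β) := by
  unfold psi sqd; fun_prop

theorem pd_psi_et (x0 : V3) (β : ℝ) : pd (psi x0 β) et = fun z => -(2 * β * z.1) := by
  unfold psi sqd
  simp only [Fin.sum_univ_three]
  simp (disch := fun_prop) only [pd_add, pd_sub, pd_mul, pd_const, pd_pow, pd_coord_et, pd_time_et]
  funext z; simp; ring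

theorem pd_psi_ex (x0 : V3) (β : ℝ) (i : Fin 3) :
    pd (psi x0 β) (ex i) = fun z => 2 * (z.2 i - x0 i) := by
  unfold psi sqd
  simp only [Fin.sum_univ_three]
  simp (disch := fun_prop) only [pd_add, pd_sub, pd_mul, pd_const, pd_pow, pd_coord_ex, pd_time_ex]
  funext z; fin_cases i <;> simp

/-- The conjugated function `e^{τψ} f`. -/
def conj (τ β : ℝ) (x0 : V3) (f : P4 → ℝ) : P4 → ℝ := fun z => Real.exp (τ * psi x0 β z) * f z

theorem pd_conj (τ β : ℝ) (x0 : V3) {f : P4 → ℝ} (hf : Differentiable ℝ f) (d : P4) :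
    pd (conj τ β x0 f) d = fun z =>
      Real.exp (τ * psi x0 β z) * (pd f d z + τ * pd (psi x0 β) d z * f z) := by
  have hp : Differentiable ℝ (psi x0 β) := (contDiff_psi x0 β (n := 1)).differentiable one_ne_zero
  unfold conj
  rw [pd_mul (by fun_prop) hf, pd_exp (by fun_prop), pd_const_mul _ hp]
  funext z; ring

theorem exp_mul_waveOp (τ β : ℝ) (x0 : V3) (b : V3 → ℝ) {f : P4 → ℝ} (hf : ContDiff ℝ 2 f)
    (z : P4) :
    Real.exp (τ * psi x0 β z) * waveOp b f z =
      symPart τ β x0 b (conj τ β x0 f) z + antiPart τ β x0 b (conj τ β x0 f) z := by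
  have df : Differentiable ℝ f := hf.differentiable two_ne_zero
  have dfd : ∀ d, Differentiable ℝ (pd f d) := fun d =>
    (ContDiff.pd (n := 1) hf d).differentiable one_ne_zero
  have hp : Differentiable ℝ (psi x0 β) := (contDiff_psi x0 β (n := 1)).differentiable one_ne_zero
  have e2 : ∀ d, pd (pd (conj τ β x0 f) d) d z = Real.exp (τ * psi x0 β z) *
      (pd (pd f d) d z + 2 * τ * pd (psi x0 β) d z * pd f d z
        + (τ ^ 2 * pd (psi x0 β) d z ^ 2 + τ * pd (pd (psi x0 β) d) d z) * f z) := by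
    intro d
    have h1 : Differentiable ℝ (pd (psi x0 β) d) :=
      (ContDiff.pd (n := 1) (contDiff_psi x0 β) d).differentiable one_ne_zero
    have h2 := dfd d
    rw [pd_conj τ β x0 df d, pd_mul (by fun_prop) (by fun_prop), pd_exp (by fun_prop),
      pd_const_mul _ hp, pd_add h2 (by fun_prop), pd_mul (by fun_prop) df, pd_const_mul _ h1]
    ring
  unfold symPart antiPart waveOp dtt slap
  simp only [e2]
  simp only [pd_conj τ β x0 df, pd_psi_et, pd_psi_ex, Fin.sum_univ_three, conj, sqd]
  have e3 : pd (fun z : P4 => -(2 * β * z.1)) et z = -(2 * β) := by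
    rw [pd_neg, pd_const_mul _ (by fun_prop), pd_time_et]; simp
  have e4 : ∀ i : Fin 3, pd (fun z : P4 => 2 * (z.2 i - x0 i)) (ex i) z = 2 := by
    intro i
    rw [pd_const_mul _ (by fun_prop), pd_sub (by fun_prop) (by fun_prop), pd_const, pd_coord_ex]
    simp
  rw [e3, e4, e4, e4]
  ring

theorem contDiff_conj (τ β : ℝ) (x0 : V3) {n : WithTop ℕ∞} {f : P4 → ℝ} (hf : ContDiff ℝ n f) :
    ContDiff ℝ n (conj τ β x0 f) := by
  have := contDiff_psi x0 β (n := n)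
  unfold conj
  fun_prop

theorem contDiff_fluxT (τ β σ : ℝ) (x0 : V3) {b : V3 → ℝ} (hb : ContDiff ℝ 1 b)
    {w : P4 → ℝ} (hw : ContDiff ℝ 2 w) : ContDiff ℝ 1 (fluxT τ β σ x0 b w) := by
  have h0 : ContDiff ℝ 1 w := hw.of_le one_le_two
  have h1 : ∀ d, ContDiff ℝ 1 (pd w d) := fun d => ContDiff.pd (n := 1) hw d
  have ht := h1 et
  have hx0 := h1 (ex 0)
  have hx1 := h1 (ex 1)
  have hx2 := h1 (ex 2)
  unfold fluxT
  fun_prop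

theorem contDiff_fluxX (τ β σ : ℝ) (x0 : V3) {b : V3 → ℝ} (hb : ContDiff ℝ 1 b)
    {w : P4 → ℝ} (hw : ContDiff ℝ 2 w) (i : Fin 3) : ContDiff ℝ 1 (fluxX τ β σ x0 b w i) := by
  have h0 : ContDiff ℝ 1 w := hw.of_le one_le_two
  have h1 : ∀ d, ContDiff ℝ 1 (pd w d) := fun d => ContDiff.pd (n := 1) hw d
  have ht := h1 et
  have hx := h1 (ex i)
  have hx0 := h1 (ex 0)
  have hx1 := h1 (ex 1)
  have hx2 := h1 (ex 2)
  unfold fluxX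
  fun_prop

theorem continuous_waveOp {b : V3 → ℝ} (hb : Continuous b) {f : P4 → ℝ} (hf : ContDiff ℝ 2 f) :
    Continuous (waveOp b f) := by
  have h2 : ∀ d, Continuous (pd (pd f d) d) := fun d =>
    (ContDiff.pd (n := 0) (ContDiff.pd (n := 1) hf d) d).continuous
  have h3 := h2 et
  unfold waveOp dtt slap
  exact ((hb.comp continuous_snd).mul h3).sub (continuous_finsetSum _ fun i _ => h2 (ex i))

theorem VanOff.waveOp {Z : Set P4} (hZ : IsClosed Z) {f : P4 → ℝ} (h : VanOff Z f) (b : V3 → ℝ) :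
    VanOff Z (waveOp b f) := by
  intro z hz
  simp [_root_.waveOp, dtt, slap, (h.pd hZ _).pd hZ _ z hz]

/-- Conditions on a slowness coefficient `b` under which the Carleman estimate holds on `Z`. -/
structure CarlemanSpeed (x0 : V3) (β : ℝ) (Z : Set P4) (b : V3 → ℝ) : Prop where
  smooth : ContDiff ℝ 1 b
  bounds : ∃ θ η κ' bmin G d0 : ℝ, θ < 1 ∧ 0 < η ∧ 0 ≤ κ' ∧ κ' < (θ - η) / 2 ∧ 0 < bmin ∧
    0 ≤ G ∧ 0 < d0 ∧ ∀ z ∈ Z, bmin ≤ b z.2 ∧ β * b z.2 ≤ η ∧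
      -2 * b z.2 * (1 - θ) ≤ ∑ i, (z.2 i - x0 i) * pdx b i z.2 ∧
      (β * z.1) ^ 2 * (∑ i, pdx b i z.2 ^ 2) ≤ 4 * κ' ^ 2 * b z.2 ∧
      (β * z.1) ^ 2 * b z.2 ≤ sqd x0 z.2 ∧ d0 ≤ sqd x0 z.2 ∧ ∑ i, pdx b i z.2 ^ 2 ≤ G

theorem sq_le_two_mul (a c : ℝ) : a ^ 2 ≤ 2 * (a + c) ^ 2 + 2 * c ^ 2 := by
  nlinarith [sq_nonneg (a + 2 * c)]

theorem carleman_pointwise {x0 : V3} {β : ℝ} (hβ : 0 < β) {Z : Set P4} (hZ : IsCompact Z)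
    {b : V3 → ℝ} (hb : CarlemanSpeed x0 β Z b) :
    ∃ ε > 0, ∃ σ : ℝ, ∃ τ0 ≥ (1 : ℝ), ∀ τ ≥ τ0, ∀ f : P4 → ℝ, ContDiff ℝ 2 f → VanOff Z f → ∀ z,
      ε * ((τ * (pd f et z ^ 2 + gradX2 f z) + τ ^ 3 * f z ^ 2)
          * Real.exp (2 * (τ * psi x0 β z)))
        ≤ waveOp b f z ^ 2 * Real.exp (2 * (τ * psi x0 β z))
          - pd (fluxT τ β σ x0 b (conj τ β x0 f)) et z
          - ∑ i, pd (fluxX τ β σ x0 b (conj τ β x0 f) i) (ex i) z := by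
  obtain ⟨hbs, θ, η, κ', bmin, G, d0, hθ, hη, hκ, hκκ, hbmin, hG, hd0, hbZ⟩ := hb
  obtain ⟨ε, hε, τ0, hτ0, H⟩ := carleman_form_lower hβ hθ hη hκ hκκ hbmin hG hd0
  obtain ⟨M, hM⟩ := hZ.exists_bound_of_continuousOn
    (f := fun z : P4 => 4 * β ^ 2 * z.1 ^ 2 + 4 * sqd x0 z.2)
    (by have := (contDiff_sqd x0 (n := 0)).continuous; fun_prop)
  have hN : 0 < 2 * |M| + 3 := by positivity
  refine ⟨ε / (2 * |M| + 3), by positivity, 1 - (θ - η) / 2, τ0, hτ0, fun τ hτ f hf hv z => ?_⟩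
  have hτp : 0 < τ := by linarith
  set w := conj τ β x0 f with hw
  have hw2 : ContDiff ℝ 2 w := contDiff_conj τ β x0 hf
  have hZc := hZ.isClosed
  have hwv : VanOff Z w := fun y hy => by simp [hw, conj, hv y hy]
  have hcl := carleman_identity τ β (1 - (θ - η) / 2) x0 hbs hw2 z
  have hexp : Real.exp (2 * (τ * psi x0 β z)) = Real.exp (τ * psi x0 β z) ^ 2 := by
    rw [← Real.exp_nat_mul]; norm_num
  have hsa := exp_mul_waveOp τ β x0 b hf z
  rw [← hw] at hsa
  by_cases hz : z ∈ Z
  · obtain ⟨k1, k2, k3, k4, k5, k6, k7⟩ := hbZ z hz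
    have hcs : ∀ u v : Fin 3 → ℝ, (∑ i, u i * v i) ^ 2 ≤ (∑ i, u i ^ 2) * ∑ i, v i ^ 2 :=
      fun u v => Finset.sum_mul_sq_le_sq_mul_sq _ _ _
    have hH := H τ hτ (b z.2) z.1 (∑ i, pdx b i z.2 ^ 2) (gradX2 w z)
      (∑ i, pdx b i z.2 * pd w (ex i) z) (∑ i, (z.2 i - x0 i) * pdx b i z.2) (pd w et z)
      (sqd x0 z.2) (w z) (symPart τ β x0 b w z) k1 k2 k3 k4
      (Finset.sum_nonneg fun i _ => sq_nonneg _) (hcs _ _) (hcs _ _) k5 k6 k7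
    have hM' : 4 * β ^ 2 * z.1 ^ 2 + 4 * sqd x0 z.2 ≤ |M| :=
      (le_abs_self _).trans ((hM z hz).trans (le_abs_self _))
    set e := Real.exp (τ * psi x0 β z) with he
    have f1 : pd w et z = e * (pd f et z + τ * (-(2 * β * z.1)) * f z) := by
      rw [hw, pd_conj _ _ _ (hf.differentiable two_ne_zero), pd_psi_et]
    have f2 : ∀ i, pd w (ex i) z = e * (pd f (ex i) z + τ * (2 * (z.2 i - x0 i)) * f z) := by
      intro i
      rw [hw, pd_conj _ _ _ (hf.differentiable two_ne_zero), pd_psi_ex]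
    have f3 : w z = e * f z := rfl
    have g1 : pd f et z ^ 2 * e ^ 2 ≤ 2 * pd w et z ^ 2 + 2 * τ ^ 2 * (4 * β ^ 2 * z.1 ^ 2) * w z ^ 2 := by
      rw [f1, f3]
      linear_combination sq_le_two_mul (pd f et z * e) (τ * (-(2 * β * z.1)) * f z * e)
    have g2 : ∀ i, pd f (ex i) z ^ 2 * e ^ 2 ≤ 2 * pd w (ex i) z ^ 2
        + 2 * τ ^ 2 * (4 * (z.2 i - x0 i) ^ 2) * w z ^ 2 := by
      intro i
      rw [f2, f3]
      linear_combination sq_le_two_mul (pd f (ex i) z * e) (τ * (2 * (z.2 i - x0 i)) * f z * e)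
    have g3 : gradX2 f z * e ^ 2 ≤ 2 * gradX2 w z + 2 * τ ^ 2 * (4 * sqd x0 z.2) * w z ^ 2 := by
      unfold gradX2 sqd
      have a0 := g2 0
      have a1 := g2 1
      have a2 := g2 2
      simp only [Fin.sum_univ_three]
      linarith
    have hP : 0 ≤ gradX2 w z := Finset.sum_nonneg fun i _ => sq_nonneg _
    have g4 : (τ * (pd f et z ^ 2 + gradX2 f z) + τ ^ 3 * f z ^ 2) * e ^ 2
        ≤ (2 * |M| + 3) * (τ * (pd w et z ^ 2 + gradX2 w z) + τ ^ 3 * w z ^ 2) := by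
      have h1 : τ * ((pd f et z ^ 2 + gradX2 f z) * e ^ 2) ≤ τ * (2 * (pd w et z ^ 2 + gradX2 w z)
          + 2 * τ ^ 2 * |M| * w z ^ 2) := by
        gcongr
        have : 2 * τ ^ 2 * (4 * β ^ 2 * z.1 ^ 2 + 4 * sqd x0 z.2) * w z ^ 2
          ≤ 2 * τ ^ 2 * |M| * w z ^ 2 := by gcongr
        linarith
      have h2 : 0 ≤ τ * (pd w et z ^ 2 + gradX2 w z) := by positivity
      have h3 : 0 ≤ |M| * (τ * (pd w et z ^ 2 + gradX2 w z)) := by positivity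
      have h4 : 0 ≤ τ ^ 3 * w z ^ 2 := by positivity
      have h5 : w z ^ 2 = f z ^ 2 * e ^ 2 := by rw [f3]; ring
      rw [h5] at h1 h4 ⊢
      linarith
    rw [hexp]
    calc ε / (2 * |M| + 3) * ((τ * (pd f et z ^ 2 + gradX2 f z) + τ ^ 3 * f z ^ 2) * e ^ 2)
        ≤ ε / (2 * |M| + 3) *
          ((2 * |M| + 3) * (τ * (pd w et z ^ 2 + gradX2 w z) + τ ^ 3 * w z ^ 2)) := by gcongr
      _ = ε * (τ * (pd w et z ^ 2 + gradX2 w z) + τ ^ 3 * w z ^ 2) := by field_simp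
      _ ≤ _ := hH
      _ ≤ _ := by
        have : waveOp b f z ^ 2 * e ^ 2 =
            (symPart τ β x0 b w z + antiPart τ β x0 b w z) ^ 2 := by rw [← hsa]; ring
        rw [this]
        linarith [sq_nonneg (antiPart τ β x0 b w z)]
  · have e0 : fluxT τ β (1 - (θ - η) / 2) x0 b w =ᶠ[nhds z] fun _ => 0 := by
      filter_upwards [hZc.isOpen_compl.mem_nhds hz] with y hy
      simp [fluxT, hwv y hy, hwv.pd hZc _ y hy]
    have e1 : ∀ i, fluxX τ β (1 - (θ - η) / 2) x0 b w i =ᶠ[nhds z] fun _ => 0 := by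
      intro i
      filter_upwards [hZc.isOpen_compl.mem_nhds hz] with y hy
      simp [fluxX, hwv y hy, hwv.pd hZc _ y hy]
    simp [gradX2, hv z hz, hv.pd hZc _ z hz, VanOff.waveOp hZc hv b z hz,
      (pd_congr e0 et).eq_of_nhds, fun i => (pd_congr (e1 i) (ex i)).eq_of_nhds, pd_const]

theorem carleman_scalar {x0 : V3} {β : ℝ} (hβ : 0 < β) {Z : Set P4} (hZ : IsCompact Z)
    {b : V3 → ℝ} (hb : CarlemanSpeed x0 β Z b) :
    ∃ ε > 0, ∃ τ0 ≥ (1 : ℝ), ∀ τ ≥ τ0, ∀ f : P4 → ℝ, ContDiff ℝ 2 f → VanOff Z f →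
      ε * ∫ z, (τ * (pd f et z ^ 2 + gradX2 f z) + τ ^ 3 * f z ^ 2)
          * Real.exp (2 * (τ * psi x0 β z))
        ≤ ∫ z, waveOp b f z ^ 2 * Real.exp (2 * (τ * psi x0 β z)) := by
  obtain ⟨ε, hε, σ, τ0, hτ0, H⟩ := carleman_pointwise hβ hZ hb
  refine ⟨ε, hε, τ0, hτ0, fun τ hτ f hf hv => ?_⟩
  have hZc := hZ.isClosed
  have hψ : Continuous (psi x0 β) := (contDiff_psi x0 β (n := 0)).continuous
  set w := conj τ β x0 f with hw
  have hw2 : ContDiff ℝ 2 w := contDiff_conj τ β x0 hf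
  have hwv : VanOff Z w := fun y hy => by simp [hw, conj, hv y hy]
  have hT1 := contDiff_fluxT τ β σ x0 hb.smooth hw2
  have hX1 := contDiff_fluxX τ β σ x0 hb.smooth hw2
  have hTv : VanOff Z (fluxT τ β σ x0 b w) := fun y hy => by
    simp [fluxT, hwv y hy, hwv.pd hZc _ y hy]
  have hXv : ∀ i, VanOff Z (fluxX τ β σ x0 b w i) := fun i y hy => by
    simp [fluxX, hwv y hy, hwv.pd hZc _ y hy]
  have cf := hf.continuous
  have cpd : ∀ d, Continuous (pd f d) := fun d => (ContDiff.pd (n := 1) hf d).continuous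
  have cg : Continuous (gradX2 f) := continuous_finsetSum _ fun i _ => (cpd _).pow 2
  have ct := cpd et
  have i1 : Integrable fun z => (τ * (pd f et z ^ 2 + gradX2 f z) + τ ^ 3 * f z ^ 2)
          * Real.exp (2 * (τ * psi x0 β z)) := by
    refine VanOff.integrable (Z := Z) (fun y hy => ?_) hZ (by fun_prop)
    simp [gradX2, hv y hy, hv.pd hZc _ y hy]
  have cw := continuous_waveOp hb.smooth.continuous hf
  have i2 : Integrable fun z => waveOp b f z ^ 2 * Real.exp (2 * (τ * psi x0 β z)) := by
    refine VanOff.integrable (Z := Z) (fun y hy => ?_) hZ (by fun_prop)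
    simp [hv.waveOp hZc b y hy]
  have i3 : Integrable (pd (fluxT τ β σ x0 b w) et) :=
    (hTv.pd hZc et).integrable hZ (ContDiff.pd (n := 0) hT1 et).continuous
  have i4 : ∀ i, Integrable (pd (fluxX τ β σ x0 b w i) (ex i)) := fun i =>
    ((hXv i).pd hZc _).integrable hZ (ContDiff.pd (n := 0) (hX1 i) _).continuous
  rw [← integral_const_mul]
  calc _ ≤ ∫ z, (waveOp b f z ^ 2 * Real.exp (2 * (τ * psi x0 β z))
          - pd (fluxT τ β σ x0 b w) et z - ∑ i, pd (fluxX τ β σ x0 b w i) (ex i) z) := by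
        refine integral_mono (i1.const_mul ε) ((i2.sub i3).sub (integrable_finsetSum _ fun i _ => i4 i))
          fun z => H τ hτ f hf hv z
    _ = _ := by
        rw [integral_sub (f := fun z => _ - _) (i2.sub i3)
            (integrable_finsetSum _ fun i _ => i4 i), integral_sub i2 i3, integral_finsetSum _ fun i _ => i4 i, integral_pd hT1 hZ hTv]
        simp [fun i => integral_pd (hX1 i) hZ (hXv i) (ex i)]

/-! ### Slices in time and the divergence theorem on time slabs -/

theorem hasDerivAt_timeSlice {f : P4 → ℝ} (hf : Differentiable ℝ f) (t : ℝ) (x : V3) :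
    HasDerivAt (fun s => f (s, x)) (pd f et (t, x)) t := by
  have h1 : HasDerivAt (fun s : ℝ => ((s, x) : P4)) et t :=
    (hasDerivAt_id t).prodMk (hasDerivAt_const t x)
  exact (hf (t, x)).hasFDerivAt.comp_hasDerivAt t h1

theorem pd_ex_eq_pdx_slice {f : P4 → ℝ} {t : ℝ} {x : V3} (hf : DifferentiableAt ℝ f (t, x))
    (i : Fin 3) : pd f (ex i) (t, x) = pdx (fun y => f (t, y)) i x := by
  have h1 : HasFDerivAt (fun y : V3 => ((t, y) : P4)) (ContinuousLinearMap.inr ℝ ℝ V3) x :=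
    hasFDerivAt_prodMk_right t x
  have h2 := (hf.hasFDerivAt.comp x h1).fderiv
  simp only [Function.comp_def] at h2
  simp [pd, pdx, h2, ex]

theorem contDiff_slice {n : WithTop ℕ∞} {f : P4 → ℝ} (hf : ContDiff ℝ n f) (t : ℝ) :
    ContDiff ℝ n fun x => f (t, x) :=
  hf.comp (contDiff_const.prodMk contDiff_id)

theorem VanOff.slice {Z : Set P4} {f : P4 → ℝ} (h : VanOff Z f) (t : ℝ) :
    VanOff (Prod.snd '' Z) fun x => f (t, x) :=
  fun _ hx => h _ fun hz => hx ⟨_, hz, rfl⟩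

theorem integral_slab {Z : Set P4} (hZ : IsCompact Z) {G : P4 → ℝ} {X : Fin 3 → P4 → ℝ}
    (hG : ContDiff ℝ 1 G) (hX : ∀ i, ContDiff ℝ 1 (X i)) (hGv : VanOff Z G)
    (hXv : ∀ i, VanOff Z (X i)) {t0 t1 : ℝ} (ht : t0 ≤ t1) :
    ∫ z in Icc t0 t1 ×ˢ univ, (pd G et z + ∑ i, pd (X i) (ex i) z) =
      (∫ x, G (t1, x)) - ∫ x, G (t0, x) := by
  have hZ2 : IsCompact (Prod.snd '' Z) := hZ.image continuous_snd
  have iG : Integrable (pd G et) :=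
    (hGv.pd hZ.isClosed et).integrable hZ (ContDiff.pd (n := 0) hG et).continuous
  have iX : ∀ i, Integrable (pd (X i) (ex i)) := fun i =>
    ((hXv i).pd hZ.isClosed _).integrable hZ (ContDiff.pd (n := 0) (hX i) _).continuous
  have hXz : ∀ i, ∫ z in Icc t0 t1 ×ˢ univ, pd (X i) (ex i) z = 0 := by
    intro i
    rw [Measure.volume_eq_prod, setIntegral_prod _ (iX i).integrableOn]
    have : ∀ t : ℝ, ∫ x, pd (X i) (ex i) (t, x) = 0 := by
      intro t
      simp only [fun x => pd_ex_eq_pdx_slice (t := t) (x := x) ((hX i).differentiable one_ne_zero _) i]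
      exact integral_pdx (contDiff_slice (hX i) t) hZ2 ((hXv i).slice t) i
    simp [this]
  have hGz : ∫ z in Icc t0 t1 ×ˢ univ, pd G et z = (∫ x, G (t1, x)) - ∫ x, G (t0, x) := by
    have iG' : Integrable (Function.uncurry fun (t : ℝ) (x : V3) => pd G et (t, x))
        ((volume.restrict (Icc t0 t1)).prod volume) := by
      have h1 : IntegrableOn (pd G et) (Icc t0 t1 ×ˢ univ) := iG.integrableOn
      rw [IntegrableOn, Measure.volume_eq_prod, ← Measure.prod_restrict, Measure.restrict_univ] at h1
      exact h1
    rw [Measure.volume_eq_prod, setIntegral_prod _ iG.integrableOn]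
    simp only [Measure.restrict_univ]
    rw [integral_integral_swap iG', ← integral_sub]
    · congr 1
      funext x
      rw [integral_Icc_eq_integral_Ioc, ← intervalIntegral.integral_of_le ht]
      refine intervalIntegral.integral_eq_sub_of_hasDerivAt
        (f := fun t => G (t, x)) (fun t _ => hasDerivAt_timeSlice (hG.differentiable one_ne_zero) t x) ?_
      have : Continuous fun t : ℝ => pd G et (t, x) :=
        (ContDiff.pd (n := 0) hG et).continuous.comp (by fun_prop)
      exact this.intervalIntegrable _ _
    · exact (hGv.slice t1).integrable hZ2 (contDiff_slice hG t1).continuous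
    · exact (hGv.slice t0).integrable hZ2 (contDiff_slice hG t0).continuous
  rw [integral_add iG.integrableOn (integrable_finsetSum _ fun i _ => (iX i).integrableOn), hGz,
    integral_finsetSum _ fun i _ => (iX i).integrableOn]
  simp [hXz]

/-! ### Weighted energies -/

/-- The weighted energy density. -/
def energyG (b : V3 → ℝ) (W h : P4 → ℝ) : P4 → ℝ := fun z =>
  (h z ^ 2 + b z.2 * pd h et z ^ 2 + gradX2 h z) * W z

/-- The weighted energy flux. -/
def energyX (W h : P4 → ℝ) (i : Fin 3) : P4 → ℝ := fun z =>
  -2 * (pd h et z * pd h (ex i) z * W z)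

theorem energy_identity {b : V3 → ℝ} (hb : ContDiff ℝ 1 b) {W h : P4 → ℝ} (hW : ContDiff ℝ 1 W)
    (hh : ContDiff ℝ 2 h) (z : P4) :
    pd (energyG b W h) et z + ∑ i, pd (energyX W h i) (ex i) z =
      2 * h z * pd h et z * W z + 2 * pd h et z * waveOp b h z * W z
        - 2 * ∑ i, pd h et z * pd h (ex i) z * pd W (ex i) z
        + (h z ^ 2 + b z.2 * pd h et z ^ 2 + gradX2 h z) * pd W et z := by
  have dh : Differentiable ℝ h := hh.differentiable two_ne_zero
  have dhd : ∀ d, Differentiable ℝ (pd h d) := fun d =>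
    (ContDiff.pd (n := 1) hh d).differentiable one_ne_zero
  have dht := dhd et
  have dh0 := dhd (ex 0)
  have dh1 := dhd (ex 1)
  have dh2 := dhd (ex 2)
  have dW := hW.differentiable one_ne_zero
  have db : Differentiable ℝ b := hb.differentiable one_ne_zero
  have dbs : Differentiable ℝ (fun z : P4 => b z.2) := db.comp differentiable_snd
  have c0 := fun i => pd_comm hh (ex i) et
  have hbt := pd_snd_et b db
  unfold energyG energyX gradX2 waveOp dtt slap
  simp only [Fin.sum_univ_three]
  simp (disch := fun_prop) only [pd_add, pd_mul, pd_const, pd_pow, hbt, c0]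
  simp
  ring

section

variable {Z : Set P4} {b : V3 → ℝ} {W h : P4 → ℝ}

theorem contDiff_energyG (hb : ContDiff ℝ 1 b) (hW : ContDiff ℝ 1 W) (hh : ContDiff ℝ 2 h) :
    ContDiff ℝ 1 (energyG b W h) := by
  have h0 : ContDiff ℝ 1 h := hh.of_le one_le_two
  have h1 : ∀ d, ContDiff ℝ 1 (pd h d) := fun d => ContDiff.pd (n := 1) hh d
  have ht := h1 et
  unfold energyG gradX2
  fun_prop

theorem contDiff_energyX (hW : ContDiff ℝ 1 W) (hh : ContDiff ℝ 2 h) (i : Fin 3) :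
    ContDiff ℝ 1 (energyX W h i) := by
  have h1 : ∀ d, ContDiff ℝ 1 (pd h d) := fun d => ContDiff.pd (n := 1) hh d
  have ht := h1 et
  have hx := h1 (ex i)
  unfold energyX
  fun_prop

theorem VanOff.energyG (hZ : IsClosed Z) (hv : VanOff Z h) : VanOff Z (energyG b W h) :=
  fun z hz => by simp [_root_.energyG, gradX2, hv z hz, hv.pd hZ _ z hz]

theorem VanOff.energyX (hZ : IsClosed Z) (hv : VanOff Z h) (i : Fin 3) :
    VanOff Z (energyX W h i) :=
  fun z hz => by simp [_root_.energyX, hv.pd hZ _ z hz]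

theorem energy_slab (hZ : IsCompact Z) (hb : ContDiff ℝ 1 b) (hW : ContDiff ℝ 1 W)
    (hh : ContDiff ℝ 2 h) (hv : VanOff Z h) {t0 t1 : ℝ} (ht : t0 ≤ t1) :
    (∫ x, energyG b W h (t1, x)) - ∫ x, energyG b W h (t0, x) =
      ∫ z in Icc t0 t1 ×ˢ univ, (2 * h z * pd h et z * W z + 2 * pd h et z * waveOp b h z * W z
        - 2 * ∑ i, pd h et z * pd h (ex i) z * pd W (ex i) z
        + (h z ^ 2 + b z.2 * pd h et z ^ 2 + gradX2 h z) * pd W et z) := by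
  rw [← integral_slab hZ (contDiff_energyG hb hW hh) (contDiff_energyX hW hh)
    (hv.energyG hZ.isClosed) (hv.energyX hZ.isClosed) ht]
  simp only [energy_identity hb hW hh]

end

/-! ### Carleman and energy estimates for weakly coupled systems of wave equations -/

/-- First order energy density `h² + |∇_{x,t} h|²`. -/
def energy1 (h : P4 → ℝ) : P4 → ℝ := fun z => h z ^ 2 + pd h et z ^ 2 + gradX2 h z

theorem gradX2_nonneg (h : P4 → ℝ) (z : P4) : 0 ≤ gradX2 h z :=
  Finset.sum_nonneg fun _ _ => sq_nonneg _

theorem energy1_nonneg (h : P4 → ℝ) (z : P4) : 0 ≤ energy1 h z :=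
  add_nonneg (by positivity) (gradX2_nonneg h z)

theorem continuous_gradX2 {h : P4 → ℝ} (hh : ContDiff ℝ 1 h) : Continuous (gradX2 h) :=
  continuous_finsetSum _ fun i _ => ((ContDiff.pd (n := 0) hh (ex i)).continuous).pow 2

theorem continuous_energy1 {h : P4 → ℝ} (hh : ContDiff ℝ 1 h) : Continuous (energy1 h) :=
  ((hh.continuous.pow 2).add ((ContDiff.pd (n := 0) hh et).continuous.pow 2)).add
    (continuous_gradX2 hh)

theorem VanOff.gradX2 {Z : Set P4} (hZ : IsClosed Z) {h : P4 → ℝ} (hv : VanOff Z h) :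
    VanOff Z (gradX2 h) := fun z hz => by
  simp [_root_.gradX2, hv.pd hZ _ z hz]

theorem VanOff.energy1 {Z : Set P4} (hZ : IsClosed Z) {h : P4 → ℝ} (hv : VanOff Z h) :
    VanOff Z (energy1 h) := fun z hz => by
  simp [_root_.energy1, hv z hz, hv.pd hZ _ z hz, hv.gradX2 hZ z hz]

/-- The Carleman weight `e^{2τψ}`. -/
def cw (x0 : V3) (β τ : ℝ) (z : P4) : ℝ := Real.exp (2 * (τ * psi x0 β z))

theorem cw_pos (x0 : V3) (β τ : ℝ) (z : P4) : 0 < cw x0 β τ z := Real.exp_pos _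

theorem contDiff_cw (x0 : V3) (β τ : ℝ) {n : WithTop ℕ∞} : ContDiff ℝ n (cw x0 β τ) := by
  have := contDiff_psi x0 β (n := n)
  unfold cw
  fun_prop

theorem pd_cw (x0 : V3) (β τ : ℝ) (d : P4) :
    pd (cw x0 β τ) d = fun z => 2 * τ * pd (psi x0 β) d z * cw x0 β τ z := by
  have hp : Differentiable ℝ (psi x0 β) := (contDiff_psi x0 β (n := 1)).differentiable one_ne_zero
  unfold cw
  rw [pd_exp (by fun_prop), pd_const_mul _ (by fun_prop), pd_const_mul _ hp]
  funext z; ring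

theorem two_mul_abs_mul_le (a b : ℝ) : 2 * |a * b| ≤ a ^ 2 + b ^ 2 := by
  rw [abs_mul, ← sq_abs a, ← sq_abs b]
  nlinarith [sq_nonneg (|a| - |b|)]

theorem energy_density_le {B M τ W Wt h ht s g b : ℝ} {hi Wi : Fin 3 → ℝ} (hτ : 1 ≤ τ)
    (hM : 0 ≤ M) (hB : |b| ≤ B) (hW : 0 < W) (hWt : |Wt| ≤ 2 * τ * M * W)
    (hWi : ∀ i, |Wi i| ≤ 2 * τ * M * W) (hg : g = ∑ i, hi i ^ 2) :
    2 * h * ht * W + 2 * ht * s * W - 2 * ∑ i, ht * hi i * Wi i + (h ^ 2 + b * ht ^ 2 + g) * Wt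
      ≤ (2 + 6 * M + 2 * M * (1 + B)) * τ * ((h ^ 2 + ht ^ 2 + g) * W) + s ^ 2 * W := by
  have hg0 : 0 ≤ g := hg ▸ Finset.sum_nonneg fun _ _ => sq_nonneg _
  have hB0 : 0 ≤ B := (abs_nonneg _).trans hB
  have h1 : 2 * h * ht ≤ h ^ 2 + ht ^ 2 := two_mul_le_add_sq _ _
  have h2 : 2 * ht * s ≤ ht ^ 2 + s ^ 2 := two_mul_le_add_sq _ _
  have h3 : ∀ i, -(2 * (ht * hi i * Wi i)) ≤ (ht ^ 2 + hi i ^ 2) * (2 * τ * M * W) := by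
    intro i
    calc -(2 * (ht * hi i * Wi i)) ≤ |2 * (ht * hi i * Wi i)| := neg_le_abs _
      _ = (2 * |ht * hi i|) * |Wi i| := by rw [abs_mul, abs_mul (ht * hi i)]; simp; ring
      _ ≤ _ := by
        gcongr
        · exact two_mul_abs_mul_le _ _
        · exact hWi i
  have h3' : -(2 * ∑ i, ht * hi i * Wi i) ≤ (3 * ht ^ 2 + g) * (2 * τ * M * W) := by
    have a := h3 0
    have b := h3 1
    have c := h3 2
    rw [hg]
    simp only [Fin.sum_univ_three]
    linarith
  have h4 : (h ^ 2 + b * ht ^ 2 + g) * Wt ≤ ((1 + B) * (h ^ 2 + ht ^ 2 + g)) * (2 * τ * M * W) := by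
    calc (h ^ 2 + b * ht ^ 2 + g) * Wt ≤ |(h ^ 2 + b * ht ^ 2 + g) * Wt| := le_abs_self _
      _ = |h ^ 2 + b * ht ^ 2 + g| * |Wt| := abs_mul _ _
      _ ≤ _ := by
        gcongr
        have : |b * ht ^ 2| ≤ B * ht ^ 2 := by rw [abs_mul, abs_of_nonneg (sq_nonneg ht)]; gcongr
        rw [abs_le] at this ⊢
        have e1 : 0 ≤ B * h ^ 2 := by positivity
        have e2 : 0 ≤ B * g := by positivity
        constructor <;> nlinarith [sq_nonneg h, sq_nonneg ht]
  have h5 : (2 * h * ht + 2 * ht * s) * W ≤ (2 * (h ^ 2 + ht ^ 2 + g) + s ^ 2) * W := by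
    refine mul_le_mul_of_nonneg_right ?_ hW.le
    linarith [sq_nonneg h]
  have h6 : 2 * (h ^ 2 + ht ^ 2 + g) * W ≤ 2 * τ * ((h ^ 2 + ht ^ 2 + g) * W) := by
    have : 0 ≤ (h ^ 2 + ht ^ 2 + g) * W := by positivity
    nlinarith
  have h7 : (3 * ht ^ 2 + g) * (2 * τ * M * W) ≤ 3 * (h ^ 2 + ht ^ 2 + g) * (2 * τ * M * W) := by
    gcongr
    nlinarith [sq_nonneg h]
  linarith

section

variable {x0 : V3} {β : ℝ} {Z : Set P4}

theorem exists_lt_time (hZ : IsCompact Z) : ∃ t0 < (0 : ℝ), ∀ x, (t0, x) ∉ Z := by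
  obtain ⟨a, ha⟩ := (hZ.image continuous_fst).bddBelow
  refine ⟨min a 0 - 1, by linarith [min_le_right a 0], fun x hx => ?_⟩
  have : a ≤ min a 0 - 1 := ha ⟨_, hx, rfl⟩
  linarith [min_le_left a 0]

theorem energy_trace_le (hZ : IsCompact Z) {b : V3 → ℝ} (hb : ContDiff ℝ 1 b)
    (hb0 : ∀ z ∈ Z, 0 ≤ b z.2) :
    ∃ M ≥ 0, ∀ τ ≥ (1 : ℝ), ∀ h : P4 → ℝ, ContDiff ℝ 2 h → VanOff Z h →
      ∫ x, (h (0, x) ^ 2 + gradX2 h (0, x)) * cw x0 β τ (0, x) ≤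
        M * τ * (∫ z, energy1 h z * cw x0 β τ z) + ∫ z, waveOp b h z ^ 2 * cw x0 β τ z := by
  have hψ : ∀ d, Continuous (pd (psi x0 β) d) := fun d =>
    (ContDiff.pd (n := 0) (contDiff_psi x0 β) d).continuous
  have hψt := hψ et
  have hψx := fun i => hψ (ex i)
  obtain ⟨M, hM⟩ := hZ.exists_bound_of_continuousOn
    (f := fun z : P4 => |pd (psi x0 β) et z| + ∑ i, |pd (psi x0 β) (ex i) z|) (by fun_prop)
  obtain ⟨B, hB⟩ := hZ.exists_bound_of_continuousOn (f := fun z : P4 => b z.2)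
    (hb.continuous.comp continuous_snd).continuousOn
  refine ⟨2 + 6 * |M| + 2 * |M| * (1 + |B|), by positivity, fun τ hτ h hh hv => ?_⟩
  have hZc := hZ.isClosed
  obtain ⟨t0, ht0, htZ⟩ := exists_lt_time hZ
  have hslab := energy_slab hZ hb (contDiff_cw x0 β τ (n := 1)) hh hv ht0.le
  have hG0 : ∀ x, energyG b (cw x0 β τ) h (t0, x) = 0 := fun x => hv.energyG hZc _ (htZ x)
  simp only [hG0, integral_zero, sub_zero] at hslab
  have cW := (contDiff_cw x0 β τ (n := 0)).continuous
  have h1 := hh.of_le one_le_two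
  have ce := continuous_energy1 h1
  have cwo := continuous_waveOp hb.continuous hh
  have i1 : Integrable fun z => energy1 h z * cw x0 β τ z :=
    VanOff.integrable (Z := Z) (fun z hz => by simp [hv.energy1 hZc z hz]) hZ (by fun_prop)
  have i2 : Integrable fun z => waveOp b h z ^ 2 * cw x0 β τ z :=
    VanOff.integrable (Z := Z) (fun z hz => by simp [hv.waveOp hZc b z hz]) hZ (by fun_prop)
  have hZ2 := hZ.image continuous_snd
  have cg := continuous_gradX2 h1
  have ch := hh.continuous
  calc ∫ x, (h (0, x) ^ 2 + gradX2 h (0, x)) * cw x0 β τ (0, x)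
      ≤ ∫ x, energyG b (cw x0 β τ) h (0, x) := by
        refine integral_mono ?_ ?_ fun x => ?_
        · refine VanOff.integrable (Z := Prod.snd '' Z) (fun x hx => ?_) hZ2 (by fun_prop)
          have : ((0 : ℝ), x) ∉ Z := fun hz => hx ⟨_, hz, rfl⟩
          simp [hv _ this, hv.gradX2 hZc _ this]
        · exact ((hv.energyG hZc).slice 0).integrable hZ2
            (contDiff_slice (contDiff_energyG hb (contDiff_cw x0 β τ) hh) 0).continuous
        · unfold energyG
          have := (cw_pos x0 β τ (0, x)).le
          by_cases hz : ((0 : ℝ), x) ∈ Z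
          · have := hb0 _ hz
            simp only at this ⊢
            gcongr
            nlinarith [sq_nonneg (pd h et (0, x))]
          · simp [hv.pd hZc _ _ hz]
    _ ≤ ∫ z in Icc t0 0 ×ˢ univ, ((2 + 6 * |M| + 2 * |M| * (1 + |B|)) * τ *
          (energy1 h z * cw x0 β τ z) + waveOp b h z ^ 2 * cw x0 β τ z) := by
        rw [hslab]
        refine integral_mono ?_ ((i1.const_mul _).add i2).integrableOn fun z => ?_
        · refine Integrable.integrableOn ?_
          simp only [← energy_identity hb (contDiff_cw x0 β τ (n := 1)) hh]
          refine (((hv.energyG hZc).pd hZc et).integrable hZ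
            (ContDiff.pd (n := 0) (contDiff_energyG hb (contDiff_cw x0 β τ) hh) et).continuous).add
            (integrable_finsetSum _ fun i _ => ((hv.energyX hZc i).pd hZc _).integrable hZ
            (ContDiff.pd (n := 0) (contDiff_energyX (contDiff_cw x0 β τ) hh i) _).continuous)
        · by_cases hz : z ∈ Z
          · have hMz := (le_abs_self _).trans ((hM z hz).trans (le_abs_self M))
            have hs0 : 0 ≤ ∑ i, |pd (psi x0 β) (ex i) z| := Finset.sum_nonneg fun _ _ => abs_nonneg _
            have hW := cw_pos x0 β τ z
            have key : ∀ d, |pd (psi x0 β) d z| ≤ |M| →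
                |pd (cw x0 β τ) d z| ≤ 2 * τ * |M| * cw x0 β τ z := by
              intro d hd
              rw [pd_cw, abs_mul, abs_mul, abs_of_pos hW, abs_of_nonneg (by positivity : 0 ≤ 2 * τ)]
              gcongr
            refine energy_density_le hτ (abs_nonneg M) ((hB z hz).trans (le_abs_self B)) hW
              (key et (by linarith)) (fun i => key (ex i) ?_) rfl
            have : |pd (psi x0 β) (ex i) z| ≤ ∑ i, |pd (psi x0 β) (ex i) z| :=
              Finset.single_le_sum (f := fun i => |pd (psi x0 β) (ex i) z|)
                (fun _ _ => abs_nonneg _) (Finset.mem_univ i)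
            linarith [abs_nonneg (pd (psi x0 β) et z)]
          · simp [hv z hz, hv.pd hZc _ z hz, hv.gradX2 hZc z hz, hv.energy1 hZc z hz,
              hv.waveOp hZc b z hz]
    _ ≤ ∫ z, ((2 + 6 * |M| + 2 * |M| * (1 + |B|)) * τ *
          (energy1 h z * cw x0 β τ z) + waveOp b h z ^ 2 * cw x0 β τ z) := by
        refine setIntegral_le_integral ((i1.const_mul _).add i2) (ae_of_all _ fun z => ?_)
        have := energy1_nonneg h z
        have := (cw_pos x0 β τ z).le
        simp only [Pi.zero_apply]
        positivity
    _ = _ := by rw [integral_add (i1.const_mul _) i2, integral_const_mul]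

theorem carleman_system {κ : Type*} [Fintype κ] (hβ : 0 < β) (hZ : IsCompact Z)
    {b : κ → V3 → ℝ} (hb : ∀ k, CarlemanSpeed x0 β Z (b k)) {C : ℝ} (hC : 0 ≤ C) :
    ∃ C' ≥ 0, ∃ τ0 ≥ (1 : ℝ), ∀ τ ≥ τ0, ∀ (h : κ → P4 → ℝ) (S : P4 → ℝ),
      (∀ k, ContDiff ℝ 2 (h k)) → (∀ k, VanOff Z (h k)) → Continuous S → VanOff Z S →
      (∀ z, 0 ≤ S z) → (∀ k z, waveOp (b k) (h k) z ^ 2 ≤ C * (∑ j, energy1 (h j) z + S z)) →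
      ∀ k, ∫ x, (h k (0, x) ^ 2 + gradX2 (h k) (0, x)) * cw x0 β τ (0, x)
        ≤ C' * ∫ z, S z * cw x0 β τ z := by
  choose ε hε τ1 hτ1 H using fun k => carleman_scalar hβ hZ (hb k)
  have hb0 : ∀ k, ∀ z ∈ Z, 0 ≤ b k z.2 := by
    intro k z hz
    obtain ⟨_, _, _, bmin, _, _, _, _, _, _, hbm, _, _, hbz⟩ := (hb k).bounds
    exact hbm.le.trans (hbz z hz).1
  choose M hM0 hM using fun k => energy_trace_le (x0 := x0) (β := β) hZ (hb k).smooth (hb0 k)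
  set c := ∑ k, (ε k)⁻¹ with hc
  have hc0 : 0 ≤ c := Finset.sum_nonneg fun k _ => (inv_pos.2 (hε k)).le
  set n : ℝ := (Fintype.card κ : ℝ) with hn
  have hn0 : 0 ≤ n := Nat.cast_nonneg _
  set MM := ∑ k, M k with hMM
  have hMM0 : 0 ≤ MM := Finset.sum_nonneg fun k _ => hM0 k
  refine ⟨MM * (2 * (n * (c * C))) + C * (2 * (n * (c * C)) + 1), by positivity,
    1 + ∑ k, τ1 k + 2 * (n * (c * C)), ?_, fun τ hτ h S hh hv hSc hSv hS0 hw k => ?_⟩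
  · have : 0 ≤ ∑ k, τ1 k := Finset.sum_nonneg fun k _ => by linarith [hτ1 k]
    have : 0 ≤ 2 * (n * (c * C)) := by positivity
    linarith
  have hτs : 0 ≤ ∑ k, τ1 k := Finset.sum_nonneg fun k _ => by linarith [hτ1 k]
  have hnc : 0 ≤ 2 * (n * (c * C)) := by positivity
  have hτ1' : 1 ≤ τ := by linarith
  have hτ2 : 2 * (n * (c * C)) ≤ τ := by linarith
  have hτk : ∀ k, τ1 k ≤ τ := fun k => by
    have : τ1 k ≤ ∑ k, τ1 k := Finset.single_le_sum (f := τ1)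
      (fun k _ => by linarith [hτ1 k]) (Finset.mem_univ k)
    linarith
  have hZc := hZ.isClosed
  have cW := (contDiff_cw x0 β τ (n := 0)).continuous
  have h1 := fun k => (hh k).of_le one_le_two
  have ce := fun k => continuous_energy1 (h1 k)
  have cwo := fun k => continuous_waveOp (hb k).smooth.continuous (hh k)
  have i1 : ∀ k, Integrable fun z => energy1 (h k) z * cw x0 β τ z := fun k =>
    VanOff.integrable (Z := Z) (fun z hz => by simp [(hv k).energy1 hZc z hz]) hZ ((ce k).mul cW)
  have i2 : ∀ k, Integrable fun z => waveOp (b k) (h k) z ^ 2 * cw x0 β τ z := fun k =>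
    VanOff.integrable (Z := Z) (fun z hz => by simp [(hv k).waveOp hZc _ z hz]) hZ
      (((cwo k).pow 2).mul cW)
  have i3 : Integrable fun z => S z * cw x0 β τ z :=
    VanOff.integrable (Z := Z) (fun z hz => by simp [hSv z hz]) hZ (hSc.mul cW)
  set I := fun k => ∫ z, energy1 (h k) z * cw x0 β τ z with hI
  set J := ∫ z, S z * cw x0 β τ z with hJ
  have hI0 : ∀ k, 0 ≤ I k := fun k =>
    integral_nonneg fun z => mul_nonneg (energy1_nonneg _ _) (cw_pos _ _ _ _).le
  have hJ0 : 0 ≤ J := integral_nonneg fun z => mul_nonneg (hS0 z) (cw_pos _ _ _ _).le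
  have hS : 0 ≤ ∑ k, I k := Finset.sum_nonneg fun k _ => hI0 k
  have hw2 : ∀ k, ∫ z, waveOp (b k) (h k) z ^ 2 * cw x0 β τ z ≤ C * (∑ k, I k + J) := by
    intro k
    calc ∫ z, waveOp (b k) (h k) z ^ 2 * cw x0 β τ z
        ≤ ∫ z, C * (∑ j, energy1 (h j) z * cw x0 β τ z + S z * cw x0 β τ z) := by
          refine integral_mono (i2 k) (((integrable_finsetSum _ fun j _ => i1 j).add i3).const_mul C)
            fun z => ?_
          have := hw k z
          have hp := (cw_pos x0 β τ z).le
          simp only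
          rw [← Finset.sum_mul, ← add_mul, ← mul_assoc]
          gcongr
      _ = _ := by
          rw [integral_const_mul, integral_add (integrable_finsetSum _ fun j _ => i1 j) i3,
            integral_finsetSum _ fun j _ => i1 j]
  have hIk : ∀ k, τ * I k ≤ c * (C * (∑ k, I k + J)) := by
    intro k
    have hpos : 0 < ε k := hε k
    have hc1 : (ε k)⁻¹ ≤ c := Finset.single_le_sum (f := fun k => (ε k)⁻¹)
      (fun k _ => (inv_pos.2 (hε k)).le) (Finset.mem_univ k)
    have hH := H k τ (hτk k) (h k) (hh k) (hv k)
    have hle : τ * I k ≤ ∫ z, (τ * (pd (h k) et z ^ 2 + gradX2 (h k) z) + τ ^ 3 * h k z ^ 2)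
        * Real.exp (2 * (τ * psi x0 β z)) := by
      rw [hI, ← integral_const_mul]
      refine integral_mono ((i1 k).const_mul τ) ?_ fun z => ?_
      · have c1 := (ContDiff.pd (n := 0) (h1 k) et).continuous
        have c2 := continuous_gradX2 (h1 k)
        have c3 := (hh k).continuous
        have c4 := (contDiff_psi x0 β (n := 0)).continuous
        refine VanOff.integrable (Z := Z) (fun z hz => ?_) hZ (by fun_prop)
        simp [hv k z hz, (hv k).pd hZc _ z hz, (hv k).gradX2 hZc z hz]
      · have : τ * (energy1 (h k) z * cw x0 β τ z) = (τ * energy1 (h k) z) * cw x0 β τ z := by ring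
        simp only [this]
        change _ ≤ _ * cw x0 β τ z
        have := (cw_pos x0 β τ z).le
        gcongr
        unfold energy1
        have : τ * h k z ^ 2 ≤ τ ^ 3 * h k z ^ 2 := by
          gcongr
          nlinarith [sq_nonneg τ]
        linarith
    calc τ * I k ≤ (ε k)⁻¹ * (ε k * (τ * I k)) := by rw [← mul_assoc]; field_simp; rfl
      _ ≤ (ε k)⁻¹ * ∫ z, waveOp (b k) (h k) z ^ 2 * cw x0 β τ z := by
          refine mul_le_mul_of_nonneg_left ((mul_le_mul_of_nonneg_left hle hpos.le).trans hH) ?_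
          positivity
      _ ≤ (ε k)⁻¹ * (C * (∑ k, I k + J)) := by gcongr; exact hw2 k
      _ ≤ _ := by gcongr
  have hsum : τ * ∑ k, I k ≤ n * (c * (C * (∑ k, I k + J))) := by
    rw [Finset.mul_sum]
    refine (Finset.sum_le_sum fun k _ => hIk k).trans ?_
    simp [hn]
  have hsum2 : τ * ∑ k, I k ≤ 2 * (n * (c * C)) * J := by
    have : 2 * (n * (c * C)) * ∑ k, I k ≤ τ * ∑ k, I k := by gcongr
    linarith
  have hsum3 : ∑ k, I k ≤ 2 * (n * (c * C)) * J := by nlinarith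
  have hMk : M k ≤ MM := Finset.single_le_sum (f := M) (fun k _ => hM0 k) (Finset.mem_univ k)
  have hIle : I k ≤ ∑ k, I k := Finset.single_le_sum (fun k _ => hI0 k) (Finset.mem_univ k)
  calc _ ≤ M k * τ * I k + ∫ z, waveOp (b k) (h k) z ^ 2 * cw x0 β τ z :=
        hM k τ hτ1' (h k) (hh k) (hv k)
    _ ≤ MM * (τ * ∑ k, I k) + C * (∑ k, I k + J) := by
        refine add_le_add ?_ (hw2 k)
        rw [mul_assoc]
        have := hI0 k
        gcongr
    _ ≤ MM * (2 * (n * (c * C)) * J) + C * (2 * (n * (c * C)) * J + J) := by gcongr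
    _ = _ := by ring

end

/-! ### Uniqueness for the Cauchy problem for weakly coupled wave systems -/

theorem pd_time_weight (N : ℝ) :
    pd (fun z => Real.exp (N * z.1)) et = (fun z => N * Real.exp (N * z.1)) ∧
      ∀ i, pd (fun z => Real.exp (N * z.1)) (ex i) = fun _ => 0 := by
  constructor
  · rw [pd_exp (by fun_prop), pd_const_mul _ (by fun_prop), pd_time_et]
    funext z; ring
  · intro i
    rw [pd_exp (by fun_prop), pd_const_mul _ (by fun_prop), pd_time_ex]
    funext z; ring

section

variable {κ : Type*} [Fintype κ] {Z : Set P4} {b : κ → V3 → ℝ} {h : κ → P4 → ℝ}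

/-- Bound for the density in the energy identity for a system with exponential time weight. -/
theorem abs_sum_energy_rhs_le {C W : ℝ} {z : P4} (hW : 0 ≤ W)
    (hw : ∀ k, waveOp (b k) (h k) z ^ 2 ≤ C * ∑ j, energy1 (h j) z) :
    |∑ k, (2 * h k z * pd (h k) et z * W + 2 * pd (h k) et z * waveOp (b k) (h k) z * W)|
      ≤ (2 + Fintype.card κ * C) * (∑ j, energy1 (h j) z) * W := by
  calc _ ≤ ∑ k, |2 * h k z * pd (h k) et z * W + 2 * pd (h k) et z * waveOp (b k) (h k) z * W| :=
        Finset.abs_sum_le_sum_abs _ _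
    _ ≤ ∑ k, (2 * energy1 (h k) z + C * ∑ j, energy1 (h j) z) * W := by
        refine Finset.sum_le_sum fun k _ => ?_
        have h1 := two_mul_abs_mul_le (h k z) (pd (h k) et z)
        have h2 := two_mul_abs_mul_le (pd (h k) et z) (waveOp (b k) (h k) z)
        have h3 := gradX2_nonneg (h k) z
        have : 2 * h k z * pd (h k) et z * W + 2 * pd (h k) et z * waveOp (b k) (h k) z * W
          = (2 * (h k z * pd (h k) et z) + 2 * (pd (h k) et z * waveOp (b k) (h k) z)) * W := by
          ring
        rw [this, abs_mul, abs_of_nonneg hW]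
        refine mul_le_mul_of_nonneg_right ?_ hW
        refine (abs_add_le _ _).trans ?_
        rw [abs_mul, abs_mul 2 (_ * _), abs_two]
        have := hw k
        unfold energy1 at this ⊢
        linarith [sq_nonneg (h k z)]
    _ = _ := by
        rw [← Finset.sum_mul, Finset.sum_add_distrib, ← Finset.mul_sum]
        rw [Finset.sum_const, Finset.card_univ, nsmul_eq_mul]
        ring

theorem wave_system_unique (hZ : IsCompact Z) (hb : ∀ k, ContDiff ℝ 1 (b k)) {bmin : ℝ}
    (hbm : 0 < bmin) (hbZ : ∀ k, ∀ z ∈ Z, bmin ≤ b k z.2) (hh : ∀ k, ContDiff ℝ 2 (h k))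
    (hv : ∀ k, VanOff Z (h k)) {C ts : ℝ} (hC : 0 ≤ C)
    (hw : ∀ k z, |z.1| ≤ ts → waveOp (b k) (h k) z ^ 2 ≤ C * ∑ j, energy1 (h j) z)
    (h0 : ∀ k x, h k (0, x) = 0) (h0t : ∀ k x, pd (h k) et (0, x) = 0) :
    ∀ k z, |z.1| ≤ ts → h k z = 0 := by
  have hZc := hZ.isClosed
  have hZ2 := hZ.image continuous_snd
  set m := min 1 bmin with hm
  have hm0 : 0 < m := lt_min one_pos hbm
  set L := 2 + Fintype.card κ * C with hL
  have hL0 : 0 ≤ L := by positivity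
  have h0x : ∀ k i x, pd (h k) (ex i) (0, x) = 0 := by
    intro k i x
    rw [pd_ex_eq_pdx_slice ((hh k).differentiable two_ne_zero _)]
    simp only [h0, pdx_const]
  have hE0 : ∀ k W x, energyG (b k) W (h k) (0, x) = 0 := by
    intro k W x
    simp [energyG, gradX2, h0, h0t, h0x]
  have hEm : ∀ k z, m * energy1 (h k) z ≤ h k z ^ 2 + b k z.2 * pd (h k) et z ^ 2 + gradX2 (h k) z := by
    intro k z
    by_cases hz : z ∈ Z
    · have h1 : m ≤ 1 := min_le_left _ _
      have h2 : m ≤ b k z.2 := (min_le_right _ _).trans (hbZ k z hz)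
      have h3 := gradX2_nonneg (h k) z
      have h4 : m * h k z ^ 2 ≤ 1 * h k z ^ 2 := by gcongr
      have h5 : m * pd (h k) et z ^ 2 ≤ b k z.2 * pd (h k) et z ^ 2 := by gcongr
      have h6 : m * gradX2 (h k) z ≤ 1 * gradX2 (h k) z := by gcongr
      unfold energy1
      linarith
    · simp [hv k z hz, (hv k).pd hZc _ z hz, (hv k).gradX2 hZc z hz, (hv k).energy1 hZc z hz]
  have hW : ∀ N : ℝ, ContDiff ℝ 1 fun z : P4 => Real.exp (N * z.1) := fun N => by fun_prop
  have hint : ∀ (N : ℝ) k, Integrable fun z => 2 * h k z * pd (h k) et z * Real.exp (N * z.1)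
      + 2 * pd (h k) et z * waveOp (b k) (h k) z * Real.exp (N * z.1)
        - 2 * ∑ i, pd (h k) et z * pd (h k) (ex i) z * pd (fun z => Real.exp (N * z.1)) (ex i) z
        + (h k z ^ 2 + b k z.2 * pd (h k) et z ^ 2 + gradX2 (h k) z)
          * pd (fun z => Real.exp (N * z.1)) et z := by
    intro N k
    simp only [← energy_identity (hb k) (hW N) (hh k)]
    exact ((((hv k).energyG hZc).pd hZc et).integrable hZ
      (ContDiff.pd (n := 0) (contDiff_energyG (hb k) (hW N) (hh k)) et).continuous).add
      (integrable_finsetSum _ fun i _ => (((hv k).energyX hZc i).pd hZc _).integrable hZ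
      (ContDiff.pd (n := 0) (contDiff_energyX (hW N) (hh k) i) _).continuous)
  have hstep : ∀ (N : ℝ) (z : P4), |z.1| ≤ ts →
      |∑ k, (2 * h k z * pd (h k) et z * Real.exp (N * z.1)
      + 2 * pd (h k) et z * waveOp (b k) (h k) z * Real.exp (N * z.1))| ≤
        L / m * (∑ k, (h k z ^ 2 + b k z.2 * pd (h k) et z ^ 2 + gradX2 (h k) z))
          * Real.exp (N * z.1) := by
    intro N z hz
    refine (abs_sum_energy_rhs_le (Real.exp_pos _).le fun k => hw k z hz).trans ?_
    have : ∑ k, energy1 (h k) z ≤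
        m⁻¹ * ∑ k, (h k z ^ 2 + b k z.2 * pd (h k) et z ^ 2 + gradX2 (h k) z) := by
      rw [Finset.mul_sum]
      refine Finset.sum_le_sum fun k _ => ?_
      rw [← div_eq_inv_mul, le_div_iff₀ hm0, mul_comm]
      exact hEm k z
    calc _ ≤ L * (m⁻¹ * ∑ k, (h k z ^ 2 + b k z.2 * pd (h k) et z ^ 2 + gradX2 (h k) z))
          * Real.exp (N * z.1) := by gcongr
      _ = _ := by ring
  have hconc : ∀ (N t : ℝ), ∑ k, ∫ x, energyG (b k) (fun z => Real.exp (N * z.1)) (h k) (t, x) ≤ 0 →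
      ∀ k x, h k (t, x) = 0 := by
    intro N t hle k x
    have hnn : ∀ k x, 0 ≤ energyG (b k) (fun z => Real.exp (N * z.1)) (h k) (t, x) := by
      intro k x
      have h1 := hEm k (t, x)
      have h2 := mul_nonneg hm0.le (energy1_nonneg (h k) (t, x))
      exact mul_nonneg (h2.trans h1) (Real.exp_pos _).le
    have hz : ∫ x, energyG (b k) (fun z => Real.exp (N * z.1)) (h k) (t, x) = 0 := by
      have h3 : ∀ k ∈ Finset.univ, 0 ≤ ∫ x, energyG (b k) (fun z => Real.exp (N * z.1)) (h k) (t, x) :=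
        fun k _ => integral_nonneg (hnn k)
      have h4 := le_antisymm hle (Finset.sum_nonneg h3)
      exact (Finset.sum_eq_zero_iff_of_nonneg h3).1 h4 k (Finset.mem_univ k)
    have hcont := (contDiff_slice (contDiff_energyG (hb k) (hW N) (hh k)) t).continuous
    rw [integral_eq_zero_iff_of_nonneg (hnn k)
      ((((hv k).energyG hZc).slice t).integrable hZ2 hcont)] at hz
    have h5 := congrFun ((hcont.ae_eq_iff_eq volume continuous_const).1 hz) x
    have h6 := hEm k (t, x)
    have h7 : h k (t, x) ^ 2 + b k x * pd (h k) et (t, x) ^ 2 + gradX2 (h k) (t, x) = 0 := by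
      exact (mul_eq_zero.1 h5).resolve_right (Real.exp_ne_zero _)
    have h8 := energy1_nonneg (h k) (t, x)
    have h9 : energy1 (h k) (t, x) ≤ 0 := by
      simp only [h7] at h6
      nlinarith
    unfold energy1 at h9
    have h10 := gradX2_nonneg (h k) (t, x)
    have : h k (t, x) ^ 2 = 0 := by
      nlinarith [sq_nonneg (h k (t, x)), sq_nonneg (pd (h k) et (t, x))]
    simpa using this
  rintro k ⟨t, x⟩ ht
  simp only at ht
  rcases le_total 0 t with ht0 | ht0
  · refine hconc (-(L / m)) t ?_ k x
    have hs := fun k => energy_slab hZ (hb k) (hW (-(L / m))) (hh k) (hv k) ht0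
    simp only [hE0, integral_zero, sub_zero] at hs
    simp only [hs]
    rw [← integral_finsetSum _ fun k _ => (hint _ k).integrableOn]
    refine setIntegral_nonpos (measurableSet_Icc.prod MeasurableSet.univ) fun z hz => ?_
    have hzt : |z.1| ≤ ts := by
      rw [abs_of_nonneg hz.1.1]; exact hz.1.2.trans ((le_abs_self t).trans ht)
    simp only [(pd_time_weight _).1, (pd_time_weight _).2, mul_zero, Finset.sum_const_zero, sub_zero]
    rw [Finset.sum_add_distrib, ← Finset.sum_mul]
    have := (abs_le.1 (hstep (-(L / m)) z hzt)).2
    linarith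
  · refine hconc (L / m) t ?_ k x
    have hs := fun k => energy_slab hZ (hb k) (hW (L / m)) (hh k) (hv k) ht0
    simp only [hE0, integral_zero, zero_sub, neg_eq_iff_eq_neg] at hs
    simp only [hs]
    rw [Finset.sum_neg_distrib, ← integral_finsetSum _ fun k _ => (hint _ k).integrableOn,
      neg_nonpos]
    refine setIntegral_nonneg (measurableSet_Icc.prod MeasurableSet.univ) fun z hz => ?_
    have hzt : |z.1| ≤ ts := by
      rw [abs_of_nonpos hz.1.2]
      rw [abs_of_nonpos ht0] at ht
      linarith [hz.1.1]
    simp only [(pd_time_weight _).1, (pd_time_weight _).2, mul_zero, Finset.sum_const_zero, sub_zero]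
    rw [Finset.sum_add_distrib, ← Finset.sum_mul]
    have := (abs_le.1 (hstep (L / m) z hzt)).1
    linarith

end

/-! ### Functions controlled by a given density on a compact set -/

/-- `X` is bounded on `Z` by a multiple of the density `E`. -/
def LO (Z : Set P4) (E X : P4 → ℝ) : Prop := ∃ C, ∀ z ∈ Z, |X z| ≤ C * E z

namespace LO

variable {Z : Set P4} {E X Y : P4 → ℝ}

theorem congr (h : LO Z E X) (he : ∀ z ∈ Z, Y z = X z) : LO Z E Y := by
  obtain ⟨C, hC⟩ := h
  exact ⟨C, fun z hz => by rw [he z hz]; exact hC z hz⟩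

theorem add (hX : LO Z E X) (hY : LO Z E Y) : LO Z E fun z => X z + Y z := by
  obtain ⟨C, hC⟩ := hX
  obtain ⟨D, hD⟩ := hY
  exact ⟨C + D, fun z hz => (abs_add_le _ _).trans (by linarith [hC z hz, hD z hz])⟩

theorem neg (hX : LO Z E X) : LO Z E fun z => - X z := by
  obtain ⟨C, hC⟩ := hX
  exact ⟨C, fun z hz => by rw [abs_neg]; exact hC z hz⟩

theorem sub (hX : LO Z E X) (hY : LO Z E Y) : LO Z E fun z => X z - Y z := by
  simpa [sub_eq_add_neg] using hX.add hY.neg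

theorem sum {ι : Type*} (s : Finset ι) {X : ι → P4 → ℝ} (h : ∀ i, LO Z E (X i)) :
    LO Z E fun z => ∑ i ∈ s, X i z := by
  choose C hC using h
  refine ⟨∑ i ∈ s, C i, fun z hz => ?_⟩
  rw [Finset.sum_mul]
  exact (Finset.abs_sum_le_sum_abs _ _).trans (Finset.sum_le_sum fun i _ => hC i z hz)

theorem coef (hZ : IsCompact Z) {c : P4 → ℝ} (hc : ContinuousOn c Z) (hX : LO Z E X) :
    LO Z E fun z => c z * X z := by
  obtain ⟨C, hC⟩ := hX
  obtain ⟨M, hM⟩ := hZ.exists_bound_of_continuousOn hc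
  refine ⟨|M| * C, fun z hz => ?_⟩
  rw [abs_mul, mul_assoc]
  exact mul_le_mul ((hM z hz).trans (le_abs_self M)) (hC z hz) (abs_nonneg _) (abs_nonneg _)

theorem coefX (hZ : IsCompact Z) {c : V3 → ℝ} (hc : Continuous c) (hX : LO Z E X) :
    LO Z E fun z => c z.2 * X z :=
  hX.coef (c := fun z => c z.2) hZ (hc.comp continuous_snd).continuousOn

theorem of_mul (hZ : IsCompact Z) {c : P4 → ℝ} (hc : ContinuousOn c Z) (h0 : ∀ z ∈ Z, c z ≠ 0)
    (hX : LO Z E fun z => c z * X z) : LO Z E X :=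
  (hX.coef hZ (hc.inv₀ h0)).congr fun z hz => by
    simp only [Pi.inv_apply]
    rw [inv_mul_cancel_left₀ (h0 z hz)]

theorem pd_mul_sub (hZ : IsCompact Z) {c : V3 → ℝ} (hc : ContDiff ℝ 1 c) (hX : LO Z E X)
    (hX1 : Differentiable ℝ X) (k : Fin 3) :
    LO Z E fun z => pd (fun y => c y.2 * X y) (ex k) z - c z.2 * pd X (ex k) z := by
  have dc : Differentiable ℝ fun z : P4 => c z.2 :=
    (hc.differentiable one_ne_zero).comp differentiable_snd
  refine (hX.coefX hZ (ContDiff.pdx (n := 0) hc k).continuous).congr fun z _ => ?_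
  rw [pd_mul dc hX1, pd_snd_ex c (hc.differentiable one_ne_zero)]
  ring

end LO

/-! ### Reduction of Biot's system -/

theorem ContDiff.sdiv {n : ℕ} {v : P4 → V3} (hv : ∀ i, ContDiff ℝ (n + 1 : ℕ) fun y => v y i) :
    ContDiff ℝ n (sdiv v) := by
  unfold _root_.sdiv
  exact ContDiff.sum fun i _ => ContDiff.pd (hv i) (ex i)

theorem ContDiff.slap {n : ℕ} {f : P4 → ℝ} (hf : ContDiff ℝ (n + 2 : ℕ) f) :
    ContDiff ℝ n (slap f) := by
  unfold _root_.slap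
  exact ContDiff.sum fun i _ => ContDiff.pd (ContDiff.pd (n := n + 1) hf (ex i)) (ex i)

theorem pd_slap {f : P4 → ℝ} (hf : ContDiff ℝ 3 f) (d : P4) : pd (slap f) d = slap (pd f d) := by
  have h1 : ∀ e, ContDiff ℝ 2 (pd f e) := fun e => ContDiff.pd (n := 2) hf e
  have h2 : ∀ i, Differentiable ℝ (pd (pd f (ex i)) (ex i)) := fun i =>
    (ContDiff.pd (n := 1) (h1 _) (ex i)).differentiable one_ne_zero
  unfold slap
  rw [pd_sum _ h2]
  funext z
  refine Finset.sum_congr rfl fun i _ => ?_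
  rw [pd_comm (h1 _), pd_comm (hf.of_le (by norm_num)) (ex i) d]

theorem pd_dtt {f : P4 → ℝ} (hf : ContDiff ℝ 3 f) (d : P4) : pd (dtt f) d = dtt (pd f d) := by
  unfold dtt
  rw [pd_comm (ContDiff.pd (n := 2) hf et), pd_comm (hf.of_le (by norm_num)) et d]

section Row

variable {Z : Set P4} {E : P4 → ℝ} {ϱ A B μ lam q r : V3 → ℝ} {v w F1 F2 : P4 → V3}
  {N : Fin 3 → P4 → ℝ}

theorem row_expand (hq : ContDiff ℝ 2 q) (hr : ContDiff ℝ 2 r)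
    (hv : ∀ i, ContDiff ℝ 3 fun y => v y i) (hw : ∀ i, ContDiff ℝ 3 fun y => w y i)
    (hN : ∀ z i, ϱ z.2 * dtt (N i) z =
      A z.2 * (lameOp μ lam v z i + pd (fun y => q y.2 * sdiv w y) (ex i) z + F1 z i)
      + B z.2 * (pd (fun y => q y.2 * sdiv v y) (ex i) z
        + pd (fun y => r y.2 * sdiv w y) (ex i) z + F2 z i)) (i : Fin 3) :
    (fun z => ϱ z.2 * dtt (N i) z) = fun z =>
      (A z.2 * μ z.2) * slap (fun y => v y i) z
      + (A z.2 * (μ z.2 + lam z.2) + B z.2 * q z.2) * pd (sdiv v) (ex i) z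
      + (A z.2 * q z.2 + B z.2 * r z.2) * pd (sdiv w) (ex i) z
      + ∑ j, (A z.2 * pdx μ j z.2) * (pd (fun y => v y i) (ex j) z + pd (fun y => v y j) (ex i) z)
      + (A z.2 * pdx lam i z.2 + B z.2 * pdx q i z.2) * sdiv v z
      + (A z.2 * pdx q i z.2 + B z.2 * pdx r i z.2) * sdiv w z
      + A z.2 * F1 z i + B z.2 * F2 z i := by
  funext z
  have dq := hq.differentiable two_ne_zero
  have dr := hr.differentiable two_ne_zero
  have dqs : Differentiable ℝ fun z : P4 => q z.2 := dq.comp differentiable_snd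
  have drs : Differentiable ℝ fun z : P4 => r z.2 := dr.comp differentiable_snd
  have de : Differentiable ℝ (sdiv v) := (ContDiff.sdiv (n := 2) hv).differentiable two_ne_zero
  have df : Differentiable ℝ (sdiv w) := (ContDiff.sdiv (n := 2) hw).differentiable two_ne_zero
  rw [hN, pd_mul dqs df, pd_mul dqs de, pd_mul drs df]
  simp only [pd_snd_ex q dq, pd_snd_ex r dr, lameOp, Fin.sum_univ_three]
  ring

theorem row_LO (hZ : IsCompact Z) (hϱ : ContDiff ℝ 2 ϱ) (hA : ContDiff ℝ 2 A) (hB : ContDiff ℝ 2 B)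
    (hμ : ContDiff ℝ 2 μ) (hlam : ContDiff ℝ 2 lam)
    (hq : ContDiff ℝ 2 q) (hr : ContDiff ℝ 2 r) (hϱ0 : ∀ z ∈ Z, ϱ z.2 ≠ 0)
    (hv : ∀ i, ContDiff ℝ 3 fun y => v y i) (hw : ∀ i, ContDiff ℝ 3 fun y => w y i)
    (hNs : ∀ i, ContDiff ℝ 3 (N i))
    (hF1 : ∀ i, ContDiff ℝ 1 fun y => F1 y i) (hF2 : ∀ i, ContDiff ℝ 1 fun y => F2 y i)
    (hN : ∀ z i, ϱ z.2 * dtt (N i) z =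
      A z.2 * (lameOp μ lam v z i + pd (fun y => q y.2 * sdiv w y) (ex i) z + F1 z i)
      + B z.2 * (pd (fun y => q y.2 * sdiv v y) (ex i) z
        + pd (fun y => r y.2 * sdiv w y) (ex i) z + F2 z i))
    (lv : ∀ i j, LO Z E (pd (fun y => v y i) (ex j))) (lΔ : ∀ i, LO Z E (slap fun y => v y i))
    (le : LO Z E (sdiv v)) (lex : ∀ i, LO Z E (pd (sdiv v) (ex i)))
    (lf : LO Z E (sdiv w)) (lfx : ∀ i, LO Z E (pd (sdiv w) (ex i)))
    (l1 : ∀ i, LO Z E fun y => F1 y i) (l1x : ∀ i j, LO Z E (pd (fun y => F1 y i) (ex j)))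
    (l2 : ∀ i, LO Z E fun y => F2 y i) (l2x : ∀ i j, LO Z E (pd (fun y => F2 y i) (ex j))) :
    (∀ i, LO Z E (dtt (N i))) ∧ ∀ i k, LO Z E fun z =>
      ϱ z.2 * pd (dtt (N i)) (ex k) z - (A z.2 * μ z.2) * pd (slap fun y => v y i) (ex k) z
      - (A z.2 * (μ z.2 + lam z.2) + B z.2 * q z.2) * pd (pd (sdiv v) (ex i)) (ex k) z
      - (A z.2 * q z.2 + B z.2 * r z.2) * pd (pd (sdiv w) (ex i)) (ex k) z
      - ∑ j, (A z.2 * pdx μ j z.2) * (pd (pd (fun y => v y i) (ex j)) (ex k) z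
          + pd (pd (fun y => v y j) (ex i)) (ex k) z) := by
  have hexp := row_expand hq hr hv hw hN
  have cμ : ∀ j, ContDiff ℝ 1 (pdx μ j) := fun j => ContDiff.pdx (n := 1) hμ j
  have clam : ∀ j, ContDiff ℝ 1 (pdx lam j) := fun j => ContDiff.pdx (n := 1) hlam j
  have cq : ∀ j, ContDiff ℝ 1 (pdx q j) := fun j => ContDiff.pdx (n := 1) hq j
  have cr : ∀ j, ContDiff ℝ 1 (pdx r j) := fun j => ContDiff.pdx (n := 1) hr j
  have kϱ := hϱ.of_le (one_le_two (α := WithTop ℕ∞))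
  have kA := hA.of_le (one_le_two (α := WithTop ℕ∞))
  have kB := hB.of_le (one_le_two (α := WithTop ℕ∞))
  have kμ := hμ.of_le (one_le_two (α := WithTop ℕ∞))
  have kl := hlam.of_le (one_le_two (α := WithTop ℕ∞))
  have kq := hq.of_le (one_le_two (α := WithTop ℕ∞))
  have kr := hr.of_le (one_le_two (α := WithTop ℕ∞))
  have c1 : ContDiff ℝ 1 fun x => A x * μ x := by fun_prop
  have c2 : ContDiff ℝ 1 fun x => A x * (μ x + lam x) + B x * q x := by fun_prop
  have c3 : ContDiff ℝ 1 fun x => A x * q x + B x * r x := by fun_prop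
  have c4 : ∀ j, ContDiff ℝ 1 fun x => A x * pdx μ j x := fun j => by
    have := cμ j; fun_prop
  have c5 : ∀ i, ContDiff ℝ 1 fun x => A x * pdx lam i x + B x * pdx q i x := fun i => by
    have := cq i; have := clam i; fun_prop
  have c6 : ∀ i, ContDiff ℝ 1 fun x => A x * pdx q i x + B x * pdx r i x := fun i => by
    have := cq i; have := cr i; fun_prop
  have lsym : ∀ i j, LO Z E fun z => pd (fun y => v y i) (ex j) z + pd (fun y => v y j) (ex i) z :=
    fun i j => (lv i j).add (lv j i)
  have hdtt : ∀ i, LO Z E (dtt (N i)) := by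
    intro i
    refine LO.of_mul hZ (hϱ.continuous.comp continuous_snd).continuousOn hϱ0 ?_
    refine LO.congr ((((((((lΔ i).coefX hZ c1.continuous).add ((lex i).coefX hZ c2.continuous)).add
      ((lfx i).coefX hZ c3.continuous)).add
      (LO.sum Finset.univ fun j => (lsym i j).coefX hZ (c4 j).continuous)).add
      (le.coefX hZ (c5 i).continuous)).add (lf.coefX hZ (c6 i).continuous)).add
      ((l1 i).coefX hZ hA.continuous) |>.add ((l2 i).coefX hZ hB.continuous)) fun z _ => ?_
    exact congrFun (hexp i) z
  refine ⟨hdtt, fun i k => ?_⟩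
  have dv : ∀ i j, ContDiff ℝ 1 (pd (fun y => v y i) (ex j)) := fun i j =>
    (ContDiff.pd (n := 2) (hv i) (ex j)).of_le one_le_two
  have s0 : Differentiable ℝ (dtt (N i)) :=
    (ContDiff.pd (n := 1) (ContDiff.pd (n := 2) (hNs i) et) et).differentiable one_ne_zero
  have s1 : Differentiable ℝ (slap fun y => v y i) :=
    (ContDiff.slap (n := 1) (hv i)).differentiable one_ne_zero
  have s2 : Differentiable ℝ (pd (sdiv v) (ex i)) :=
    (ContDiff.pd (n := 1) (ContDiff.sdiv (n := 2) hv) _).differentiable one_ne_zero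
  have s3 : Differentiable ℝ (pd (sdiv w) (ex i)) :=
    (ContDiff.pd (n := 1) (ContDiff.sdiv (n := 2) hw) _).differentiable one_ne_zero
  have s4 : ∀ i j, Differentiable ℝ (pd (fun y => v y i) (ex j)) := fun i j =>
    (dv i j).differentiable one_ne_zero
  have s4' : ∀ j, Differentiable ℝ fun z =>
      pd (fun y => v y i) (ex j) z + pd (fun y => v y j) (ex i) z := fun j =>
    (s4 i j).add (s4 j i)
  have s5 : Differentiable ℝ (sdiv v) := (ContDiff.sdiv (n := 2) hv).differentiable two_ne_zero
  have s6 : Differentiable ℝ (sdiv w) := (ContDiff.sdiv (n := 2) hw).differentiable two_ne_zero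
  have s7 : Differentiable ℝ fun y => F1 y i := (hF1 i).differentiable one_ne_zero
  have s8 : Differentiable ℝ fun y => F2 y i := (hF2 i).differentiable one_ne_zero
  have dm : ∀ {c : V3 → ℝ} {X : P4 → ℝ}, ContDiff ℝ 1 c → Differentiable ℝ X →
      Differentiable ℝ fun z : P4 => c z.2 * X z := fun hc hX =>
    ((hc.differentiable one_ne_zero).comp differentiable_snd).mul hX
  have t0 := (hdtt i).pd_mul_sub hZ kϱ s0 k
  have t1 := (lΔ i).pd_mul_sub hZ c1 s1 k
  have t2 := (lex i).pd_mul_sub hZ c2 s2 k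
  have t3 := (lfx i).pd_mul_sub hZ c3 s3 k
  have t4 := LO.sum Finset.univ fun j => (lsym i j).pd_mul_sub hZ (c4 j) (s4' j) k
  have t5 := (le.pd_mul_sub hZ (c5 i) s5 k).add ((lex k).coefX hZ (c5 i).continuous)
  have t6 := (lf.pd_mul_sub hZ (c6 i) s6 k).add ((lfx k).coefX hZ (c6 i).continuous)
  have t7 := ((l1 i).pd_mul_sub hZ kA s7 k).add ((l1x i k).coefX hZ hA.continuous)
  have t8 := ((l2 i).pd_mul_sub hZ kB s8 k).add ((l2x i k).coefX hZ hB.continuous)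
  refine ((((((((t1.add t2).add t3).add t4).add t5).add t6).add t7).add t8).sub t0).congr
    fun z _ => ?_
  have hpd := congrArg (fun H => pd H (ex k) z) (hexp i)
  have m1 := dm c1 s1
  have m2 := dm c2 s2
  have m3 := dm c3 s3
  have m4 := fun j => dm (c4 j) (s4' j)
  have m4' : Differentiable ℝ fun z => ∑ j, (A z.2 * pdx μ j z.2) *
      (pd (fun y => v y i) (ex j) z + pd (fun y => v y j) (ex i) z) :=
    Differentiable.fun_sum fun j _ => m4 j
  have m5 := dm (c5 i) s5
  have m6 := dm (c6 i) s6
  have m7 := dm kA s7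
  have m8 := dm kB s8
  beta_reduce at hpd
  have a2 := m1.fun_add m2
  have a3 := a2.fun_add m3
  have a4 := a3.fun_add m4'
  have a5 := a4.fun_add m5
  have a6 := a5.fun_add m6
  have a7 := a6.fun_add m7
  rw [pd_add a7 m8, pd_add a6 m7, pd_add a5 m6, pd_add a4 m5, pd_add a3 m4', pd_add a2 m3,
    pd_add m1 m2, pd_sum _ m4] at hpd
  simp only [Finset.sum_sub_distrib] at hpd ⊢
  rw [hpd]
  have : ∀ j, pd (fun z => pd (fun y => v y i) (ex j) z + pd (fun y => v y j) (ex i) z) (ex k) z =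
      pd (pd (fun y => v y i) (ex j)) (ex k) z + pd (pd (fun y => v y j) (ex i)) (ex k) z :=
    fun j => by rw [pd_add (s4 i j) (s4 j i)]
  simp only [this]
  ring

end Row

theorem pd_et_coef_mul {c : V3 → ℝ} {X : P4 → ℝ} (hc : Differentiable ℝ c)
    (hX : Differentiable ℝ X) :
    pd (fun y => c y.2 * X y) et = fun z => c z.2 * pd X et z := by
  have dc : Differentiable ℝ fun z : P4 => c z.2 := hc.comp differentiable_snd
  rw [pd_mul dc hX, pd_snd_et c hc]
  funext z
  ring

theorem pd_ex_coef_mul {c : V3 → ℝ} {X : P4 → ℝ} (hc : Differentiable ℝ c)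
    (hX : Differentiable ℝ X) (k : Fin 3) :
    pd (fun y => c y.2 * X y) (ex k) = fun z => pdx c k z.2 * X z + c z.2 * pd X (ex k) z := by
  have dc : Differentiable ℝ fun z : P4 => c z.2 := hc.comp differentiable_snd
  rw [pd_mul dc hX, pd_snd_ex c hc]

theorem dtt_coef_mul {c : V3 → ℝ} {X : P4 → ℝ} (hc : Differentiable ℝ c) (hX : ContDiff ℝ 2 X) :
    dtt (fun y => c y.2 * X y) = fun z => c z.2 * dtt X z := by
  unfold dtt
  rw [pd_et_coef_mul hc (hX.differentiable two_ne_zero), pd_et_coef_mul hc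
    ((ContDiff.pd (n := 1) hX et).differentiable one_ne_zero)]

theorem slap_add {X Y : P4 → ℝ} (hX : ContDiff ℝ 2 X) (hY : ContDiff ℝ 2 Y) :
    slap (fun z => X z + Y z) = fun z => slap X z + slap Y z := by
  funext z
  unfold slap
  rw [← Finset.sum_add_distrib]
  refine Finset.sum_congr rfl fun i _ => ?_
  rw [pd_add (hX.differentiable two_ne_zero) (hY.differentiable two_ne_zero),
    pd_add ((ContDiff.pd (n := 1) hX _).differentiable one_ne_zero)
      ((ContDiff.pd (n := 1) hY _).differentiable one_ne_zero)]

theorem dtt_add {X Y : P4 → ℝ} (hX : ContDiff ℝ 2 X) (hY : ContDiff ℝ 2 Y) :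
    dtt (fun z => X z + Y z) = fun z => dtt X z + dtt Y z := by
  unfold dtt
  rw [pd_add (hX.differentiable two_ne_zero) (hY.differentiable two_ne_zero),
    pd_add ((ContDiff.pd (n := 1) hX _).differentiable one_ne_zero)
      ((ContDiff.pd (n := 1) hY _).differentiable one_ne_zero)]

namespace LO

variable {Z : Set P4} {E X Y : P4 → ℝ}

theorem of_pd_mul (hZ : IsCompact Z) {c : V3 → ℝ} (hc : ContDiff ℝ 1 c)
    (h0 : ∀ z ∈ Z, c z.2 ≠ 0) (hX1 : Differentiable ℝ X) (h : LO Z E fun z => c z.2 * X z)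
    (hd : ∀ k, LO Z E (pd (fun z => c z.2 * X z) (ex k))) :
    LO Z E X ∧ ∀ k, LO Z E (pd X (ex k)) := by
  have cc : ContinuousOn (fun z : P4 => c z.2) Z := (hc.continuous.comp continuous_snd).continuousOn
  have hX : LO Z E X := h.of_mul hZ cc h0
  refine ⟨hX, fun k => of_mul hZ cc h0 (((hd k).sub (hX.pd_mul_sub hZ hc hX1 k)).congr fun z _ => ?_)⟩
  ring

theorem slap_mul_sub (hZ : IsCompact Z) {c : V3 → ℝ} (hc : ContDiff ℝ 2 c) (hX : LO Z E X)
    (hd : ∀ k, LO Z E (pd X (ex k))) (hX2 : ContDiff ℝ 2 X) :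
    LO Z E fun z => slap (fun y => c y.2 * X y) z - c z.2 * slap X z := by
  have kc : ∀ k, ContDiff ℝ 1 (pdx c k) := fun k => ContDiff.pdx (n := 1) hc k
  have dX := hX2.differentiable two_ne_zero
  have ddX : ∀ k, Differentiable ℝ (pd X (ex k)) := fun k =>
    (ContDiff.pd (n := 1) hX2 (ex k)).differentiable one_ne_zero
  have dk : ∀ k, Differentiable ℝ fun z : P4 => pdx c k z.2 := fun k =>
    ((kc k).differentiable one_ne_zero).comp differentiable_snd
  have dc : Differentiable ℝ fun z : P4 => c z.2 :=
    (hc.differentiable two_ne_zero).comp differentiable_snd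
  refine (LO.sum Finset.univ fun k => (((hX.coefX hZ
    (ContDiff.pdx (n := 0) (kc k) k).continuous).add ((hd k).coefX hZ (kc k).continuous)).add
      ((hd k).coefX hZ (kc k).continuous))).congr fun z _ => ?_
  unfold slap
  rw [Finset.mul_sum, ← Finset.sum_sub_distrib]
  refine Finset.sum_congr rfl fun k _ => ?_
  rw [pd_ex_coef_mul (hc.differentiable two_ne_zero) dX,
    pd_add ((dk k).fun_mul dX) (dc.fun_mul (ddX k)),
    pd_ex_coef_mul ((kc k).differentiable one_ne_zero) dX,
    pd_ex_coef_mul (hc.differentiable two_ne_zero) (ddX k)]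
  ring

end LO

/-- The combination `P div v + Q div w`. -/
def comb (P Q : V3 → ℝ) (v w : P4 → V3) : P4 → ℝ := fun z => P z.2 * sdiv v z + Q z.2 * sdiv w z

theorem ContDiff.comb {P Q : V3 → ℝ} {v w : P4 → V3} (hP : ContDiff ℝ 2 P) (hQ : ContDiff ℝ 2 Q)
    (hv : ∀ i, ContDiff ℝ 3 fun y => v y i) (hw : ∀ i, ContDiff ℝ 3 fun y => w y i) :
    ContDiff ℝ 2 (comb P Q v w) :=
  ((hP.comp contDiff_snd).mul (ContDiff.sdiv (n := 2) hv)).add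
    ((hQ.comp contDiff_snd).mul (ContDiff.sdiv (n := 2) hw))

theorem comb_wave_LO {Z : Set P4} {E : P4 → ℝ} {ϱ N11 N12 N21 N22 P Q s b : V3 → ℝ} {v w : P4 → V3}
    (hZ : IsCompact Z) (hP : ContDiff ℝ 2 P) (hQ : ContDiff ℝ 2 Q) (hs : Continuous s)
    (hv : ∀ i, ContDiff ℝ 3 fun y => v y i) (hw : ∀ i, ContDiff ℝ 3 fun y => w y i)
    (hb : ∀ z ∈ Z, b z.2 * s z.2 = ϱ z.2) (hs0 : ∀ z ∈ Z, s z.2 ≠ 0)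
    (e1 : ∀ z ∈ Z, P z.2 * N11 z.2 + Q z.2 * N21 z.2 = s z.2 * P z.2)
    (e2 : ∀ z ∈ Z, P z.2 * N12 z.2 + Q z.2 * N22 z.2 = s z.2 * Q z.2)
    (le : LO Z E (sdiv v)) (lex : ∀ i, LO Z E (pd (sdiv v) (ex i)))
    (lf : LO Z E (sdiv w)) (lfx : ∀ i, LO Z E (pd (sdiv w) (ex i)))
    (we : LO Z E fun z => ϱ z.2 * dtt (sdiv v) z - N11 z.2 * slap (sdiv v) z
      - N12 z.2 * slap (sdiv w) z)
    (wf : LO Z E fun z => ϱ z.2 * dtt (sdiv w) z - N21 z.2 * slap (sdiv v) z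
      - N22 z.2 * slap (sdiv w) z) :
    LO Z E (waveOp b (comb P Q v w)) := by
  have ce : ContDiff ℝ 2 (sdiv v) := ContDiff.sdiv (n := 2) hv
  have cf : ContDiff ℝ 2 (sdiv w) := ContDiff.sdiv (n := 2) hw
  refine LO.of_mul (c := fun z => s z.2) hZ (hs.comp continuous_snd).continuousOn hs0 ?_
  refine ((((we.coefX hZ hP.continuous).add (wf.coefX hZ hQ.continuous)).sub
    ((le.slap_mul_sub hZ hP lex ce).coefX hZ hs)).sub
      ((lf.slap_mul_sub hZ hQ lfx cf).coefX hZ hs)).congr fun z hz => ?_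
  have cPe : ContDiff ℝ 2 fun z : P4 => P z.2 * sdiv v z := (hP.comp contDiff_snd).mul ce
  have cQf : ContDiff ℝ 2 fun z : P4 => Q z.2 * sdiv w z := (hQ.comp contDiff_snd).mul cf
  unfold waveOp comb
  rw [dtt_add cPe cQf, slap_add cPe cQf, dtt_coef_mul (hP.differentiable two_ne_zero) ce,
    dtt_coef_mul (hQ.differentiable two_ne_zero) cf]
  linear_combination (P z.2 * dtt (sdiv v) z + Q z.2 * dtt (sdiv w) z) * hb z hz
    + slap (sdiv v) z * e1 z hz + slap (sdiv w) z * e2 z hz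

/-- The coefficients of Biot's system together with the squared wave speeds `μ2`, `μ3`. -/
structure Coefs where
  ρ11 : V3 → ℝ
  ρ12 : V3 → ℝ
  ρ22 : V3 → ℝ
  μ : V3 → ℝ
  lam : V3 → ℝ
  q : V3 → ℝ
  r : V3 → ℝ
  μ2 : V3 → ℝ
  μ3 : V3 → ℝ

namespace Coefs

variable (c : Coefs)

/-- Determinant of the density matrix. -/
def ϱ (x : V3) : ℝ := c.ρ11 x * c.ρ22 x - c.ρ12 x ^ 2
/-- Upper left entry of `ϱ A`. -/
def M11 (x : V3) : ℝ := c.ρ22 x * (c.μ x + c.lam x) + -c.ρ12 x * c.q x + c.ρ22 x * c.μ x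
/-- Upper right entry of `ϱ A`. -/
def M12 (x : V3) : ℝ := c.ρ22 x * c.q x + -c.ρ12 x * c.r x
/-- Lower left entry of `ϱ A`. -/
def M21 (x : V3) : ℝ := -c.ρ12 x * (c.μ x + c.lam x) + c.ρ11 x * c.q x + -c.ρ12 x * c.μ x
/-- Lower right entry of `ϱ A`. -/
def M22 (x : V3) : ℝ := -c.ρ12 x * c.q x + c.ρ11 x * c.r x

/-- Regularity and non-degeneracy of the coefficients over a space-time set `Z`. -/
structure Good (c : Coefs) (Z : Set P4) (b1 b2 b3 : V3 → ℝ) : Prop where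
  sρ11 : ContDiff ℝ 2 c.ρ11
  sρ12 : ContDiff ℝ 2 c.ρ12
  sρ22 : ContDiff ℝ 2 c.ρ22
  sμ : ContDiff ℝ 2 c.μ
  slam : ContDiff ℝ 2 c.lam
  sq : ContDiff ℝ 2 c.q
  sr : ContDiff ℝ 2 c.r
  sμ2 : ContDiff ℝ 2 c.μ2
  sμ3 : ContDiff ℝ 2 c.μ3
  ϱ0 : ∀ z ∈ Z, c.ϱ z.2 ≠ 0
  ρμ0 : ∀ z ∈ Z, c.ρ22 z.2 * c.μ z.2 ≠ 0
  μ20 : ∀ z ∈ Z, c.μ2 z.2 ≠ 0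
  μ30 : ∀ z ∈ Z, c.μ3 z.2 ≠ 0
  ne : ∀ z ∈ Z, c.μ2 z.2 - c.μ3 z.2 ≠ 0
  tr : ∀ z ∈ Z, c.M11 z.2 + c.M22 z.2 = c.ϱ z.2 * (c.μ2 z.2 + c.μ3 z.2)
  det : ∀ z ∈ Z, c.M11 z.2 * c.M22 z.2 - c.M12 z.2 * c.M21 z.2 =
    c.ϱ z.2 ^ 2 * (c.μ2 z.2 * c.μ3 z.2)
  hb1 : ∀ z ∈ Z, b1 z.2 * (c.ρ22 z.2 * c.μ z.2) = c.ϱ z.2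
  hb2 : ∀ z ∈ Z, b2 z.2 * c.μ2 z.2 = 1
  hb3 : ∀ z ∈ Z, b3 z.2 * c.μ3 z.2 = 1

/-- The unknowns of the diagonalised system: displacement, rotation and two pairs of
combinations of the divergences. -/
abbrev Unk := (Fin 3 ⊕ Fin 3 × Fin 3) ⊕ (Fin 2 ⊕ Fin 2)

/-- The rotation `∂ₖvᵢ - ∂ᵢvₖ`. -/
def rot (v : P4 → V3) (k i : Fin 3) : P4 → ℝ := fun z =>
  pd (fun y => v y i) (ex k) z - pd (fun y => v y k) (ex i) z

/-- The decoupled combinations of the divergences. -/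
def divFam (v w : P4 → V3) : Fin 2 ⊕ Fin 2 → P4 → ℝ :=
  Sum.elim
    ![comb (fun x => c.M11 x - c.ϱ x * c.μ3 x) c.M12 v w,
      comb c.M21 (fun x => c.M22 x - c.ϱ x * c.μ3 x) v w]
    ![comb (fun x => c.M11 x - c.ϱ x * c.μ2 x) c.M12 v w,
      comb c.M21 (fun x => c.M22 x - c.ϱ x * c.μ2 x) v w]

/-- All unknowns of the diagonalised system. -/
def fam (v w : P4 → V3) : Unk → P4 → ℝ :=
  Sum.elim (Sum.elim (fun i z => v z i) fun p => rot v p.1 p.2) (c.divFam v w)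

/-- The reciprocal squared speeds attached to the unknowns. -/
def speed (b1 b2 b3 : V3 → ℝ) : Unk → V3 → ℝ :=
  Sum.elim (fun _ => b1) (Sum.elim (fun _ => b2) fun _ => b3)

variable {c} {Z : Set P4} {b1 b2 b3 : V3 → ℝ} {E : P4 → ℝ} {v w F1 F2 : P4 → V3}

theorem Good.sϱ (h : c.Good Z b1 b2 b3) : ContDiff ℝ 2 c.ϱ := by
  have := h.sρ11; have := h.sρ12; have := h.sρ22
  unfold ϱ; fun_prop

theorem Good.sM11 (h : c.Good Z b1 b2 b3) : ContDiff ℝ 2 c.M11 := by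
  have := h.sρ11; have := h.sρ12; have := h.sρ22; have := h.sμ; have := h.slam; have := h.sq
  unfold M11; fun_prop

theorem Good.sM12 (h : c.Good Z b1 b2 b3) : ContDiff ℝ 2 c.M12 := by
  have := h.sρ12; have := h.sρ22; have := h.sr; have := h.sq
  unfold M12; fun_prop

theorem Good.sM21 (h : c.Good Z b1 b2 b3) : ContDiff ℝ 2 c.M21 := by
  have := h.sρ11; have := h.sρ12; have := h.sρ22; have := h.sμ; have := h.slam; have := h.sq
  unfold M21; fun_prop

theorem Good.sM22 (h : c.Good Z b1 b2 b3) : ContDiff ℝ 2 c.M22 := by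
  have := h.sρ11; have := h.sρ12; have := h.sr; have := h.sq
  unfold M22; fun_prop

theorem divFam_cases {p : Fin 2 ⊕ Fin 2 → (P4 → ℝ) → Prop}
    (h1 : p (Sum.inl 0) (comb (fun x => c.M11 x - c.ϱ x * c.μ3 x) c.M12 v w))
    (h2 : p (Sum.inl 1) (comb c.M21 (fun x => c.M22 x - c.ϱ x * c.μ3 x) v w))
    (h3 : p (Sum.inr 0) (comb (fun x => c.M11 x - c.ϱ x * c.μ2 x) c.M12 v w))
    (h4 : p (Sum.inr 1) (comb c.M21 (fun x => c.M22 x - c.ϱ x * c.μ2 x) v w)) :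
    ∀ k, p k (c.divFam v w k)
  | Sum.inl 0 => h1
  | Sum.inl 1 => h2
  | Sum.inr 0 => h3
  | Sum.inr 1 => h4

theorem Good.contDiff_divFam (h : c.Good Z b1 b2 b3)
    (hv : ∀ i, ContDiff ℝ 3 fun y => v y i) (hw : ∀ i, ContDiff ℝ 3 fun y => w y i) (k) :
    ContDiff ℝ 2 (c.divFam v w k) := by
  have := h.sϱ; have := h.sμ2; have := h.sμ3
  have := h.sM11; have := h.sM22
  revert k
  exact divFam_cases (p := fun _ f => ContDiff ℝ 2 f) (ContDiff.comb (by fun_prop) h.sM12 hv hw)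
    (ContDiff.comb h.sM21 (by fun_prop) hv hw) (ContDiff.comb (by fun_prop) h.sM12 hv hw)
    (ContDiff.comb h.sM21 (by fun_prop) hv hw)

theorem contDiff_rot (hv : ∀ i, ContDiff ℝ 3 fun y => v y i) (k i : Fin 3) :
    ContDiff ℝ 2 (rot v k i) :=
  (ContDiff.pd (n := 2) (hv i) (ex k)).sub (ContDiff.pd (n := 2) (hv k) (ex i))

theorem Good.contDiff_fam (h : c.Good Z b1 b2 b3)
    (hv : ∀ i, ContDiff ℝ 3 fun y => v y i) (hw : ∀ i, ContDiff ℝ 3 fun y => w y i) (k) :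
    ContDiff ℝ 2 (c.fam v w k) := by
  rcases k with (i | p) | k
  · exact (hv i).of_le (by norm_num)
  · exact contDiff_rot hv _ _
  · exact h.contDiff_divFam hv hw k

theorem vanOff_sdiv (hZ : IsClosed Z) (hv : ∀ i, VanOff Z fun y => v y i) : VanOff Z (sdiv v) :=
  fun z hz => Finset.sum_eq_zero fun i _ => (hv i).pd hZ _ z hz

theorem vanOff_fam (hZ : IsClosed Z) (hv : ∀ i, VanOff Z fun y => v y i)
    (hw : ∀ i, VanOff Z fun y => w y i) (k) : VanOff Z (c.fam v w k) := by
  have hc : ∀ P Q, VanOff Z (comb P Q v w) := fun P Q z hz => by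
    simp [comb, vanOff_sdiv hZ hv z hz, vanOff_sdiv hZ hw z hz]
  rcases k with (i | p) | k
  · exact hv i
  · intro z hz
    simp [fam, rot, (hv _).pd hZ _ z hz]
  · exact divFam_cases (p := fun _ f => VanOff Z f) (hc _ _) (hc _ _) (hc _ _) (hc _ _) k

theorem Good.div_LO (h : c.Good Z b1 b2 b3) (hZ : IsCompact Z)
    (hv : ∀ i, ContDiff ℝ 3 fun y => v y i) (hw : ∀ i, ContDiff ℝ 3 fun y => w y i)
    (l : ∀ k, LO Z E (c.divFam v w k)) (lx : ∀ k j, LO Z E (pd (c.divFam v w k) (ex j))) :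
    (LO Z E (sdiv v) ∧ ∀ j, LO Z E (pd (sdiv v) (ex j))) ∧
      (LO Z E (sdiv w) ∧ ∀ j, LO Z E (pd (sdiv w) (ex j))) := by
  have sϱ := h.sϱ.of_le (one_le_two (α := WithTop ℕ∞))
  have s2 := h.sμ2.of_le (one_le_two (α := WithTop ℕ∞))
  have s3 := h.sμ3.of_le (one_le_two (α := WithTop ℕ∞))
  have cδ : ContDiff ℝ 1 fun x => c.ϱ x * (c.μ2 x - c.μ3 x) := by fun_prop
  have h0 : ∀ z ∈ Z, c.ϱ z.2 * (c.μ2 z.2 - c.μ3 z.2) ≠ 0 := fun z hz =>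
    mul_ne_zero (h.ϱ0 z hz) (h.ne z hz)
  have dY : ∀ k, Differentiable ℝ (c.divFam v w k) := fun k =>
    (h.contDiff_divFam hv hw k).differentiable two_ne_zero
  have key : ∀ (a : Fin 2) (X : P4 → ℝ), Differentiable ℝ X →
      ((fun z => c.ϱ z.2 * (c.μ2 z.2 - c.μ3 z.2) * X z) =
        fun z => c.divFam v w (Sum.inl a) z - c.divFam v w (Sum.inr a) z) →
      LO Z E X ∧ ∀ j, LO Z E (pd X (ex j)) := by
    intro a X dX hX
    refine LO.of_pd_mul hZ cδ h0 dX ?_ ?_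
    · rw [hX]
      exact (l _).sub (l _)
    · intro j
      rw [hX, pd_sub (dY _) (dY _)]
      exact (lx _ j).sub (lx _ j)
  refine ⟨key 0 _ ((ContDiff.sdiv (n := 2) hv).differentiable two_ne_zero) ?_,
    key 1 _ ((ContDiff.sdiv (n := 2) hw).differentiable two_ne_zero) ?_⟩
  · funext z
    change _ = comb (fun x => c.M11 x - c.ϱ x * c.μ3 x) c.M12 v w z
      - comb (fun x => c.M11 x - c.ϱ x * c.μ2 x) c.M12 v w z
    simp only [comb]
    ring
  · funext z
    change _ = comb c.M21 (fun x => c.M22 x - c.ϱ x * c.μ3 x) v w z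
      - comb c.M21 (fun x => c.M22 x - c.ϱ x * c.μ2 x) v w z
    simp only [comb]
    ring

end Coefs

theorem LO.of_sq_le {Z : Set P4} {G X : P4 → ℝ} (h : ∀ z, X z ^ 2 ≤ G z) :
    LO Z (fun z => √(G z)) X :=
  ⟨1, fun z _ => by rw [one_mul]; exact Real.abs_le_sqrt (h z)⟩

theorem LO.exists_sq_le {Z : Set P4} {G : P4 → ℝ} {ι : Type*} [Fintype ι] {X : ι → P4 → ℝ}
    (h : ∀ k, LO Z (fun z => √(G z)) (X k)) (hG : ∀ z, 0 ≤ G z) :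
    ∃ C, 0 ≤ C ∧ ∀ k, ∀ z ∈ Z, X k z ^ 2 ≤ C * G z := by
  choose C hC using h
  refine ⟨∑ k, C k ^ 2, Finset.sum_nonneg fun _ _ => sq_nonneg _, fun k z hz => ?_⟩
  have h1 : X k z ^ 2 ≤ (C k * √(G z)) ^ 2 := by
    rw [← sq_abs (X k z)]
    exact pow_le_pow_left₀ (abs_nonneg _) (hC k z hz) 2
  rw [mul_pow, Real.sq_sqrt (hG z)] at h1
  exact h1.trans (mul_le_mul_of_nonneg_right
    (Finset.single_le_sum (f := fun k => C k ^ 2) (fun _ _ => sq_nonneg _) (Finset.mem_univ k))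
    (hG z))

/-- The pointwise size of the sources and of their spatial gradients. -/
def src (F1 F2 : P4 → V3) : P4 → ℝ := fun z =>
  n2 (F1 z) + n2 (F2 z) + vGradX2 F1 z + vGradX2 F2 z

theorem n2_nonneg (v : V3) : 0 ≤ n2 v := Finset.sum_nonneg fun _ _ => sq_nonneg _

theorem vGradX2_nonneg (u : P4 → V3) (z : P4) : 0 ≤ vGradX2 u z :=
  Finset.sum_nonneg fun _ _ => gradX2_nonneg _ _

theorem src_nonneg (F1 F2 : P4 → V3) (z : P4) : 0 ≤ src F1 F2 z := by
  unfold src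
  linarith [n2_nonneg (F1 z), n2_nonneg (F2 z), vGradX2_nonneg F1 z, vGradX2_nonneg F2 z]

theorem sq_le_n2 (v : V3) (i : Fin 3) : v i ^ 2 ≤ n2 v :=
  Finset.single_le_sum (f := fun i => v i ^ 2) (fun _ _ => sq_nonneg _) (Finset.mem_univ i)

theorem sq_pd_le_gradX2 (f : P4 → ℝ) (j : Fin 3) (z : P4) : pd f (ex j) z ^ 2 ≤ gradX2 f z :=
  Finset.single_le_sum (f := fun j => pd f (ex j) z ^ 2) (fun _ _ => sq_nonneg _)
    (Finset.mem_univ j)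

theorem sq_pd_le_vGradX2 (u : P4 → V3) (i j : Fin 3) (z : P4) :
    pd (fun y => u y i) (ex j) z ^ 2 ≤ vGradX2 u z :=
  (sq_pd_le_gradX2 _ j z).trans (Finset.single_le_sum (f := fun i => gradX2 (fun y => u y i) z)
    (fun _ _ => gradX2_nonneg _ _) (Finset.mem_univ i))

namespace Coefs

variable {c : Coefs} {Z : Set P4} {b1 b2 b3 : V3 → ℝ} {v w F1 F2 : P4 → V3}

/-- Biot's system with the coefficients `c`. -/
def Biot (c : Coefs) (v w F1 F2 : P4 → V3) (Q : Set P4) : Prop :=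
  BiotSystem c.ρ11 c.ρ12 c.ρ22 c.μ c.lam c.q c.r v w F1 F2 Q

theorem pd_pd_comm {f : P4 → ℝ} (hf : ContDiff ℝ 3 f) (a b : P4) :
    pd (pd f a) b = pd (pd f b) a := pd_comm (hf.of_le (by norm_num)) a b

theorem slap_eq_rot (hv : ∀ i, ContDiff ℝ 3 fun y => v y i) (i : Fin 3) (z : P4) :
    slap (fun y => v y i) z = ∑ k, pd (rot v k i) (ex k) z + pd (sdiv v) (ex i) z := by
  have d1 : ∀ i k, Differentiable ℝ (pd (fun y => v y i) (ex k)) := fun i k =>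
    (ContDiff.pd (n := 2) (hv i) _).differentiable two_ne_zero
  unfold slap rot _root_.sdiv
  rw [pd_sum _ fun k => d1 k k, ← Finset.sum_add_distrib]
  refine Finset.sum_congr rfl fun k _ => ?_
  rw [pd_sub (d1 _ _) (d1 _ _), pd_pd_comm (hv k) (ex i) (ex k)]
  ring

theorem slap_rot (hv : ∀ i, ContDiff ℝ 3 fun y => v y i) (k i : Fin 3) (z : P4) :
    slap (rot v k i) z = pd (slap fun y => v y i) (ex k) z - pd (slap fun y => v y k) (ex i) z := by
  rw [pd_slap (hv i), pd_slap (hv k)]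
  have c1 : ∀ i k, ContDiff ℝ 2 (pd (fun y => v y i) (ex k)) := fun i k =>
    ContDiff.pd (n := 2) (hv i) _
  unfold slap rot
  rw [← Finset.sum_sub_distrib]
  refine Finset.sum_congr rfl fun j _ => ?_
  rw [pd_sub ((c1 _ _).differentiable two_ne_zero) ((c1 _ _).differentiable two_ne_zero),
    pd_sub ((ContDiff.pd (n := 1) (c1 _ _) _).differentiable one_ne_zero)
    ((ContDiff.pd (n := 1) (c1 _ _) _).differentiable one_ne_zero)]

theorem dtt_rot (hv : ∀ i, ContDiff ℝ 3 fun y => v y i) (k i : Fin 3) (z : P4) :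
    dtt (rot v k i) z = pd (dtt fun y => v y i) (ex k) z - pd (dtt fun y => v y k) (ex i) z := by
  rw [pd_dtt (hv i), pd_dtt (hv k)]
  have c1 : ∀ i k, ContDiff ℝ 2 (pd (fun y => v y i) (ex k)) := fun i k =>
    ContDiff.pd (n := 2) (hv i) _
  unfold dtt rot
  rw [pd_sub ((c1 _ _).differentiable two_ne_zero) ((c1 _ _).differentiable two_ne_zero),
    pd_sub ((ContDiff.pd (n := 1) (c1 _ _) _).differentiable one_ne_zero)
    ((ContDiff.pd (n := 1) (c1 _ _) _).differentiable one_ne_zero)]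

theorem dtt_sdiv (hv : ∀ i, ContDiff ℝ 3 fun y => v y i) (z : P4) :
    dtt (sdiv v) z = ∑ i, pd (dtt fun y => v y i) (ex i) z := by
  have c1 : ∀ i, ContDiff ℝ 2 (pd (fun y => v y i) (ex i)) := fun i =>
    ContDiff.pd (n := 2) (hv i) _
  simp only [pd_dtt (hv _)]
  unfold dtt _root_.sdiv
  rw [pd_sum _ fun i => (c1 i).differentiable two_ne_zero,
    pd_sum _ fun i => (ContDiff.pd (n := 1) (c1 i) _).differentiable one_ne_zero]

theorem slap_sdiv (hv : ∀ i, ContDiff ℝ 3 fun y => v y i) (z : P4) :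
    slap (sdiv v) z = ∑ i, pd (slap fun y => v y i) (ex i) z := by
  have c1 : ∀ i, ContDiff ℝ 2 (pd (fun y => v y i) (ex i)) := fun i =>
    ContDiff.pd (n := 2) (hv i) _
  simp only [pd_slap (hv _)]
  unfold slap _root_.sdiv
  rw [Finset.sum_comm]
  refine Finset.sum_congr rfl fun j _ => ?_
  rw [pd_sum _ fun i => (c1 i).differentiable two_ne_zero,
    pd_sum _ fun i => (ContDiff.pd (n := 1) (c1 i) _).differentiable one_ne_zero]

theorem pd_rot (hv : ∀ i, ContDiff ℝ 3 fun y => v y i) (k i j : Fin 3) (z : P4) :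
    pd (rot v k i) (ex j) z = pd (pd (fun y => v y i) (ex j)) (ex k) z
      - pd (pd (fun y => v y k) (ex j)) (ex i) z := by
  have d1 : ∀ i k, Differentiable ℝ (pd (fun y => v y i) (ex k)) := fun i k =>
    (ContDiff.pd (n := 2) (hv i) _).differentiable two_ne_zero
  unfold rot
  rw [pd_sub (d1 _ _) (d1 _ _), pd_pd_comm (hv k) (ex i), pd_pd_comm (hv i) (ex k)]

theorem pd_sdiv (hv : ∀ i, ContDiff ℝ 3 fun y => v y i) (j : Fin 3) (z : P4) :
    pd (sdiv v) (ex j) z = ∑ i, pd (pd (fun y => v y i) (ex j)) (ex i) z := by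
  have d1 : ∀ i k, Differentiable ℝ (pd (fun y => v y i) (ex k)) := fun i k =>
    (ContDiff.pd (n := 2) (hv i) _).differentiable two_ne_zero
  unfold _root_.sdiv
  rw [pd_sum _ fun k => d1 k k]
  exact Finset.sum_congr rfl fun i _ => by rw [pd_pd_comm (hv i)]

theorem Good.wave_LO (h : c.Good Z b1 b2 b3) (hZ : IsCompact Z) {E : P4 → ℝ}
    (hv : ∀ i, ContDiff ℝ 3 fun y => v y i) (hw : ∀ i, ContDiff ℝ 3 fun y => w y i)
    (hF1 : ∀ i, ContDiff ℝ 1 fun y => F1 y i) (hF2 : ∀ i, ContDiff ℝ 1 fun y => F2 y i)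
    (hB : c.Biot v w F1 F2 univ)
    (l : ∀ k, LO Z E (c.fam v w k)) (lx : ∀ k j, LO Z E (pd (c.fam v w k) (ex j)))
    (l1 : ∀ i, LO Z E fun y => F1 y i) (l1x : ∀ i j, LO Z E (pd (fun y => F1 y i) (ex j)))
    (l2 : ∀ i, LO Z E fun y => F2 y i) (l2x : ∀ i j, LO Z E (pd (fun y => F2 y i) (ex j))) :
    ∀ k, LO Z E (waveOp (speed b1 b2 b3 k) (c.fam v w k)) := by
  obtain ⟨⟨le, lex⟩, lf, lfx⟩ := h.div_LO hZ hv hw (fun k => l (Sum.inr k))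
    fun k j => lx (Sum.inr k) j
  have lv : ∀ i j, LO Z E (pd (fun y => v y i) (ex j)) := fun i j => lx (Sum.inl (Sum.inl i)) j
  have lrot : ∀ k i j, LO Z E (pd (rot v k i) (ex j)) := fun k i j =>
    lx (Sum.inl (Sum.inr (k, i))) j
  have lΔ : ∀ i, LO Z E (slap fun y => v y i) := fun i =>
    ((LO.sum Finset.univ fun k => lrot k i k).add (lex i)).congr fun z _ => slap_eq_rot hv i z
  have n12 : ContDiff ℝ 2 fun x => -c.ρ12 x := h.sρ12.neg
  obtain ⟨ta, ra⟩ := row_LO hZ h.sϱ h.sρ22 n12 h.sμ h.slam h.sq h.sr h.ϱ0 hv hw hv hF1 hF2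
    (fun z i => by
      have := hB z (mem_univ z) i
      simp only [ϱ]
      linear_combination c.ρ22 z.2 * this.1 - c.ρ12 z.2 * this.2)
    lv lΔ le lex lf lfx l1 l1x l2 l2x
  obtain ⟨-, rb⟩ := row_LO hZ h.sϱ n12 h.sρ11 h.sμ h.slam h.sq h.sr h.ϱ0 hv hw hw hF1 hF2
    (fun z i => by
      have := hB z (mem_univ z) i
      simp only [ϱ]
      linear_combination -c.ρ12 z.2 * this.1 + c.ρ11 z.2 * this.2)
    lv lΔ le lex lf lfx l1 l1x l2 l2x
  have cμ : ∀ j, Continuous (pdx c.μ j) := fun j => (ContDiff.pdx (n := 1) h.sμ j).continuous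
  have cα : ∀ j, Continuous fun x => c.ρ22 x * pdx c.μ j x := fun j =>
    h.sρ22.continuous.mul (cμ j)
  have cα' : ∀ j, Continuous fun x => -c.ρ12 x * pdx c.μ j x := fun j =>
    n12.continuous.mul (cμ j)
  have we : LO Z E fun z => c.ϱ z.2 * dtt (sdiv v) z - c.M11 z.2 * slap (sdiv v) z
      - c.M12 z.2 * slap (sdiv w) z := by
    refine ((LO.sum Finset.univ fun i => ra i i).add (LO.sum Finset.univ fun j =>
      ((lex j).add (lΔ j)).coefX hZ (cα j))).congr fun z _ => ?_
    have e1 := slap_sdiv hv z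
    have e2 : slap (sdiv v) z = ∑ i, pd (pd (sdiv v) (ex i)) (ex i) z := rfl
    rw [dtt_sdiv hv]
    generalize slap (sdiv v) z = s at e1 e2 ⊢
    simp only [pd_sdiv hv, slap, Fin.sum_univ_three, M11, M12] at e1 e2 ⊢
    linear_combination -(c.ρ22 z.2 * c.μ z.2) * e1 - (c.ρ22 z.2 * (c.μ z.2 + c.lam z.2) + -c.ρ12 z.2 * c.q z.2) * e2
  have wf : LO Z E fun z => c.ϱ z.2 * dtt (sdiv w) z - c.M21 z.2 * slap (sdiv v) z
      - c.M22 z.2 * slap (sdiv w) z := by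
    refine ((LO.sum Finset.univ fun i => rb i i).add (LO.sum Finset.univ fun j =>
      ((lex j).add (lΔ j)).coefX hZ (cα' j))).congr fun z _ => ?_
    have e1 := slap_sdiv hv z
    have e2 : slap (sdiv v) z = ∑ i, pd (pd (sdiv v) (ex i)) (ex i) z := rfl
    rw [dtt_sdiv hw]
    generalize slap (sdiv v) z = s at e1 e2 ⊢
    simp only [pd_sdiv hv, slap, Fin.sum_univ_three, M21, M22] at e1 e2 ⊢
    linear_combination -(-c.ρ12 z.2 * c.μ z.2) * e1 - (-c.ρ12 z.2 * (c.μ z.2 + c.lam z.2) + c.ρ11 z.2 * c.q z.2) * e2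
  have hϱ2 : Continuous fun x => c.ϱ x * c.μ2 x := h.sϱ.continuous.mul h.sμ2.continuous
  have hϱ3 : Continuous fun x => c.ϱ x * c.μ3 x := h.sϱ.continuous.mul h.sμ3.continuous
  have s1 := h.sϱ
  have s2 := h.sμ2
  have s3 := h.sμ3
  have s4 := h.sM11
  have s5 := h.sM22
  have key : ∀ (b s : V3 → ℝ) {P Q : V3 → ℝ}, ContDiff ℝ 2 P → ContDiff ℝ 2 Q → Continuous s →
      (∀ z ∈ Z, b z.2 * s z.2 = c.ϱ z.2) → (∀ z ∈ Z, s z.2 ≠ 0) →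
      (∀ z ∈ Z, P z.2 * c.M11 z.2 + Q z.2 * c.M21 z.2 = s z.2 * P z.2) →
      (∀ z ∈ Z, P z.2 * c.M12 z.2 + Q z.2 * c.M22 z.2 = s z.2 * Q z.2) →
      LO Z E (waveOp b (comb P Q v w)) := fun b s P Q cP cQ cs hb hs0 e1 e2 =>
    comb_wave_LO hZ cP cQ cs hv hw hb hs0 e1 e2 le lex lf lfx we wf
  have g2 : ∀ z ∈ Z, b2 z.2 * (c.ϱ z.2 * c.μ2 z.2) = c.ϱ z.2 := fun z hz => by
    linear_combination c.ϱ z.2 * h.hb2 z hz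
  have g3 : ∀ z ∈ Z, b3 z.2 * (c.ϱ z.2 * c.μ3 z.2) = c.ϱ z.2 := fun z hz => by
    linear_combination c.ϱ z.2 * h.hb3 z hz
  have n2 : ∀ z ∈ Z, c.ϱ z.2 * c.μ2 z.2 ≠ 0 := fun z hz => mul_ne_zero (h.ϱ0 z hz) (h.μ20 z hz)
  have n3 : ∀ z ∈ Z, c.ϱ z.2 * c.μ3 z.2 ≠ 0 := fun z hz => mul_ne_zero (h.ϱ0 z hz) (h.μ30 z hz)
  rintro ((i | ⟨k, i⟩) | k)
  · have cκ : ContinuousOn (fun z : P4 => b1 z.2) Z := by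
      refine ContinuousOn.congr (f := fun z => c.ϱ z.2 / (c.ρ22 z.2 * c.μ z.2)) ?_ fun z hz => ?_
      · exact (h.sϱ.continuous.comp continuous_snd).continuousOn.div
          ((h.sρ22.continuous.mul h.sμ.continuous).comp continuous_snd).continuousOn h.ρμ0
      · rw [eq_div_iff (h.ρμ0 z hz)]
        exact h.hb1 z hz
    exact ((ta i).coef hZ cκ).sub (lΔ i)
  · refine LO.of_mul (c := fun z => c.ρ22 z.2 * c.μ z.2) hZ
      ((h.sρ22.continuous.mul h.sμ.continuous).comp continuous_snd).continuousOn h.ρμ0 ?_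
    refine (((ra i k).sub (ra k i)).add (LO.sum Finset.univ fun j =>
      (lrot k i j).coefX hZ (cα j))).congr fun z hz => ?_
    have hc : ∀ j, pd (pd (fun y => v y j) (ex i)) (ex k) z =
      pd (pd (fun y => v y j) (ex k)) (ex i) z := fun j => by rw [pd_pd_comm (hv j)]
    have he : pd (pd (sdiv v) (ex i)) (ex k) z = pd (pd (sdiv v) (ex k)) (ex i) z := by
      rw [pd_comm (ContDiff.sdiv (n := 2) hv)]
    have hf : pd (pd (sdiv w) (ex i)) (ex k) z = pd (pd (sdiv w) (ex k)) (ex i) z := by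
      rw [pd_comm (ContDiff.sdiv (n := 2) hw)]
    change _ * (b1 z.2 * dtt (rot v k i) z - slap (rot v k i) z) = _
    rw [slap_rot hv, dtt_rot hv]
    simp only [pd_rot hv, Fin.sum_univ_three, hc, he, hf]
    linear_combination (pd (dtt fun y => v y i) (ex k) z - pd (dtt fun y => v y k) (ex i) z) *
      h.hb1 z hz
  · revert k
    refine divFam_cases (p := fun k f => LO Z E (waveOp (speed b1 b2 b3 (Sum.inr k)) f))
      (key b2 _ (by fun_prop) h.sM12 hϱ2 g2 n2 (fun z hz => ?_) fun z hz => ?_)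
      (key b2 _ h.sM21 (by fun_prop) hϱ2 g2 n2 (fun z hz => ?_) fun z hz => ?_)
      (key b3 _ (by fun_prop) h.sM12 hϱ3 g3 n3 (fun z hz => ?_) fun z hz => ?_)
      (key b3 _ h.sM21 (by fun_prop) hϱ3 g3 n3 (fun z hz => ?_) fun z hz => ?_)
    · linear_combination c.M11 z.2 * h.tr z hz - h.det z hz
    · linear_combination c.M12 z.2 * h.tr z hz
    · linear_combination c.M21 z.2 * h.tr z hz
    · linear_combination c.M22 z.2 * h.tr z hz - h.det z hz
    · linear_combination c.M11 z.2 * h.tr z hz - h.det z hz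
    · linear_combination c.M12 z.2 * h.tr z hz
    · linear_combination c.M21 z.2 * h.tr z hz
    · linear_combination c.M22 z.2 * h.tr z hz - h.det z hz

theorem Good.reduction (h : c.Good Z b1 b2 b3) (hZ : IsCompact Z)
    (hv : ∀ i, ContDiff ℝ 3 fun y => v y i) (hw : ∀ i, ContDiff ℝ 3 fun y => w y i)
    (ov : ∀ i, VanOff Z fun y => v y i) (ow : ∀ i, VanOff Z fun y => w y i)
    (hF1 : ∀ i, ContDiff ℝ 1 fun y => F1 y i) (hF2 : ∀ i, ContDiff ℝ 1 fun y => F2 y i)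
    (hB : c.Biot v w F1 F2 univ) :
    ∃ C, 0 ≤ C ∧ ∀ k z, waveOp (speed b1 b2 b3 k) (c.fam v w k) z ^ 2 ≤
      C * (∑ j, energy1 (c.fam v w j) z + src F1 F2 z) := by
  set G : P4 → ℝ := fun z => ∑ j, energy1 (c.fam v w j) z + src F1 F2 z with hGdef
  have hE : ∀ z, 0 ≤ ∑ j, energy1 (c.fam v w j) z := fun z =>
    Finset.sum_nonneg fun _ _ => energy1_nonneg _ _
  have hG : ∀ z, 0 ≤ G z := fun z => add_nonneg (hE z) (src_nonneg _ _ _)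
  have h1 : ∀ k z, energy1 (c.fam v w k) z ≤ G z := fun k z =>
    (Finset.single_le_sum (f := fun k => energy1 (c.fam v w k) z)
      (fun _ _ => energy1_nonneg _ _) (Finset.mem_univ k)).trans
      (le_add_of_nonneg_right (src_nonneg _ _ _))
  have h2 : ∀ z, src F1 F2 z ≤ G z := fun z => le_add_of_nonneg_left (hE z)
  have p1 : ∀ z, 0 ≤ n2 (F1 z) := fun z => n2_nonneg _
  have p2 : ∀ z, 0 ≤ n2 (F2 z) := fun z => n2_nonneg _
  have p3 := vGradX2_nonneg F1
  have p4 := vGradX2_nonneg F2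
  obtain ⟨C, hC, hCk⟩ := LO.exists_sq_le (h.wave_LO hZ hv hw hF1 hF2 hB
    (E := fun z => √(G z))
    (fun k => LO.of_sq_le fun z => by
      have := h1 k z
      unfold energy1 at this
      nlinarith [gradX2_nonneg (c.fam v w k) z, sq_nonneg (pd (c.fam v w k) et z)])
    (fun k j => LO.of_sq_le fun z => by
      have := h1 k z
      unfold energy1 at this
      nlinarith [sq_pd_le_gradX2 (c.fam v w k) j z, sq_nonneg (pd (c.fam v w k) et z),
        sq_nonneg (c.fam v w k z)])
    (fun i => LO.of_sq_le fun z => by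
      have := h2 z; unfold src at this
      linarith [sq_le_n2 (F1 z) i, p1 z, p2 z, p3 z, p4 z])
    (fun i j => LO.of_sq_le fun z => by
      have := h2 z; unfold src at this
      linarith [sq_pd_le_vGradX2 F1 i j z, p1 z, p2 z, p3 z, p4 z])
    (fun i => LO.of_sq_le fun z => by
      have := h2 z; unfold src at this
      linarith [sq_le_n2 (F2 z) i, p1 z, p2 z, p3 z, p4 z])
    (fun i j => LO.of_sq_le fun z => by
      have := h2 z; unfold src at this
      linarith [sq_pd_le_vGradX2 F2 i j z, p1 z, p2 z, p3 z, p4 z])) hG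
  refine ⟨C, hC, fun k z => ?_⟩
  by_cases hz : z ∈ Z
  · exact hCk k z hz
  · rw [(vanOff_fam hZ.isClosed ov ow k).waveOp hZ.isClosed _ z hz]
    rw [zero_pow two_ne_zero]
    exact mul_nonneg hC (hG z)

end Coefs

/-! ### Gluing, cut-offs and the geometry of the weight -/

theorem contDiff_of_eq_zero_off {E : Type*} [NormedAddCommGroup E] [NormedSpace ℝ E] {n : ℕ∞}
    {f : E → ℝ} {U K : Set E} (hK : IsClosed K) (hKU : K ⊆ U)
    (hf : ∀ x ∈ U, ContDiffAt ℝ n f x) (h0 : ∀ x, x ∉ K → f x = 0) : ContDiff ℝ n f := by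
  rw [contDiff_iff_contDiffAt]
  intro x
  by_cases hx : x ∈ U
  · exact hf x hx
  · have : f =ᶠ[nhds x] fun _ => 0 := by
      filter_upwards [hK.isOpen_compl.mem_nhds fun h => hx (hKU h)] with y hy
      exact h0 y hy
    exact contDiffAt_const.congr_of_eventuallyEq this

theorem exists_cutoff {E : Type*} [NormedAddCommGroup E] [NormedSpace ℝ E] [FiniteDimensional ℝ E]
    {K U : Set E} (hK : IsCompact K) (hU : IsOpen U) (hKU : K ⊆ U) (n : ℕ∞) :
    ∃ χ : E → ℝ, ContDiff ℝ n χ ∧ ∃ K' V, IsCompact K' ∧ K' ⊆ U ∧ IsOpen V ∧ K ⊆ V ∧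
      (∀ x ∈ V, χ x = 1) ∧ ∀ x, x ∉ K' → χ x = 0 := by
  obtain ⟨K', hK', hKK', hK'U⟩ := exists_compact_between hK hU hKU
  obtain ⟨f, h1, h0, -⟩ := exists_contMDiffMap_one_nhds_of_subset_interior (n := n)
    (modelWithCornersSelf ℝ E) hK.isClosed hKK'
  obtain ⟨V, hV, hKV, hVs⟩ := eventually_nhdsSet_iff_exists.1 h1
  exact ⟨f, f.contMDiff.contDiff, K', V, hK', hK'U, hV, hKV, hVs, h0⟩

theorem exists_reciprocal {K : Set V3} (hK : IsCompact K) {g : V3 → ℝ} (hg : ContDiff ℝ 2 g)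
    (h0 : ∀ x ∈ K, g x ≠ 0) :
    ∃ b : V3 → ℝ, ContDiff ℝ 2 b ∧ ∃ V, IsOpen V ∧ K ⊆ V ∧ ∀ x ∈ V, b x * g x = 1 := by
  have hU : IsOpen {x | g x ≠ 0} := isOpen_ne_fun hg.continuous continuous_const
  obtain ⟨χ, hχ, K', V, hK', hK'U, hV, hKV, h1, hoff⟩ := exists_cutoff hK hU h0 2
  refine ⟨fun x => χ x * (g x)⁻¹, contDiff_of_eq_zero_off (n := 2) hK'.isClosed hK'U
    (fun x hx => (hχ.contDiffAt).mul (hg.contDiffAt.inv hx)) fun x hx => by simp [hoff x hx],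
    V ∩ {x | g x ≠ 0}, hV.inter hU, fun x hx => ⟨hKV hx, h0 x hx⟩, fun x hx => ?_⟩
  change χ x * (g x)⁻¹ * g x = 1
  rw [h1 x hx.1, one_mul, inv_mul_cancel₀ hx.2]

theorem sum_pdx_sq_le (g : V3 → ℝ) (x : V3) : ∑ i, pdx g i x ^ 2 ≤ ‖fderiv ℝ g x‖ ^ 2 := by
  set s : V3 := fun i => SignType.sign (pdx g i x) with hs
  have h1 : fderiv ℝ g x s = ∑ i, |pdx g i x| := by
    have : s = ∑ i, s i • (Pi.single i (1 : ℝ) : V3) := by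
      funext j
      simp [Finset.sum_apply, Pi.single_apply]
    rw [this, map_sum]
    refine Finset.sum_congr rfl fun i _ => ?_
    rw [map_smul, smul_eq_mul]
    exact sign_mul_self _
  have h2 : ‖s‖ ≤ 1 := by
    rw [pi_norm_le_iff_of_nonneg zero_le_one]
    intro i
    simp only [hs]
    rcases SignType.sign (pdx g i x) <;> simp
  have h3 : ∑ i, |pdx g i x| ≤ ‖fderiv ℝ g x‖ := by
    rw [← h1]
    refine (le_abs_self _).trans (((fderiv ℝ g x).le_opNorm s).trans ?_)
    exact mul_le_of_le_one_right (norm_nonneg _) h2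
  have h4 : ∑ i, pdx g i x ^ 2 ≤ (∑ i, |pdx g i x|) ^ 2 := by
    have := Finset.sum_sq_le_sq_sum_of_nonneg (s := Finset.univ) (f := fun i => |pdx g i x|)
      fun i _ => abs_nonneg _
    simpa [sq_abs] using this
  exact h4.trans (pow_le_pow_left₀ (Finset.sum_nonneg fun _ _ => abs_nonneg _) h3 2)

theorem dGeom.pos {Ω : Set V3} {x0 : V3} {d D : ℝ} (h : dGeom Ω x0 d D) (hx0 : x0 ∉ closure Ω) :
    0 < d := by
  refine lt_of_le_of_ne h.1 fun hd => hx0 ?_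
  obtain ⟨x, hx, hxd⟩ := h.2.2.1.1
  simp only [← hd, sqd, ne_eq, OfNat.ofNat_ne_zero, not_false_eq_true, zero_pow] at hxd
  rw [Finset.sum_eq_zero_iff_of_nonneg fun _ _ => sq_nonneg _] at hxd
  have : x = x0 := funext fun i => by
    have := hxd i (Finset.mem_univ i)
    rw [sq_eq_zero_iff] at this
    linarith
  exact this ▸ hx

theorem carlemanSpeed_of_class {Ω : Set V3} {x0 : V3} {m θ cs c0 d D β T1 : ℝ} {g b : V3 → ℝ}
    {K V : Set V3} (hg : CClass Ω x0 m θ cs g) (hc0 : 0 < c0) (hcs : c0 ≤ cs)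
    (hgeom : dGeom Ω x0 d D) (hd : 0 < d) (hm : 0 < m) (hθ : θ < 1) (hβ : 0 < β)
    (hβd : 0 < c0 * d ^ 2 - β * D ^ 2) (hT1 : 0 ≤ T1) (hT1' : β + m * β * T1 / √c0 < θ * c0)
    (hTD : β * T1 ^ 2 ≤ D ^ 2) (hK : K ⊆ closure Ω) (hb : ContDiff ℝ 2 b) (hV : IsOpen V)
    (hKV : K ⊆ V) (hbg : ∀ x ∈ V, b x * g x = 1) :
    CarlemanSpeed x0 β (Icc (-T1) T1 ×ˢ K) b := by
  obtain ⟨sg, -, hlow, hbd, hcls⟩ := hg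
  have hs : 0 < √c0 := Real.sqrt_pos.2 hc0
  have hss : √c0 * √c0 = c0 := Real.mul_self_sqrt hc0.le
  refine ⟨hb.of_le one_le_two, θ, β / c0, β * T1 * m / (2 * c0 * √c0), 1 / m, m ^ 2 * (1 / c0) ^ 4,
    d ^ 2, hθ, by positivity, by positivity, ?_, by positivity, by positivity, by positivity, ?_⟩
  · rw [div_lt_iff₀ (by positivity), ← sub_pos]
    have : m * β * T1 / √c0 < θ * c0 - β := by linarith
    rw [div_lt_iff₀ hs] at this
    have e : (θ - β / c0) / 2 * (2 * c0 * √c0) = (θ * c0 - β) * √c0 := by field_simp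
    rw [e]
    linarith
  rintro ⟨t, x⟩ ⟨ht, hx⟩
  have hx' := hK hx
  simp only
  have hgx : c0 < g x := lt_of_le_of_lt hcs (hlow x hx')
  have hgp : 0 < g x := hc0.trans hgx
  have hbx : b x = 1 / g x := by rw [eq_div_iff hgp.ne']; exact hbg x (hKV hx)
  have hbp : 0 < b x := by rw [hbx]; positivity
  have hbc : b x ≤ 1 / c0 := by rw [hbx]; exact one_div_le_one_div_of_le hc0 hgx.le
  have hbm : 1 / m ≤ b x := by
    rw [hbx]; exact one_div_le_one_div_of_le hgp ((le_abs_self _).trans (hbd x hx').1)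
  have hpd : ∀ i, pdx b i x = - (b x ^ 2 * pdx g i x) := by
    intro i
    have h1 : (fun y => b y * g y) =ᶠ[nhds x] fun _ => 1 := by
      filter_upwards [hV.mem_nhds (hKV hx)] with y hy using hbg y hy
    have h2 := (pdx_congr h1 i).eq_of_nhds
    rw [pdx_mul (hb.differentiable two_ne_zero) (sg.differentiable two_ne_zero), pdx_const] at h2
    have h3 := hbg x (hKV hx)
    linear_combination b x * h2 - pdx b i x * h3
  have hgrad : ∑ i, pdx g i x ^ 2 ≤ m ^ 2 :=
    (sum_pdx_sq_le g x).trans (pow_le_pow_left₀ (norm_nonneg _) (hbd x hx').2.1 2)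
  have hgradb : ∑ i, pdx b i x ^ 2 ≤ m ^ 2 * b x ^ 4 := by
    have : ∑ i, pdx b i x ^ 2 = (∑ i, pdx g i x ^ 2) * b x ^ 4 := by
      rw [Finset.sum_mul]
      exact Finset.sum_congr rfl fun i _ => by rw [hpd]; ring
    rw [this]
    exact mul_le_mul_of_nonneg_right hgrad (by positivity)
  have ht2 : t ^ 2 ≤ T1 ^ 2 := sq_le_sq' ht.1 ht.2
  have hsx : d ^ 2 ≤ sqd x0 x := hgeom.2.2.1.2 ⟨x, hx', rfl⟩
  refine ⟨hbm, ?_, ?_, ?_, ?_, hsx, ?_⟩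
  · rw [div_eq_mul_one_div]
    exact mul_le_mul_of_nonneg_left hbc hβ.le
  · have h1 := hcls x hx'
    rw [div_le_iff₀ (by positivity)] at h1
    have h2 : ∑ i, (x i - x0 i) * pdx b i x = -(b x ^ 2 * ∑ i, pdx g i x * (x i - x0 i)) := by
      rw [Finset.mul_sum, ← Finset.sum_neg_distrib]
      exact Finset.sum_congr rfl fun i _ => by rw [hpd]; ring
    rw [h2]
    have h3 := mul_le_mul_of_nonneg_left h1 (sq_nonneg (b x))
    have h4 : b x ^ 2 * ((1 - θ) * (2 * g x)) = 2 * b x * (1 - θ) := by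
      linear_combination 2 * b x * (1 - θ) * hbg x (hKV hx)
    linarith
  · have e : 4 * (β * T1 * m / (2 * c0 * √c0)) ^ 2 = β ^ 2 * T1 ^ 2 * m ^ 2 * (1 / c0) ^ 3 := by
      have : √c0 ^ 2 = c0 := Real.sq_sqrt hc0.le
      rw [div_pow, mul_pow (2 * c0), this]
      field_simp
      ring
    rw [e]
    calc (β * t) ^ 2 * ∑ i, pdx b i x ^ 2 ≤ (β ^ 2 * T1 ^ 2) * (m ^ 2 * b x ^ 4) := by
          rw [mul_pow]
          exact mul_le_mul (mul_le_mul_of_nonneg_left ht2 (sq_nonneg _)) hgradb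
            (Finset.sum_nonneg fun _ _ => sq_nonneg _) (by positivity)
      _ = β ^ 2 * T1 ^ 2 * m ^ 2 * b x ^ 3 * b x := by ring
      _ ≤ _ := by gcongr
  · calc (β * t) ^ 2 * b x ≤ (β ^ 2 * T1 ^ 2) * (1 / c0) := by
          rw [mul_pow]; gcongr
      _ = β * (β * T1 ^ 2) / c0 := by ring
      _ ≤ β * D ^ 2 / c0 := by gcongr
      _ ≤ d ^ 2 := by rw [div_le_iff₀ hc0]; linarith
      _ ≤ _ := hsx
  · exact hgradb.trans (by gcongr)

theorem exists_times {m θ c0 d D β T : ℝ} (h : BetaCond m θ c0 d D β)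
    (hdD : d ^ 2 ≤ D ^ 2) (hd : 0 < d) (hT : √(D ^ 2 - d ^ 2) / √β < T) :
    ∃ T0 T1, 0 < T0 ∧ T0 < T1 ∧ T1 < T ∧ β + m * β * T1 / √c0 < θ * c0 ∧ β * T1 ^ 2 ≤ D ^ 2 ∧
      D ^ 2 - β * T0 ^ 2 < d ^ 2 := by
  obtain ⟨hβ, hb, -⟩ := h
  set S := √(D ^ 2 - d ^ 2) / √β with hS
  have hS0 : 0 ≤ S := by positivity
  have hsβ : 0 < √β := Real.sqrt_pos.2 hβ
  have h1 : β * S ^ 2 = D ^ 2 - d ^ 2 := by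
    rw [hS, div_pow, Real.sq_sqrt (by linarith), Real.sq_sqrt hβ.le]
    field_simp
  have h2 : β + m * β * S / √c0 < θ * c0 := by
    have : m * β * S / √c0 = m * √(D ^ 2 - d ^ 2) / √c0 * √β := by
      rw [hS]
      have : β = √β * √β := (Real.mul_self_sqrt hβ.le).symm
      rw [div_mul_eq_mul_div]
      congr 1
      rw [mul_div_assoc', div_eq_iff hsβ.ne']
      linear_combination m * √(D ^ 2 - d ^ 2) * this
    rw [this]
    exact hb
  have e1 : ∀ᶠ t in nhds S, β + m * β * t / √c0 < θ * c0 :=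
    Continuous.tendsto (by fun_prop : Continuous fun t => β + m * β * t / √c0) S
      |>.eventually_lt_const h2
  have e2 : ∀ᶠ t in nhds S, β * t ^ 2 < D ^ 2 :=
    Continuous.tendsto (by fun_prop : Continuous fun t : ℝ => β * t ^ 2) S
      |>.eventually_lt_const (by rw [h1]; linarith [pow_pos hd 2])
  have e3 : ∀ᶠ t in nhds S, t < T := eventually_lt_nhds hT
  obtain ⟨T1, hT1⟩ := ((e1.and (e2.and e3)).filter_mono nhdsWithin_le_nhds |>.and
    (self_mem_nhdsWithin (a := S) (s := Ioi S))).exists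
  obtain ⟨⟨g1, g2, g3⟩, g4⟩ := hT1
  have g4' : S < T1 := g4
  refine ⟨(S + T1) / 2, T1, by linarith, by linarith, g3, g1, g2.le, ?_⟩
  have : S ^ 2 < ((S + T1) / 2) ^ 2 := pow_lt_pow_left₀ (by linarith) hS0 two_ne_zero
  nlinarith

/-! ### A first-order Carleman estimate -/

/-- The trace of the Carleman weight at time zero. -/
def cw0 (x0 : V3) (τ : ℝ) (x : V3) : ℝ := Real.exp (2 * (τ * sqd x0 x))

theorem cw0_pos (x0 : V3) (τ : ℝ) (x : V3) : 0 < cw0 x0 τ x := Real.exp_pos _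

theorem contDiff_cw0 (x0 : V3) (τ : ℝ) : ContDiff ℝ 2 (cw0 x0 τ) := by
  have : ContDiff ℝ 2 (sqd x0) := by unfold sqd; fun_prop
  unfold cw0
  fun_prop

theorem pdx_sqd (x0 : V3) (i : Fin 3) : pdx (sqd x0) i = fun x => 2 * (x i - x0 i) := by
  have h : ∀ j, Differentiable ℝ fun x : V3 => x j - x0 j := fun j => by fun_prop
  have : sqd x0 = fun x => ∑ j, (x j - x0 j) ^ 2 := rfl
  rw [this, pdx_sum _ fun j => (h j).fun_pow 2]
  funext x
  have : ∀ j, pdx (fun x : V3 => (x j - x0 j) ^ 2) i x =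
      2 * (x j - x0 j) * if j = i then 1 else 0 := fun j => by
    rw [pdx_pow (h j), pdx_sub (by fun_prop) (by fun_prop), pdx_coord, pdx_const]
    simp
  simp [this]

theorem pdx_cw0 (x0 : V3) (τ : ℝ) (i : Fin 3) :
    pdx (cw0 x0 τ) i = fun x => 4 * τ * (x i - x0 i) * cw0 x0 τ x := by
  have hs : Differentiable ℝ (sqd x0) := by unfold sqd; fun_prop
  have : cw0 x0 τ = fun x => Real.exp (2 * (τ * sqd x0 x)) := rfl
  rw [this, pdx_exp (by fun_prop), pdx_mul (by fun_prop) (by fun_prop),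
    pdx_mul (by fun_prop) hs, pdx_const, pdx_const, pdx_sqd]
  funext x
  ring

theorem transport_carleman {K : Set V3} (hK : IsCompact K) (x0 : V3) {Φ : Fin 3 → V3 → ℝ}
    (hΦ : ∀ i, ContDiff ℝ 1 (Φ i)) (hne : ∀ x ∈ K, ∑ i, Φ i x * (x i - x0 i) ≠ 0) :
    ∃ c, 0 < c ∧ ∃ τ0, 1 ≤ τ0 ∧ ∀ τ, τ0 ≤ τ → ∀ g, ContDiff ℝ 1 g → VanOff K g →
      c * τ ^ 2 * ∫ x, g x ^ 2 * cw0 x0 τ x ≤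
        ∫ x, (∑ i, Φ i x * pdx g i x) ^ 2 * cw0 x0 τ x := by
  set m : V3 → ℝ := fun x => 2 * ∑ i, Φ i x * (x i - x0 i) with hm
  have sm : ContDiff ℝ 1 m := by fun_prop
  have dm : Differentiable ℝ m := sm.differentiable one_ne_zero
  set δ : V3 → ℝ := fun x => ∑ i, pdx (fun y => m y * Φ i y) i x with hδ
  have cδ : Continuous δ := continuous_finsetSum _ fun i _ =>
    (ContDiff.pdx (n := 0) (sm.mul (hΦ i)) i).continuous
  obtain ⟨M, hM⟩ := hK.exists_bound_of_continuousOn cδ.continuousOn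
  obtain ⟨a, ha, ham⟩ : ∃ a, 0 < a ∧ ∀ x ∈ K, a ≤ m x ^ 2 := by
    rcases K.eq_empty_or_nonempty with h | h
    · exact ⟨1, one_pos, by simp [h]⟩
    · obtain ⟨x, hx, hmin⟩ := hK.exists_isMinOn h (sm.continuous.pow 2).continuousOn
      refine ⟨m x ^ 2, ?_, fun y hy => hmin hy⟩
      have : m x ≠ 0 := mul_ne_zero two_ne_zero (hne x hx)
      positivity
  refine ⟨a / 2, by positivity, max 1 (2 * |M| / a), le_max_left _ _, fun τ hτ g hg og => ?_⟩
  have hτ1 : 1 ≤ τ := (le_max_left _ _).trans hτ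
  have hτ2 : 2 * |M| ≤ τ * a := by rw [← div_le_iff₀ ha]; exact (le_max_right _ _).trans hτ
  have sW : ContDiff ℝ 1 (cw0 x0 τ) := (contDiff_cw0 x0 τ).of_le one_le_two
  have dW := sW.differentiable one_ne_zero
  have cW := sW.continuous
  have dg := hg.differentiable one_ne_zero
  have cg := hg.continuous
  have cgi : ∀ i, Continuous (pdx g i) := fun i => (ContDiff.pdx (n := 0) hg i).continuous
  have ogi : ∀ i, VanOff K (pdx g i) := fun i => og.pdx hK.isClosed i
  have cΦ : ∀ i, Continuous (Φ i) := fun i => (hΦ i).continuous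
  have key : ∫ x, ∑ i, pdx (fun y => (m y * Φ i y) * (g y ^ 2 * cw0 x0 τ y)) i x = 0 := by
    have o : ∀ i, VanOff K fun y => (m y * Φ i y) * (g y ^ 2 * cw0 x0 τ y) := fun i x hx => by
      simp [og x hx]
    have s : ∀ i, ContDiff ℝ 1 fun y => (m y * Φ i y) * (g y ^ 2 * cw0 x0 τ y) := fun i => by
      have := hΦ i; fun_prop
    rw [integral_finsetSum _ fun i _ => ((o i).pdx hK.isClosed i).integrable hK
      (ContDiff.pdx (n := 0) (s i) i).continuous]
    exact Finset.sum_eq_zero fun i _ => integral_pdx (s i) hK (o i) i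
  have expand : ∀ x, ∑ i, pdx (fun y => (m y * Φ i y) * (g y ^ 2 * cw0 x0 τ y)) i x =
      δ x * g x ^ 2 * cw0 x0 τ x + 2 * m x * g x * (∑ i, Φ i x * pdx g i x) * cw0 x0 τ x
        + 2 * τ * m x ^ 2 * g x ^ 2 * cw0 x0 τ x := by
    intro x
    have e : ∀ i, pdx (fun y => (m y * Φ i y) * (g y ^ 2 * cw0 x0 τ y)) i x =
        pdx (fun y => m y * Φ i y) i x * (g x ^ 2 * cw0 x0 τ x) + m x * Φ i x *
          (2 * g x * pdx g i x * cw0 x0 τ x + g x ^ 2 * (4 * τ * (x i - x0 i) * cw0 x0 τ x)) := by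
      intro i
      have dΦ := (hΦ i).differentiable one_ne_zero
      rw [pdx_mul (dm.fun_mul dΦ) ((dg.fun_pow 2).fun_mul dW), pdx_mul (dg.fun_pow 2) dW,
        pdx_pow dg, pdx_cw0]
      simp
    have em : m x = 2 * ∑ i, Φ i x * (x i - x0 i) := rfl
    have eδ : δ x = ∑ i, pdx (fun y => m y * Φ i y) i x := rfl
    rw [Finset.sum_congr rfl fun i _ => e i, eδ]
    simp only [Fin.sum_univ_three] at em ⊢
    linear_combination -2 * τ * m x * g x ^ 2 * cw0 x0 τ x * em
  simp only [expand] at key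
  have low : ∀ x, a / 2 * τ ^ 2 * (g x ^ 2 * cw0 x0 τ x) ≤
      (∑ i, Φ i x * pdx g i x) ^ 2 * cw0 x0 τ x + τ * (δ x * g x ^ 2 * cw0 x0 τ x +
        2 * m x * g x * (∑ i, Φ i x * pdx g i x) * cw0 x0 τ x
        + 2 * τ * m x ^ 2 * g x ^ 2 * cw0 x0 τ x) := by
    intro x
    by_cases hx : x ∈ K
    · have h1 := hM x hx
      rw [Real.norm_eq_abs] at h1
      have h2 : -|M| ≤ δ x := by
        have := neg_abs_le (δ x); have := le_abs_self M; linarith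
      have h3 := ham x hx
      have h4 : a / 2 * τ ^ 2 ≤ τ * δ x + τ ^ 2 * m x ^ 2 := by nlinarith [sq_nonneg τ]
      have h5 := mul_le_mul_of_nonneg_right h4 (sq_nonneg (g x))
      have h6 : a / 2 * τ ^ 2 * g x ^ 2 ≤ (∑ i, Φ i x * pdx g i x) ^ 2 + τ * (δ x * g x ^ 2 +
          2 * m x * g x * (∑ i, Φ i x * pdx g i x) + 2 * τ * m x ^ 2 * g x ^ 2) := by
        nlinarith [sq_nonneg (∑ i, Φ i x * pdx g i x + τ * m x * g x)]
      have h7 := mul_le_mul_of_nonneg_right h6 (cw0_pos x0 τ x).le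
      linarith
    · simp [og x hx, ogi _ x hx]
  have cS : Continuous fun x => ∑ i, Φ i x * pdx g i x :=
    continuous_finsetSum _ fun i _ => (cΦ i).mul (cgi i)
  have cm := sm.continuous
  have i1 : Integrable fun x => g x ^ 2 * cw0 x0 τ x :=
    VanOff.integrable (Z := K) (fun x hx => by simp [og x hx]) hK (by fun_prop)
  have i2 : Integrable fun x => (∑ i, Φ i x * pdx g i x) ^ 2 * cw0 x0 τ x :=
    VanOff.integrable (Z := K) (fun x hx => by simp [ogi _ x hx]) hK (by fun_prop)
  have i3 : Integrable fun x => δ x * g x ^ 2 * cw0 x0 τ x +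
        2 * m x * g x * (∑ i, Φ i x * pdx g i x) * cw0 x0 τ x
        + 2 * τ * m x ^ 2 * g x ^ 2 * cw0 x0 τ x :=
    VanOff.integrable (Z := K) (fun x hx => by simp [og x hx]) hK (by fun_prop)
  have := integral_mono (i1.const_mul (a / 2 * τ ^ 2)) (i2.add (i3.const_mul τ)) low
  simp only [Pi.add_apply] at this
  rwa [integral_const_mul, integral_add i2 (i3.const_mul τ), integral_const_mul, key, mul_zero,
    add_zero] at this

/-! ### The sources at time zero -/

/-- A differentiable function of `x` controlled, with its gradient, by a density on `Z`. -/
structure LO1 (Z : Set P4) (E : P4 → ℝ) (Y : V3 → ℝ) : Prop where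
  diff : Differentiable ℝ Y
  val : LO Z E fun z => Y z.2
  grad : ∀ k, LO Z E fun z => pdx Y k z.2

namespace LO1

variable {Z : Set P4} {E : P4 → ℝ} {X Y : V3 → ℝ}

theorem add (hX : LO1 Z E X) (hY : LO1 Z E Y) : LO1 Z E fun x => X x + Y x :=
  ⟨hX.diff.fun_add hY.diff, hX.val.add hY.val, fun k => by
    rw [pdx_add hX.diff hY.diff]
    exact (hX.grad k).add (hY.grad k)⟩

theorem sub (hX : LO1 Z E X) (hY : LO1 Z E Y) : LO1 Z E fun x => X x - Y x :=
  ⟨hX.diff.fun_sub hY.diff, hX.val.sub hY.val, fun k => by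
    rw [pdx_sub hX.diff hY.diff]
    exact (hX.grad k).sub (hY.grad k)⟩

theorem sum {ι : Type*} (s : Finset ι) {X : ι → V3 → ℝ} (h : ∀ i, LO1 Z E (X i)) :
    LO1 Z E fun x => ∑ i ∈ s, X i x :=
  ⟨Differentiable.fun_sum fun i _ => (h i).diff, LO.sum s fun i => (h i).val, fun k => by
    rw [pdx_sum s fun i => (h i).diff]
    exact LO.sum s fun i => (h i).grad k⟩

theorem coef (hZ : IsCompact Z) {c : V3 → ℝ} (hc : ContDiff ℝ 1 c) (hX : LO1 Z E X) :
    LO1 Z E fun x => c x * X x :=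
  ⟨(hc.differentiable one_ne_zero).fun_mul hX.diff, hX.val.coefX hZ hc.continuous, fun k => by
    rw [pdx_mul (hc.differentiable one_ne_zero) hX.diff]
    exact (hX.val.coefX hZ (ContDiff.pdx (n := 0) hc k).continuous).add
      ((hX.grad k).coefX hZ hc.continuous)⟩

theorem of_mul (hZ : IsCompact Z) {c : V3 → ℝ} (hc : ContDiff ℝ 1 c) (h0 : ∀ z ∈ Z, c z.2 ≠ 0)
    (hY : Differentiable ℝ Y) (h : LO1 Z E fun x => c x * Y x) : LO1 Z E Y := by
  have cc : ContinuousOn (fun z : P4 => c z.2) Z :=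
    (hc.continuous.comp continuous_snd).continuousOn
  have v : LO Z E fun z => Y z.2 := LO.of_mul hZ cc h0 h.val
  refine ⟨hY, v, fun k => LO.of_mul hZ cc h0 ?_⟩
  refine ((h.grad k).sub (v.coefX hZ (ContDiff.pdx (n := 0) hc k).continuous)).congr fun z _ => ?_
  rw [pdx_mul (hc.differentiable one_ne_zero) hY]
  ring

/-- If `pΦ = αv + γw` then `Φ·∇p` and `Φ·∇∂ₖp` are controlled by first-order quantities. -/
theorem transport (hZ : IsCompact Z) {p α γ : V3 → ℝ} {Φ v w : Fin 3 → V3 → ℝ}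
    (hp : ContDiff ℝ 2 p) (hα : ContDiff ℝ 2 α) (hγ : ContDiff ℝ 2 γ)
    (hΦ : ∀ i, ContDiff ℝ 2 (Φ i)) (rel : ∀ i x, p x * Φ i x = α x * v i x + γ x * w i x)
    (lp : LO1 Z E p) (lv : ∀ i, LO1 Z E (v i)) (lw : ∀ i, LO1 Z E (w i))
    (le : LO1 Z E fun x => ∑ i, pdx (v i) i x) (lf : LO1 Z E fun x => ∑ i, pdx (w i) i x) :
    (LO Z E fun z => ∑ i, Φ i z.2 * pdx p i z.2) ∧
      ∀ k, LO Z E fun z => ∑ i, Φ i z.2 * pdx (pdx p k) i z.2 := by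
  have dp := hp.differentiable two_ne_zero
  have dα := hα.differentiable two_ne_zero
  have dγ := hγ.differentiable two_ne_zero
  have dΦ := fun i => (hΦ i).differentiable two_ne_zero
  have hS : (fun x => ∑ i, Φ i x * pdx p i x) = fun x =>
      ((∑ i, (pdx α i x * v i x + pdx γ i x * w i x)) + (α x * ∑ i, pdx (v i) i x)
        + γ x * ∑ i, pdx (w i) i x) - (∑ i, pdx (Φ i) i x) * p x := by
    funext x
    have e : ∀ i, pdx p i x * Φ i x + p x * pdx (Φ i) i x = (pdx α i x * v i x + α x * pdx (v i) i x)
        + (pdx γ i x * w i x + γ x * pdx (w i) i x) := fun i => by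
      have h1 : (fun x => p x * Φ i x) = fun x => α x * v i x + γ x * w i x := funext (rel i)
      have h2 := congrFun (congrArg (fun f => pdx f i) h1) x
      rwa [pdx_mul dp (dΦ i), pdx_add (dα.fun_mul (lv i).diff) (dγ.fun_mul (lw i).diff),
        pdx_mul dα (lv i).diff, pdx_mul dγ (lw i).diff] at h2
    simp only [Fin.sum_univ_three]
    linear_combination e 0 + e 1 + e 2
  have l1 : LO1 Z E fun x => ∑ i, Φ i x * pdx p i x := by
    rw [hS]
    exact (((sum _ fun i => ((lv i).coef hZ (ContDiff.pdx (n := 1) hα i)).add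
      ((lw i).coef hZ (ContDiff.pdx (n := 1) hγ i))).add (le.coef hZ (hα.of_le one_le_two))).add
      (lf.coef hZ (hγ.of_le one_le_two))).sub
      (lp.coef hZ (ContDiff.sum fun i _ => ContDiff.pdx (n := 1) (hΦ i) i))
  refine ⟨l1.val, fun k => ?_⟩
  have cp := fun i => ContDiff.pdx (n := 1) hp i
  refine ((l1.grad k).sub (LO.sum Finset.univ fun i => (lp.grad i).coefX hZ
    (ContDiff.pdx (n := 1) (hΦ i) k).continuous)).congr fun z _ => ?_
  have dpi : ∀ i, Differentiable ℝ (pdx p i) := fun i => (cp i).differentiable one_ne_zero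
  rw [pdx_sum _ fun i => (dΦ i).fun_mul (dpi i)]
  simp only
  rw [← Finset.sum_sub_distrib]
  refine Finset.sum_congr rfl fun i _ => ?_
  rw [pdx_mul (dΦ i) (dpi i), pdx_comm hp k i]
  ring

end LO1

/-- A function together with its first derivatives. -/
def jet1 (p : V3 → ℝ) (o : Option (Fin 3)) : V3 → ℝ := o.elim p (pdx p)

theorem contDiff_jet1 {p : V3 → ℝ} (hp : ContDiff ℝ 2 p) (o) : ContDiff ℝ 1 (jet1 p o) := by
  rcases o with _ | k
  · exact hp.of_le one_le_two
  · exact ContDiff.pdx (n := 1) hp k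

theorem VanOff.jet1 {p : V3 → ℝ} {K : Set V3} (h : VanOff K p) (hK : IsClosed K) (o) :
    VanOff K (jet1 p o) := by
  rcases o with _ | k
  · exact h
  · exact h.pdx hK k

/-- Squared size of two functions together with their gradients. -/
def jetSq (p1 p2 : V3 → ℝ) (x : V3) : ℝ := ∑ o, (jet1 p1 o x ^ 2 + jet1 p2 o x ^ 2)

theorem jetSq_nonneg (p1 p2 : V3 → ℝ) (x : V3) : 0 ≤ jetSq p1 p2 x :=
  Finset.sum_nonneg fun _ _ => by positivity

theorem sq_jet1_le (p1 p2 : V3 → ℝ) (x : V3) (o : Option (Fin 3)) :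
    jet1 p1 o x ^ 2 + jet1 p2 o x ^ 2 ≤ jetSq p1 p2 x :=
  Finset.single_le_sum (f := fun o => jet1 p1 o x ^ 2 + jet1 p2 o x ^ 2)
    (fun _ _ => by positivity) (Finset.mem_univ o)

namespace Coefs

variable {c : Coefs} {Z : Set P4} {K : Set V3} {b1 b2 b3 : V3 → ℝ} {v w : P4 → V3}

theorem Good.mono (h : c.Good Z b1 b2 b3) {Z' : Set P4} (hZ : ∀ z ∈ Z', ∃ z' ∈ Z, z'.2 = z.2) :
    c.Good Z' b1 b2 b3 where
  sρ11 := h.sρ11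
  sρ12 := h.sρ12
  sρ22 := h.sρ22
  sμ := h.sμ
  slam := h.slam
  sq := h.sq
  sr := h.sr
  sμ2 := h.sμ2
  sμ3 := h.sμ3
  ϱ0 z hz := by obtain ⟨y, hy, e⟩ := hZ z hz; exact e ▸ h.ϱ0 y hy
  ρμ0 z hz := by obtain ⟨y, hy, e⟩ := hZ z hz; exact e ▸ h.ρμ0 y hy
  μ20 z hz := by obtain ⟨y, hy, e⟩ := hZ z hz; exact e ▸ h.μ20 y hy
  μ30 z hz := by obtain ⟨y, hy, e⟩ := hZ z hz; exact e ▸ h.μ30 y hy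
  ne z hz := by obtain ⟨y, hy, e⟩ := hZ z hz; exact e ▸ h.ne y hy
  tr z hz := by obtain ⟨y, hy, e⟩ := hZ z hz; exact e ▸ h.tr y hy
  det z hz := by obtain ⟨y, hy, e⟩ := hZ z hz; exact e ▸ h.det y hy
  hb1 z hz := by obtain ⟨y, hy, e⟩ := hZ z hz; exact e ▸ h.hb1 y hy
  hb2 z hz := by obtain ⟨y, hy, e⟩ := hZ z hz; exact e ▸ h.hb2 y hy
  hb3 z hz := by obtain ⟨y, hy, e⟩ := hZ z hz; exact e ▸ h.hb3 y hy

/-- The energy of the unknowns at time zero. -/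
def energy0 (c : Coefs) (v w : P4 → V3) (x : V3) : ℝ :=
  ∑ k, (c.fam v w k (0, x) ^ 2 + gradX2 (c.fam v w k) (0, x))

theorem energy0_nonneg (x : V3) : 0 ≤ c.energy0 v w x :=
  Finset.sum_nonneg fun _ _ => add_nonneg (sq_nonneg _) (gradX2_nonneg _ _)

theorem Good.time_zero (h : c.Good Z b1 b2 b3) (hK : IsCompact K) (hKZ : {(0 : ℝ)} ×ˢ K ⊆ Z)
    (hv : ∀ i, ContDiff ℝ 3 fun y => v y i) (hw : ∀ i, ContDiff ℝ 3 fun y => w y i)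
    {p1 p2 : V3 → ℝ} (hp1 : ContDiff ℝ 2 p1) (hp2 : ContDiff ℝ 2 p2) {Φ1 Φ2 : Fin 3 → V3 → ℝ}
    (hΦ1 : ∀ i, ContDiff ℝ 2 (Φ1 i)) (hΦ2 : ∀ i, ContDiff ℝ 2 (Φ2 i))
    (rel1 : ∀ i x, p1 x * Φ1 i x = c.ρ11 x * v (0, x) i + c.ρ12 x * w (0, x) i)
    (rel2 : ∀ i x, p2 x * Φ2 i x = c.ρ12 x * v (0, x) i + c.ρ22 x * w (0, x) i) :
    ∃ C, 0 ≤ C ∧ ∀ o, ∀ x ∈ K,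
      (∑ i, Φ1 i x * pdx (jet1 p1 o) i x) ^ 2 ≤ C * (c.energy0 v w x + jetSq p1 p2 x) ∧
      (∑ i, Φ2 i x * pdx (jet1 p2 o) i x) ^ 2 ≤ C * (c.energy0 v w x + jetSq p1 p2 x) := by
  set Z0 : Set P4 := {(0 : ℝ)} ×ˢ K with hZ0
  have cZ0 : IsCompact Z0 := isCompact_singleton.prod hK
  have h0 : c.Good Z0 b1 b2 b3 := h.mono fun z hz => ⟨z, hKZ hz, rfl⟩
  set G : P4 → ℝ := fun z =>
    ∑ k, (c.fam v w k z ^ 2 + gradX2 (c.fam v w k) z) + jetSq p1 p2 z.2 with hG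
  have hterm : ∀ k z, 0 ≤ c.fam v w k z ^ 2 + gradX2 (c.fam v w k) z := fun k z =>
    add_nonneg (sq_nonneg _) (gradX2_nonneg _ _)
  have hG0 : ∀ z, 0 ≤ G z := fun z =>
    add_nonneg (Finset.sum_nonneg fun k _ => hterm k z) (jetSq_nonneg _ _ _)
  have hGk : ∀ k z, c.fam v w k z ^ 2 + gradX2 (c.fam v w k) z ≤ G z := fun k z =>
    (Finset.single_le_sum (f := fun k => c.fam v w k z ^ 2 + gradX2 (c.fam v w k) z)
      (fun k _ => hterm k z) (Finset.mem_univ k)).trans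
      (le_add_of_nonneg_right (jetSq_nonneg _ _ _))
  have hGp : ∀ o (z : P4), jet1 p1 o z.2 ^ 2 + jet1 p2 o z.2 ^ 2 ≤ G z := fun o z =>
    (sq_jet1_le p1 p2 z.2 o).trans (le_add_of_nonneg_left (Finset.sum_nonneg fun k _ => hterm k z))
  set E : P4 → ℝ := fun z => √(G z) with hE
  have l : ∀ k, LO Z0 E (c.fam v w k) := fun k => LO.of_sq_le fun z => by
    have := hGk k z; linarith [gradX2_nonneg (c.fam v w k) z]
  have lx : ∀ k j, LO Z0 E (pd (c.fam v w k) (ex j)) := fun k j => LO.of_sq_le fun z => by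
    have := hGk k z
    linarith [sq_pd_le_gradX2 (c.fam v w k) j z, sq_nonneg (c.fam v w k z)]
  obtain ⟨⟨le, lex⟩, lf, lfx⟩ := h0.div_LO cZ0 hv hw (fun k => l (Sum.inr k))
    fun k j => lx (Sum.inr k) j
  have slice : ∀ {f : P4 → ℝ}, ContDiff ℝ 1 f → LO Z0 E f → (∀ j, LO Z0 E (pd f (ex j))) →
      LO1 Z0 E fun x => f (0, x) := by
    intro f hf h1 h2
    refine ⟨(contDiff_slice hf 0).differentiable one_ne_zero, h1.congr fun z hz => ?_,
      fun k => (h2 k).congr fun z hz => ?_⟩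
    · have : z = (0, z.2) := Prod.ext hz.1 rfl
      rw [this]
    · have e : z = (0, z.2) := Prod.ext hz.1 rfl
      conv_rhs => rw [e]
      rw [pd_ex_eq_pdx_slice (hf.differentiable one_ne_zero _)]
  have sdiv_slice : ∀ {u : P4 → V3}, (∀ i, ContDiff ℝ 3 fun y => u y i) →
      (fun x => ∑ i, pdx (fun y => u (0, y) i) i x) = fun x => sdiv u (0, x) := by
    intro u hu
    funext x
    exact Finset.sum_congr rfl fun i _ =>
      (pd_ex_eq_pdx_slice ((hu i).differentiable three_ne_zero _) i).symm
  have lv : ∀ i, LO1 Z0 E fun x => v (0, x) i := fun i =>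
    slice ((hv i).of_le (by norm_num)) (l (Sum.inl (Sum.inl i))) (lx (Sum.inl (Sum.inl i)))
  have le1 : LO1 Z0 E fun x => ∑ i, pdx (fun y => v (0, y) i) i x := by
    rw [sdiv_slice hv]
    exact slice ((ContDiff.sdiv (n := 2) hv).of_le one_le_two) le lex
  have lf1 : LO1 Z0 E fun x => ∑ i, pdx (fun y => w (0, y) i) i x := by
    rw [sdiv_slice hw]
    exact slice ((ContDiff.sdiv (n := 2) hw).of_le one_le_two) lf lfx
  have lp1 : LO1 Z0 E p1 := ⟨hp1.differentiable two_ne_zero, LO.of_sq_le fun z => by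
      have := hGp none z
      exact (le_add_of_nonneg_right (sq_nonneg (jet1 p2 none z.2))).trans this,
    fun k => LO.of_sq_le fun z => by
      have := hGp (some k) z
      exact (le_add_of_nonneg_right (sq_nonneg (jet1 p2 (some k) z.2))).trans this⟩
  have lp2 : LO1 Z0 E p2 := ⟨hp2.differentiable two_ne_zero, LO.of_sq_le fun z => by
      have := hGp none z
      exact (le_add_of_nonneg_left (sq_nonneg (jet1 p1 none z.2))).trans this,
    fun k => LO.of_sq_le fun z => by
      have := hGp (some k) z
      exact (le_add_of_nonneg_left (sq_nonneg (jet1 p1 (some k) z.2))).trans this⟩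
  have s12 : ContDiff ℝ 1 c.ρ12 := h.sρ12.of_le one_le_two
  have s22 : ContDiff ℝ 1 c.ρ22 := h.sρ22.of_le one_le_two
  have lw : ∀ i, LO1 Z0 E fun x => w (0, x) i := fun i => by
    refine LO1.of_mul cZ0 s22 (fun z hz => left_ne_zero_of_mul (h0.ρμ0 z hz))
      ((contDiff_slice (hw i) 0).differentiable three_ne_zero) ?_
    have : (fun x => c.ρ22 x * w (0, x) i) = fun x => Φ2 i x * p2 x - c.ρ12 x * v (0, x) i := by
      funext x
      linear_combination - rel2 i x
    rw [this]
    exact (lp2.coef cZ0 ((hΦ2 i).of_le one_le_two)).sub ((lv i).coef cZ0 s12)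
  obtain ⟨t1, t1'⟩ := LO1.transport cZ0 hp1 h.sρ11 h.sρ12 hΦ1 rel1 lp1 lv lw le1 lf1
  obtain ⟨t2, t2'⟩ := LO1.transport cZ0 hp2 h.sρ12 h.sρ22 hΦ2 rel2 lp2 lv lw le1 lf1
  obtain ⟨C, hC, hCk⟩ := LO.exists_sq_le
    (X := fun (o : Option (Fin 3)) z => ∑ i, Φ1 i z.2 * pdx (jet1 p1 o) i z.2)
    (fun o => by rcases o with _ | k; exacts [t1, t1' k]) hG0
  obtain ⟨C', hC', hCk'⟩ := LO.exists_sq_le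
    (X := fun (o : Option (Fin 3)) z => ∑ i, Φ2 i z.2 * pdx (jet1 p2 o) i z.2)
    (fun o => by rcases o with _ | k; exacts [t2, t2' k]) hG0
  refine ⟨C + C', by positivity, fun o x hx => ?_⟩
  have hz : ((0 : ℝ), x) ∈ Z0 := ⟨rfl, hx⟩
  have g0 := hG0 (0, x)
  have g1 := hCk o _ hz
  have g2 := hCk' o _ hz
  have m1 := mul_nonneg hC g0
  have m2 := mul_nonneg hC' g0
  change _ ≤ (C + C') * G (0, x) ∧ _ ≤ (C + C') * G (0, x)
  simp only at g1 g2
  constructor <;> linarith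

end Coefs

/-! ### Vanishing of the sources -/

theorem cw_zero (x0 : V3) (β τ : ℝ) (x : V3) : cw x0 β τ (0, x) = cw0 x0 τ x := by
  simp [cw, cw0, psi]

theorem VanOff.src {Z : Set P4} {F1 F2 : P4 → V3} (hZ : IsClosed Z)
    (o1 : ∀ i, VanOff Z fun y => F1 y i) (o2 : ∀ i, VanOff Z fun y => F2 y i) :
    VanOff Z (_root_.src F1 F2) := fun z hz => by
  have h1 : ∀ i, F1 z i = 0 := fun i => o1 i z hz
  have h2 : ∀ i, F2 z i = 0 := fun i => o2 i z hz
  have h3 : ∀ i, _root_.gradX2 (fun y => F1 y i) z = 0 := fun i => (o1 i).gradX2 hZ z hz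
  have h4 : ∀ i, _root_.gradX2 (fun y => F2 y i) z = 0 := fun i => (o2 i).gradX2 hZ z hz
  simp [_root_.src, n2, vGradX2, h1, h2, h3, h4]

theorem continuous_src {F1 F2 : P4 → V3} (h1 : ∀ i, ContDiff ℝ 1 fun y => F1 y i)
    (h2 : ∀ i, ContDiff ℝ 1 fun y => F2 y i) : Continuous (src F1 F2) := by
  have c1 := fun i => (h1 i).continuous
  have c2 := fun i => (h2 i).continuous
  have g1 := fun i => continuous_gradX2 (h1 i)
  have g2 := fun i => continuous_gradX2 (h2 i)
  unfold src n2 vGradX2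
  fun_prop

theorem continuous_jetSq {p1 p2 : V3 → ℝ} (h1 : ContDiff ℝ 2 p1) (h2 : ContDiff ℝ 2 p2) :
    Continuous (jetSq p1 p2) := by
  have c1 := fun o => (contDiff_jet1 h1 o).continuous
  have c2 := fun o => (contDiff_jet1 h2 o).continuous
  unfold jetSq
  fun_prop

theorem VanOff.jetSq {p1 p2 : V3 → ℝ} {K : Set V3} (hK : IsClosed K) (h1 : VanOff K p1)
    (h2 : VanOff K p2) : VanOff K (_root_.jetSq p1 p2) := fun x hx =>
  Finset.sum_eq_zero fun o _ => by simp [h1.jet1 hK o x hx, h2.jet1 hK o x hx]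

theorem integral_src_le {x0 : V3} {β T0 T1 D : ℝ} {K : Set V3} {S : P4 → ℝ} {P : V3 → ℝ} {A : ℝ}
    (hK : IsCompact K) (hβ : 0 ≤ β) (hT0 : 0 ≤ T0) (hS : Continuous S)
    (oS : VanOff (Icc (-T1) T1 ×ˢ K) S) (hP : Continuous P) (oP : VanOff K P) (hP0 : ∀ x, 0 ≤ P x)
    (hA : 0 ≤ A) (hSP : ∀ z, |z.1| ≤ T0 → S z ≤ A * P z.2)
    (hD : ∀ x ∈ K, sqd x0 x ≤ D ^ 2) :
    ∃ B, 0 ≤ B ∧ ∀ τ, 0 ≤ τ → ∫ z, S z * cw x0 β τ z ≤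
      B * ((∫ x, P x * cw0 x0 τ x) + Real.exp (2 * (τ * (D ^ 2 - β * T0 ^ 2)))) := by
  set Z : Set P4 := Icc (-T1) T1 ×ˢ K with hZdef
  have hZ : IsCompact Z := isCompact_Icc.prod hK
  obtain ⟨M, hM⟩ := hZ.exists_bound_of_continuousOn hS.continuousOn
  set f : ℝ → ℝ := (Icc (-T1) T1).indicator fun _ => 1 with hf
  have f0 : ∀ t, 0 ≤ f t := fun t => indicator_nonneg (fun _ _ => zero_le_one) t
  have if' : Integrable f := (integrable_indicator_iff measurableSet_Icc).2
    (integrableOn_const isCompact_Icc.measure_lt_top.ne)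
  set k : P4 → ℝ := Z.indicator fun _ => 1 with hk
  have k0 : ∀ z, 0 ≤ k z := fun z => indicator_nonneg (fun _ _ => zero_le_one) z
  have ik : Integrable k := (integrable_indicator_iff hZ.measurableSet).2
    (integrableOn_const hZ.measure_lt_top.ne)
  have hMM : 0 ≤ |M| := abs_nonneg M
  have i0 : 0 ≤ ∫ t, f t := integral_nonneg f0
  have j0 : 0 ≤ ∫ z, k z := integral_nonneg k0
  refine ⟨A * (∫ t, f t) + |M| * ∫ z, k z, by positivity, fun τ hτ => ?_⟩
  set e := Real.exp (2 * (τ * (D ^ 2 - β * T0 ^ 2))) with he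
  have e0 : 0 < e := Real.exp_pos _
  have cW : Continuous (cw0 x0 τ) := (contDiff_cw0 x0 τ).continuous
  have iP : Integrable fun x => P x * cw0 x0 τ x :=
    VanOff.integrable (Z := K) (fun x hx => by simp [oP x hx]) hK (by fun_prop)
  have hPW : ∀ x, 0 ≤ P x * cw0 x0 τ x := fun x => mul_nonneg (hP0 x) (cw0_pos _ _ _).le
  have ccw : Continuous (cw x0 β τ) := (contDiff_cw x0 β τ (n := 0)).continuous
  have iS : Integrable fun z => S z * cw x0 β τ z :=
    VanOff.integrable (Z := Z) (fun x hx => by simp [oS x hx]) hZ (by fun_prop)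
  have iFP : Integrable fun z : P4 => f z.1 * (P z.2 * cw0 x0 τ z.2) := if'.mul_prod iP
  have low : ∀ z : P4, S z * cw x0 β τ z ≤
      A * (f z.1 * (P z.2 * cw0 x0 τ z.2)) + |M| * e * k z := by
    rintro ⟨t, x⟩
    have t1 : 0 ≤ A * (f t * (P x * cw0 x0 τ x)) := mul_nonneg hA (mul_nonneg (f0 _) (hPW x))
    have t2 : 0 ≤ |M| * e * k (t, x) := mul_nonneg (by positivity) (k0 _)
    by_cases hz : (t, x) ∈ Z
    · have hft : f t = 1 := indicator_of_mem hz.1 _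
      have hkz : k (t, x) = 1 := indicator_of_mem hz _
      rcases le_or_gt |t| T0 with ht | ht
      · have h1 : cw x0 β τ (t, x) ≤ cw0 x0 τ x := by
          unfold cw cw0 psi
          apply Real.exp_le_exp.2
          have : 0 ≤ τ * (β * t ^ 2) := by positivity
          simp only
          linarith
        have h2 := mul_le_mul (hSP (t, x) ht) h1 (cw_pos _ _ _ _).le (mul_nonneg hA (hP0 x))
        simp only [hft, one_mul]
        simp only at h2
        linarith
      · have h1 : cw x0 β τ (t, x) ≤ e := by
          unfold cw psi
          apply Real.exp_le_exp.2
          have h3 : T0 ^ 2 ≤ t ^ 2 := by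
            rw [← sq_abs t]; exact pow_le_pow_left₀ hT0 ht.le 2
          have h4 := mul_le_mul_of_nonneg_left h3 hβ
          have h5 := hD x hz.2
          have : τ * (sqd x0 x - β * t ^ 2) ≤ τ * (D ^ 2 - β * T0 ^ 2) :=
            mul_le_mul_of_nonneg_left (by linarith) hτ
          simp only
          linarith
        have h2 : S (t, x) ≤ |M| := (le_abs_self _).trans ((hM _ hz).trans (le_abs_self M))
        have h3 := mul_le_mul h2 h1 (cw_pos _ _ _ _).le hMM
        rw [hkz]
        linarith
    · rw [oS _ hz, zero_mul]
      exact add_nonneg t1 t2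
  have h1 := integral_mono iS ((iFP.const_mul A).add (ik.const_mul (|M| * e))) low
  simp only [Pi.add_apply] at h1
  rw [integral_add (iFP.const_mul A) (ik.const_mul (|M| * e)), integral_const_mul,
    integral_const_mul] at h1
  have h2 : ∫ z : P4, f z.1 * (P z.2 * cw0 x0 τ z.2) = (∫ t, f t) * ∫ x, P x * cw0 x0 τ x :=
    integral_prod_mul f fun x => P x * cw0 x0 τ x
  rw [h2] at h1
  have h3 : 0 ≤ ∫ x, P x * cw0 x0 τ x := integral_nonneg hPW
  refine h1.trans ?_
  have m1 := mul_nonneg (mul_nonneg hA i0) e0.le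
  have m2 := mul_nonneg (mul_nonneg hMM j0) h3
  nlinarith

theorem eq_zero_of_weighted_bound {x0 : V3} {K : Set V3} {P : V3 → ℝ} {d κ a C1 C2 τ0 : ℝ}
    (hK : IsCompact K) (hP : Continuous P) (oP : VanOff K P) (hP0 : ∀ x, 0 ≤ P x)
    (hd : ∀ x ∈ K, d ^ 2 ≤ sqd x0 x) (hκ : κ < d ^ 2) (ha : 0 < a)
    (h : ∀ τ, τ0 ≤ τ → a * τ ^ 2 * ∫ x, P x * cw0 x0 τ x ≤
      C1 * (∫ x, P x * cw0 x0 τ x) + C2 * Real.exp (2 * (τ * κ))) : ∀ x, P x = 0 := by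
  have iP : Integrable P := oP.integrable hK hP
  have J0 : 0 ≤ ∫ x, P x := integral_nonneg hP0
  have bound : ∀ᶠ τ in Filter.atTop, ∫ x, P x ≤ C2 * Real.exp (-(2 * (d ^ 2 - κ)) * τ) := by
    filter_upwards [Filter.eventually_ge_atTop τ0, Filter.eventually_ge_atTop 1,
      Filter.eventually_ge_atTop ((C1 + 1) / a)] with τ h0 h1 h2
    have cW : Continuous (cw0 x0 τ) := (contDiff_cw0 x0 τ).continuous
    have iPW : Integrable fun x => P x * cw0 x0 τ x :=
      VanOff.integrable (Z := K) (fun x hx => by simp [oP x hx]) hK (by fun_prop)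
    have I0 : 0 ≤ ∫ x, P x * cw0 x0 τ x :=
      integral_nonneg fun x => mul_nonneg (hP0 x) (cw0_pos _ _ _).le
    have h3 := h τ h0
    rw [div_le_iff₀ ha] at h2
    have h4 : C1 + 1 ≤ a * τ ^ 2 := by
      nlinarith [mul_nonneg (mul_nonneg ha.le (by linarith : 0 ≤ τ)) (sub_nonneg.2 h1)]
    have h5 : ∫ x, P x * cw0 x0 τ x ≤ C2 * Real.exp (2 * (τ * κ)) := by nlinarith
    have h6 : Real.exp (2 * (τ * d ^ 2)) * ∫ x, P x ≤ ∫ x, P x * cw0 x0 τ x := by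
      rw [← integral_const_mul]
      refine integral_mono (iP.const_mul _) iPW fun x => ?_
      by_cases hx : x ∈ K
      · have : Real.exp (2 * (τ * d ^ 2)) ≤ cw0 x0 τ x := by
          apply Real.exp_le_exp.2
          have := mul_le_mul_of_nonneg_left (hd x hx) (by linarith : 0 ≤ τ)
          linarith
        have := mul_le_mul_of_nonneg_left this (hP0 x)
        simp only
        linarith
      · simp [oP x hx]
    have e0 : Real.exp (-(2 * (d ^ 2 - κ)) * τ) =
        Real.exp (2 * (τ * κ)) / Real.exp (2 * (τ * d ^ 2)) := by
      rw [← Real.exp_sub]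
      congr 1
      ring
    rw [e0, mul_div_assoc', le_div_iff₀ (Real.exp_pos _)]
    linarith
  have lim : Filter.Tendsto (fun τ => C2 * Real.exp (-(2 * (d ^ 2 - κ)) * τ)) Filter.atTop
      (nhds (C2 * 0)) := by
    refine Filter.Tendsto.const_mul _ (Real.tendsto_exp_atBot.comp ?_)
    exact Filter.tendsto_id.const_mul_atTop_of_neg (by linarith)
  have J1 : ∫ x, P x ≤ 0 := by
    have := ge_of_tendsto lim bound
    simpa using this
  have J2 := (integral_eq_zero_iff_of_nonneg hP0 iP).1 (le_antisymm J1 J0)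
  have J3 := (Continuous.ae_eq_iff_eq volume hP continuous_const).1 J2
  exact fun x => congrFun J3 x

namespace Coefs

variable {c : Coefs} {K : Set V3} {b1 b2 b3 : V3 → ℝ} {v w F1 F2 : P4 → V3}

theorem Good.sources_vanish {x0 : V3} {β T0 T1 d D A : ℝ}
    (h : c.Good (Icc (-T1) T1 ×ˢ K) b1 b2 b3) (hK : IsCompact K) (hβ : 0 < β) (hT0 : 0 ≤ T0)
    (hT1 : 0 ≤ T1) (hspeed : ∀ k, CarlemanSpeed x0 β (Icc (-T1) T1 ×ˢ K) (speed b1 b2 b3 k))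
    (hv : ∀ i, ContDiff ℝ 3 fun y => v y i) (hw : ∀ i, ContDiff ℝ 3 fun y => w y i)
    (ov : ∀ i, VanOff (Icc (-T1) T1 ×ˢ K) fun y => v y i)
    (ow : ∀ i, VanOff (Icc (-T1) T1 ×ˢ K) fun y => w y i)
    (hF1 : ∀ i, ContDiff ℝ 1 fun y => F1 y i) (hF2 : ∀ i, ContDiff ℝ 1 fun y => F2 y i)
    (o1 : ∀ i, VanOff (Icc (-T1) T1 ×ˢ K) fun y => F1 y i)
    (o2 : ∀ i, VanOff (Icc (-T1) T1 ×ˢ K) fun y => F2 y i)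
    (hB : c.Biot v w F1 F2 univ) {p1 p2 : V3 → ℝ} (hp1 : ContDiff ℝ 2 p1) (hp2 : ContDiff ℝ 2 p2)
    (op1 : VanOff K p1) (op2 : VanOff K p2) {Φ1 Φ2 : Fin 3 → V3 → ℝ}
    (hΦ1 : ∀ i, ContDiff ℝ 2 (Φ1 i)) (hΦ2 : ∀ i, ContDiff ℝ 2 (Φ2 i))
    (ne1 : ∀ x ∈ K, ∑ i, Φ1 i x * (x i - x0 i) ≠ 0)
    (ne2 : ∀ x ∈ K, ∑ i, Φ2 i x * (x i - x0 i) ≠ 0)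
    (rel1 : ∀ i x, p1 x * Φ1 i x = c.ρ11 x * v (0, x) i + c.ρ12 x * w (0, x) i)
    (rel2 : ∀ i x, p2 x * Φ2 i x = c.ρ12 x * v (0, x) i + c.ρ22 x * w (0, x) i)
    (hA : 0 ≤ A) (hsrc : ∀ z, |z.1| ≤ T0 → src F1 F2 z ≤ A * jetSq p1 p2 z.2)
    (hd : ∀ x ∈ K, d ^ 2 ≤ sqd x0 x) (hD : ∀ x ∈ K, sqd x0 x ≤ D ^ 2)
    (hκ : D ^ 2 - β * T0 ^ 2 < d ^ 2) : ∀ x, p1 x = 0 ∧ p2 x = 0 := by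
  set Z : Set P4 := Icc (-T1) T1 ×ˢ K with hZdef
  have hZ : IsCompact Z := isCompact_Icc.prod hK
  have hKZ : {(0 : ℝ)} ×ˢ K ⊆ Z := fun z hz =>
    ⟨by rw [show z.1 = 0 from hz.1]; exact ⟨by linarith, hT1⟩, hz.2⟩
  obtain ⟨C0, hC0, hC0'⟩ := h.time_zero hK hKZ hv hw hp1 hp2 hΦ1 hΦ2 rel1 rel2
  obtain ⟨C1, hC1, hred⟩ := h.reduction hZ hv hw ov ow hF1 hF2 hB
  obtain ⟨C2, hC2, τ2, hτ2, hcarl⟩ := carleman_system hβ hZ hspeed hC1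
  obtain ⟨a1, ha1, τ3, hτ3, tr1⟩ := transport_carleman hK x0
    (fun i => (hΦ1 i).of_le one_le_two) ne1
  obtain ⟨a2, ha2, τ4, hτ4, tr2⟩ := transport_carleman hK x0
    (fun i => (hΦ2 i).of_le one_le_two) ne2
  have oS := VanOff.src hZ.isClosed o1 o2
  have cS := continuous_src hF1 hF2
  have oP := VanOff.jetSq hK.isClosed op1 op2
  have cP := continuous_jetSq hp1 hp2
  have P0 := jetSq_nonneg p1 p2
  obtain ⟨B, hB0, hBτ⟩ := integral_src_le (x0 := x0) hK hβ.le hT0 cS oS cP oP P0 hA hsrc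
    hD
  have cf := h.contDiff_fam hv hw
  have off := vanOff_fam (c := c) hZ.isClosed ov ow
  have ceg : ∀ k, Continuous fun x => c.fam v w k (0, x) ^ 2 + gradX2 (c.fam v w k) (0, x) :=
    fun k => by
      have e1 := (cf k).continuous
      have e2 := continuous_gradX2 ((cf k).of_le one_le_two)
      fun_prop
  have oeg : ∀ k, VanOff K fun x => c.fam v w k (0, x) ^ 2 + gradX2 (c.fam v w k) (0, x) :=
    fun k x hx => by
      have hz : ((0 : ℝ), x) ∉ Z := fun hz => hx hz.2
      simp [off k _ hz, (off k).gradX2 hZ.isClosed _ hz]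
  set N : ℝ := (Fintype.card Unk : ℝ) with hN
  set H := 2 * (Fintype.card (Option (Fin 3)) : ℝ) with hH
  have main : ∀ τ, max τ2 (max τ3 τ4) ≤ τ → min a1 a2 * τ ^ 2 * ∫ x, jetSq p1 p2 x * cw0 x0 τ x ≤
      (H * C0 * (N * C2 * B + 1)) * (∫ x, jetSq p1 p2 x * cw0 x0 τ x) +
        (H * C0 * (N * C2 * B)) * Real.exp (2 * (τ * (D ^ 2 - β * T0 ^ 2))) := by
    intro τ hτ
    simp only [max_le_iff] at hτ
    have cW : Continuous (cw0 x0 τ) := (contDiff_cw0 x0 τ).continuous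
    have W0 := cw0_pos x0 τ
    set I := ∫ x, jetSq p1 p2 x * cw0 x0 τ x with hI
    set e := Real.exp (2 * (τ * (D ^ 2 - β * T0 ^ 2))) with he
    have iP : Integrable fun x => jetSq p1 p2 x * cw0 x0 τ x :=
      VanOff.integrable (Z := K) (fun x hx => by simp [oP x hx]) hK (by fun_prop)
    have ie : ∀ k, Integrable fun x =>
        (c.fam v w k (0, x) ^ 2 + gradX2 (c.fam v w k) (0, x)) * cw0 x0 τ x := fun k =>
      VanOff.integrable (Z := K) (fun x hx => by
        have := oeg k x hx
        simp only at this
        rw [this, zero_mul]) hK ((ceg k).mul cW)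
    have hE : ∫ x, c.energy0 v w x * cw0 x0 τ x ≤ N * (C2 * (B * (I + e))) := by
      have e1 : ∀ x, c.energy0 v w x * cw0 x0 τ x =
          ∑ k, (c.fam v w k (0, x) ^ 2 + gradX2 (c.fam v w k) (0, x)) * cw0 x0 τ x := fun x => by
        rw [energy0, Finset.sum_mul]
      simp only [e1]
      rw [integral_finsetSum _ fun k _ => ie k]
      refine (Finset.sum_le_card_nsmul _ _ (C2 * (B * (I + e))) fun k _ => ?_).trans
        (by simp [hN])
      have := hcarl τ hτ.1 (c.fam v w) (src F1 F2) cf off cS oS (src_nonneg F1 F2) hred k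
      simp only [cw_zero] at this
      exact this.trans (mul_le_mul_of_nonneg_left (hBτ τ (by linarith)) hC2)
    have iE : Integrable fun x => c.energy0 v w x * cw0 x0 τ x := by
      have : (fun x => c.energy0 v w x * cw0 x0 τ x) = fun x =>
          ∑ k, (c.fam v w k (0, x) ^ 2 + gradX2 (c.fam v w k) (0, x)) * cw0 x0 τ x := by
        funext x
        rw [energy0, Finset.sum_mul]
      rw [this]
      exact integrable_finsetSum _ fun k _ => ie k
    have side : ∀ {p : V3 → ℝ} {Φ : Fin 3 → V3 → ℝ} {a : ℝ} (o : Option (Fin 3)), 0 < a →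
        ContDiff ℝ 2 p → VanOff K p → (∀ i, ContDiff ℝ 2 (Φ i)) → min a1 a2 ≤ a →
        (a * τ ^ 2 * ∫ x, jet1 p o x ^ 2 * cw0 x0 τ x ≤
          ∫ x, (∑ i, Φ i x * pdx (jet1 p o) i x) ^ 2 * cw0 x0 τ x) →
        (∀ x ∈ K, (∑ i, Φ i x * pdx (jet1 p o) i x) ^ 2 ≤
          C0 * (c.energy0 v w x + jetSq p1 p2 x)) →
        min a1 a2 * τ ^ 2 * ∫ x, jet1 p o x ^ 2 * cw0 x0 τ x ≤
          C0 * ((∫ x, c.energy0 v w x * cw0 x0 τ x) + I) := by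
      intro p Φ a o ha hp op hΦ hmin hcar hb
      have q0 : 0 ≤ ∫ x, jet1 p o x ^ 2 * cw0 x0 τ x :=
        integral_nonneg fun x => mul_nonneg (sq_nonneg _) (W0 x).le
      refine (mul_le_mul_of_nonneg_right (mul_le_mul_of_nonneg_right hmin (sq_nonneg τ)) q0).trans
        (hcar.trans ?_)
      rw [hI, ← integral_add iE iP, ← integral_const_mul]
      have ci : ∀ i, Continuous (pdx (jet1 p o) i) := fun i =>
        (ContDiff.pdx (n := 0) (contDiff_jet1 hp o) i).continuous
      have cΦ : ∀ i, Continuous (Φ i) := fun i => (hΦ i).continuous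
      have oi : ∀ i, VanOff K (pdx (jet1 p o) i) := fun i => (op.jet1 hK.isClosed o).pdx hK.isClosed i
      refine integral_mono (VanOff.integrable (Z := K) (fun x hx => by simp [oi _ x hx]) hK
        (by fun_prop)) ((iE.add iP).const_mul C0) fun x => ?_
      beta_reduce
      by_cases hx : x ∈ K
      · have := mul_le_mul_of_nonneg_right (hb x hx) (W0 x).le
        linarith
      · simp only [oi _ x hx, mul_zero, Finset.sum_const_zero]
        have := mul_nonneg hC0 (mul_nonneg (add_nonneg (energy0_nonneg (c := c) (v := v) (w := w) x)
          (P0 x)) (W0 x).le)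
        linarith
    have split : I = ∑ o, ((∫ x, jet1 p1 o x ^ 2 * cw0 x0 τ x) +
        ∫ x, jet1 p2 o x ^ 2 * cw0 x0 τ x) := by
      have ij : ∀ {p : V3 → ℝ} (o : Option (Fin 3)), ContDiff ℝ 2 p → VanOff K p →
          Integrable fun x => jet1 p o x ^ 2 * cw0 x0 τ x := fun {p} o hp op => by
        have := (contDiff_jet1 hp o).continuous
        exact VanOff.integrable (Z := K) (fun x hx => by simp [op.jet1 hK.isClosed o x hx]) hK
          (by fun_prop)
      have e1 : ∀ x, jetSq p1 p2 x * cw0 x0 τ x =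
          ∑ o, (jet1 p1 o x ^ 2 * cw0 x0 τ x + jet1 p2 o x ^ 2 * cw0 x0 τ x) := fun x => by
        rw [jetSq, Finset.sum_mul]
        exact Finset.sum_congr rfl fun o _ => by ring
      rw [hI]
      simp only [e1]
      refine (integral_finsetSum _ fun o _ => (ij o hp1 op1).add (ij o hp2 op2)).trans ?_
      exact Finset.sum_congr rfl fun o _ => integral_add (ij o hp1 op1) (ij o hp2 op2)
    have tot : min a1 a2 * τ ^ 2 * I ≤ H * (C0 * ((∫ x, c.energy0 v w x * cw0 x0 τ x) + I)) := by
      rw [split, Finset.mul_sum, ← split]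
      refine (Finset.sum_le_card_nsmul _ _
        (2 * (C0 * ((∫ x, c.energy0 v w x * cw0 x0 τ x) + I))) fun o _ => ?_).trans
        (le_of_eq (by rw [nsmul_eq_mul, hH, Finset.card_univ]; ring))
      have s1 := side o ha1 hp1 op1 hΦ1 (min_le_left _ _)
        (tr1 τ hτ.2.1 _ (contDiff_jet1 hp1 o) (op1.jet1 hK.isClosed o)) fun x hx => (hC0' o x hx).1
      have s2 := side o ha2 hp2 op2 hΦ2 (min_le_right _ _)
        (tr2 τ hτ.2.2 _ (contDiff_jet1 hp2 o) (op2.jet1 hK.isClosed o)) fun x hx => (hC0' o x hx).2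
      rw [mul_add]
      linarith
    refine tot.trans ?_
    have H0 : 0 ≤ H * C0 := mul_nonneg (by positivity) hC0
    have := mul_le_mul_of_nonneg_left hE H0
    linarith
  have key := eq_zero_of_weighted_bound hK cP oP P0 hd hκ (lt_min ha1 ha2) main
  intro x
  have h1 := sq_jet1_le p1 p2 x none
  rw [key x] at h1
  have e1 : p1 x ^ 2 + p2 x ^ 2 ≤ 0 := h1
  exact ⟨by nlinarith [sq_nonneg (p1 x), sq_nonneg (p2 x)],
    by nlinarith [sq_nonneg (p1 x), sq_nonneg (p2 x)]⟩

end Coefs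

/-! ### Coefficients satisfying the standing assumptions -/

theorem trace_det_of_roots {A : Matrix (Fin 2) (Fin 2) ℝ} {a b : ℝ}
    (ha : (A - a • (1 : Matrix (Fin 2) (Fin 2) ℝ)).det = 0)
    (hb : (A - b • (1 : Matrix (Fin 2) (Fin 2) ℝ)).det = 0) (hab : a ≠ b) :
    A 0 0 + A 1 1 = a + b ∧ A 0 0 * A 1 1 - A 0 1 * A 1 0 = a * b := by
  simp only [Matrix.det_fin_two, Matrix.sub_apply, Matrix.smul_apply, Matrix.one_apply,
    smul_eq_mul] at ha hb
  norm_num at ha hb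
  have h1 : (a - b) * (A 0 0 + A 1 1 - (a + b)) = 0 := by linear_combination hb - ha
  have h2 : A 0 0 + A 1 1 = a + b := by
    have := (mul_eq_zero.1 h1).resolve_left (sub_ne_zero.2 hab)
    linarith
  exact ⟨h2, by linear_combination ha + a * h2⟩

theorem Coefs.exists_good {Ω K : Set V3} {x0 : V3} {ρ11 ρ12 ρ22 μ lam q r μ2 μ3 : V3 → ℝ}
    {m θ c1 c2 c3 : ℝ} (hA1 : AssumpA1 Ω ρ11 ρ12 ρ22 μ lam q r)
    (hA2 : AssumpA2 Ω x0 ρ11 ρ12 ρ22 μ lam q r μ2 μ3 m θ c1 c2 c3) (hK : IsCompact K)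
    (hKΩ : K ⊆ closure Ω) :
    ∃ b1 b2 b3 : V3 → ℝ, ∃ V : Set V3, IsOpen V ∧ K ⊆ V ∧
      (ContDiff ℝ 2 b1 ∧ ContDiff ℝ 2 b2 ∧ ContDiff ℝ 2 b3) ∧
      (∀ x ∈ V, b1 x * ((ρ11 x * ρ22 x - ρ12 x ^ 2)⁻¹ * ρ22 x * μ x) = 1 ∧ b2 x * μ2 x = 1 ∧
        b3 x * μ3 x = 1) ∧
      ∀ I : Set ℝ, (⟨ρ11, ρ12, ρ22, μ, lam, q, r, μ2, μ3⟩ : Coefs).Good (I ×ˢ K) b1 b2 b3 := by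
  obtain ⟨s1, s2, s3, s4, s5, s6, s7, pos, dpos, -⟩ := hA1
  obtain ⟨eig, k1, k2, k3⟩ := hA2
  have nz : ∀ {g : V3 → ℝ} {cs : ℝ}, CClass Ω x0 m θ cs g → ∀ x ∈ K, g x ≠ 0 :=
    fun h x hx => (h.2.1.trans (h.2.2.1 x (hKΩ hx))).ne'
  obtain ⟨b1, hb1, V1, oV1, KV1, e1⟩ := exists_reciprocal hK k1.1 (nz k1)
  obtain ⟨b2, hb2, V2, oV2, KV2, e2⟩ := exists_reciprocal hK k2.1 (nz k2)
  obtain ⟨b3, hb3, V3', oV3, KV3, e3⟩ := exists_reciprocal hK k3.1 (nz k3)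
  have roots : ∀ x ∈ closure Ω,
      (ρ22 x * (μ x + lam x) + -ρ12 x * q x + ρ22 x * μ x) + (-ρ12 x * q x + ρ11 x * r x) =
        (ρ11 x * ρ22 x - ρ12 x ^ 2) * (μ2 x + μ3 x) ∧
      (ρ22 x * (μ x + lam x) + -ρ12 x * q x + ρ22 x * μ x) * (-ρ12 x * q x + ρ11 x * r x) -
        (ρ22 x * q x + -ρ12 x * r x) * (-ρ12 x * (μ x + lam x) + ρ11 x * q x + -ρ12 x * μ x) =
        (ρ11 x * ρ22 x - ρ12 x ^ 2) ^ 2 * (μ2 x * μ3 x) := fun x hx => by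
    obtain ⟨d2, d3, -, -, hne⟩ := eig x hx
    have hϱ := (dpos x hx).ne'
    obtain ⟨t1, t2⟩ := trace_det_of_roots d2 d3 hne
    simp only [Amat, Matrix.smul_apply, Matrix.mul_apply, Fin.sum_univ_two, Matrix.of_apply,
      Matrix.cons_val_zero, Matrix.cons_val_one, smul_eq_mul] at t1 t2
    generalize ρ11 x * ρ22 x - ρ12 x ^ 2 = ϱ at hϱ t1 t2 ⊢
    constructor
    · rw [← t1]
      field_simp
      ring
    · rw [← t2]
      field_simp
      ring
  refine ⟨b1, b2, b3, V1 ∩ V2 ∩ V3', (oV1.inter oV2).inter oV3,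
    subset_inter (subset_inter KV1 KV2) KV3, ⟨hb1, hb2, hb3⟩,
    fun x hx => ⟨e1 x hx.1.1, e2 x hx.1.2, e3 x hx.2⟩, fun I => ?_⟩
  exact
    { sρ11 := s1, sρ12 := s2, sρ22 := s3, sμ := s4, slam := s5, sq := s6, sr := s7
      sμ2 := k2.1, sμ3 := k3.1
      ϱ0 := fun z hz => (dpos _ (hKΩ hz.2)).ne'
      ρμ0 := fun z hz => by
        obtain ⟨-, p1, -, -, p2, -⟩ := pos _ (hKΩ hz.2)
        exact (mul_pos p1 p2).ne'
      μ20 := fun z hz => nz k2 _ hz.2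
      μ30 := fun z hz => nz k3 _ hz.2
      ne := fun z hz => sub_ne_zero.2 (eig _ (hKΩ hz.2)).2.2.2.2
      tr := fun z hz => (roots _ (hKΩ hz.2)).1
      det := fun z hz => (roots _ (hKΩ hz.2)).2
      hb1 := fun z hz => by
        have h1 := e1 _ (KV1 hz.2)
        have h2 := (dpos _ (hKΩ hz.2)).ne'
        simp only [ϱ]
        field_simp at h1
        linarith
      hb2 := fun z hz => e2 _ (KV2 hz.2)
      hb3 := fun z hz => e3 _ (KV3 hz.2) }

/-! ### Biot's operator: locality and differentiation in time -/

theorem Set.EqOn.pd {f g : P4 → ℝ} {O : Set P4} (h : EqOn f g O) (hO : IsOpen O) (d : P4) :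
    EqOn (pd f d) (pd g d) O := fun _ hz =>
  (pd_congr (h.eventuallyEq_of_mem (hO.mem_nhds hz)) d).self_of_nhds

theorem pd_ex_eq_zero_of_slice {f : P4 → ℝ} {Ω : Set V3} {t : ℝ} (hΩ : IsOpen Ω)
    (hf : Differentiable ℝ f) (h : ∀ x ∈ Ω, f (t, x) = 0) (i : Fin 3) :
    ∀ x ∈ Ω, pd f (ex i) (t, x) = 0 := fun x hx => by
  rw [pd_ex_eq_pdx_slice (hf _)]
  have h1 : (fun y => f (t, y)) =ᶠ[nhds x] fun _ => 0 := by
    filter_upwards [hΩ.mem_nhds hx] with y hy using h y hy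
  simp [pdx, h1.fderiv_eq]

/-- `g` is the time derivative of `f`. -/
def TimeDeriv (f g : P4 → ℝ) : Prop := ∀ t x, HasDerivAt (fun s => f (s, x)) (g (t, x)) t

namespace TimeDeriv

variable {f g f' g' : P4 → ℝ}

theorem of_differentiable (hf : Differentiable ℝ f) : TimeDeriv f (pd f et) := fun t x => by
  have h1 : HasDerivAt (fun s : ℝ => ((s, x) : P4)) et t :=
    (hasDerivAt_id t).prodMk (hasDerivAt_const t x)
  exact (hf (t, x)).hasFDerivAt.comp_hasDerivAt t h1

theorem pd_eq (hf : Differentiable ℝ f) (h : TimeDeriv f g) : _root_.pd f et = g := by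
  funext ⟨t, x⟩
  exact (of_differentiable hf t x).unique (h t x)

theorem add (hf : TimeDeriv f f') (hg : TimeDeriv g g') :
    TimeDeriv (fun z => f z + g z) fun z => f' z + g' z := fun t x => (hf t x).add (hg t x)

theorem sub (hf : TimeDeriv f f') (hg : TimeDeriv g g') :
    TimeDeriv (fun z => f z - g z) fun z => f' z - g' z := fun t x => (hf t x).sub (hg t x)

theorem coef_mul (c : V3 → ℝ) (hf : TimeDeriv f f') :
    TimeDeriv (fun z => c z.2 * f z) fun z => c z.2 * f' z := fun t x => (hf t x).const_mul (c x)

theorem mul_coef (c : V3 → ℝ) (hf : TimeDeriv f f') :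
    TimeDeriv (fun z => f z * c z.2) fun z => f' z * c z.2 := fun t x => (hf t x).mul_const (c x)

theorem sum {ι : Type*} [Fintype ι] {F F' : ι → P4 → ℝ} (h : ∀ i, TimeDeriv (F i) (F' i)) :
    TimeDeriv (fun z => ∑ i, F i z) fun z => ∑ i, F' i z := fun t x =>
  HasDerivAt.fun_sum fun i _ => h i t x

theorem pd (hf : ContDiff ℝ 2 f) (h : TimeDeriv f g) (d : P4) :
    TimeDeriv (pd f d) (_root_.pd g d) := by
  rw [← h.pd_eq (hf.differentiable two_ne_zero), ← pd_comm hf]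
  exact of_differentiable ((ContDiff.pd (n := 1) hf d).differentiable one_ne_zero)

theorem slap (hf : ContDiff ℝ 3 f) : TimeDeriv (slap f) (_root_.slap (_root_.pd f et)) := by
  rw [← pd_slap hf]
  exact of_differentiable ((ContDiff.slap (n := 1) hf).differentiable one_ne_zero)

theorem dtt (hf : ContDiff ℝ 3 f) : TimeDeriv (dtt f) (_root_.dtt (_root_.pd f et)) :=
  of_differentiable ((ContDiff.pd (n := 1) (ContDiff.pd (n := 2) hf et) et).differentiable
    one_ne_zero)

theorem sdiv {v : P4 → V3} (hv : ∀ i, ContDiff ℝ 2 fun y => v y i) :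
    TimeDeriv (sdiv v) (_root_.sdiv (Dt v)) :=
  sum fun i => (of_differentiable ((hv i).differentiable two_ne_zero)).pd (hv i) _

end TimeDeriv

namespace Coefs

variable {c : Coefs} {v w v' w' : P4 → V3} {Z O : Set P4}

/-- Left-hand side of the first equation of Biot's system. -/
def row1 (c : Coefs) (v w : P4 → V3) : P4 → V3 := fun z i =>
  c.ρ11 z.2 * dtt (fun y => v y i) z + c.ρ12 z.2 * dtt (fun y => w y i) z
    - lameOp c.μ c.lam v z i - pd (fun y => c.q y.2 * sdiv w y) (ex i) z

/-- Left-hand side of the second equation of Biot's system. -/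
def row2 (c : Coefs) (v w : P4 → V3) : P4 → V3 := fun z i =>
  c.ρ12 z.2 * dtt (fun y => v y i) z + c.ρ22 z.2 * dtt (fun y => w y i) z
    - pd (fun y => c.q y.2 * sdiv v y) (ex i) z - pd (fun y => c.r y.2 * sdiv w y) (ex i) z

theorem biot_rows (Q : Set P4) : c.Biot v w (c.row1 v w) (c.row2 v w) Q :=
  fun _ _ _ => ⟨rfl, rfl⟩

/-- The coefficients of Biot's system are twice continuously differentiable. -/
structure Smooth (c : Coefs) : Prop where
  sρ11 : ContDiff ℝ 2 c.ρ11
  sρ12 : ContDiff ℝ 2 c.ρ12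
  sρ22 : ContDiff ℝ 2 c.ρ22
  sμ : ContDiff ℝ 2 c.μ
  slam : ContDiff ℝ 2 c.lam
  sq : ContDiff ℝ 2 c.q
  sr : ContDiff ℝ 2 c.r

theorem contDiff_coef_sdiv {a : V3 → ℝ} (ha : ContDiff ℝ 2 a)
    (hv : ∀ i, ContDiff ℝ 3 fun y => v y i) : ContDiff ℝ 2 fun y => a y.2 * sdiv v y := by
  have := ContDiff.sdiv (n := 2) hv
  fun_prop

theorem contDiff_lameOp {μ lam : V3 → ℝ} (hμ : ContDiff ℝ 2 μ) (hlam : ContDiff ℝ 2 lam)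
    (hv : ∀ i, ContDiff ℝ 3 fun y => v y i) (i : Fin 3) :
    ContDiff ℝ 1 fun y => lameOp μ lam v y i := by
  have h1 := ContDiff.slap (n := 1) (hv i)
  have h2 : ContDiff ℝ 1 (sdiv v) := (ContDiff.sdiv (n := 2) hv).of_le one_le_two
  have h3 : ContDiff ℝ 1 (pd (sdiv v) (ex i)) :=
    ContDiff.pd (n := 1) (ContDiff.sdiv (n := 2) hv) (ex i)
  have h4 : ∀ i j, ContDiff ℝ 1 (pd (fun y => v y i) (ex j)) := fun i j =>
    (ContDiff.pd (n := 2) (hv i) _).of_le one_le_two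
  have h5 := ContDiff.pdx (n := 1) hlam i
  have h6 := fun j => ContDiff.pdx (n := 1) hμ j
  have h7 := hμ.of_le (one_le_two (α := WithTop ℕ∞))
  have h8 := hlam.of_le (one_le_two (α := WithTop ℕ∞))
  unfold lameOp
  fun_prop

theorem contDiff_dtt {f : P4 → ℝ} (hf : ContDiff ℝ 3 f) : ContDiff ℝ 1 (dtt f) :=
  ContDiff.pd (n := 1) (ContDiff.pd (n := 2) hf et) et

theorem Smooth.contDiff_row1 (h : c.Smooth) (hv : ∀ i, ContDiff ℝ 3 fun y => v y i)
    (hw : ∀ i, ContDiff ℝ 3 fun y => w y i) (i : Fin 3) :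
    ContDiff ℝ 1 fun y => c.row1 v w y i := by
  have h1 := contDiff_lameOp h.sμ h.slam hv i
  have h2 : ContDiff ℝ 1 _ := ContDiff.pd (n := 1) (contDiff_coef_sdiv h.sq hw) (ex i)
  have h3 := contDiff_dtt (hv i)
  have h4 := contDiff_dtt (hw i)
  have h5 := h.sρ11.of_le (one_le_two (α := WithTop ℕ∞))
  have h6 := h.sρ12.of_le (one_le_two (α := WithTop ℕ∞))
  unfold row1
  fun_prop

theorem Smooth.contDiff_row2 (h : c.Smooth) (hv : ∀ i, ContDiff ℝ 3 fun y => v y i)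
    (hw : ∀ i, ContDiff ℝ 3 fun y => w y i) (i : Fin 3) :
    ContDiff ℝ 1 fun y => c.row2 v w y i := by
  have h1 : ContDiff ℝ 1 _ := ContDiff.pd (n := 1) (contDiff_coef_sdiv h.sq hv) (ex i)
  have h2 : ContDiff ℝ 1 _ := ContDiff.pd (n := 1) (contDiff_coef_sdiv h.sr hw) (ex i)
  have h3 := contDiff_dtt (hv i)
  have h4 := contDiff_dtt (hw i)
  have h5 := h.sρ22.of_le (one_le_two (α := WithTop ℕ∞))
  have h6 := h.sρ12.of_le (one_le_two (α := WithTop ℕ∞))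
  unfold row2
  fun_prop

theorem eqOn_sdiv (hO : IsOpen O) (hv : ∀ i, EqOn (fun y => v y i) (fun y => v' y i) O) :
    EqOn (sdiv v) (sdiv v') O := fun _ hz =>
  Finset.sum_congr rfl fun i _ => (hv i).pd hO _ hz

theorem eqOn_pd_coef_sdiv (a : V3 → ℝ) (hO : IsOpen O)
    (hv : ∀ i, EqOn (fun y => v y i) (fun y => v' y i) O) (i : Fin 3) :
    EqOn (pd (fun y => a y.2 * sdiv v y) (ex i)) (pd (fun y => a y.2 * sdiv v' y) (ex i)) O :=
  EqOn.pd (fun z hz => by simp only [eqOn_sdiv hO hv hz]) hO _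

theorem eqOn_rows (c : Coefs) (hO : IsOpen O)
    (hv : ∀ i, EqOn (fun y => v y i) (fun y => v' y i) O)
    (hw : ∀ i, EqOn (fun y => w y i) (fun y => w' y i) O) :
    ∀ z ∈ O, c.row1 v w z = c.row1 v' w' z ∧ c.row2 v w z = c.row2 v' w' z := fun z hz => by
  have a1 : ∀ i, dtt (fun y => v y i) z = dtt (fun y => v' y i) z := fun i =>
    ((hv i).pd hO _).pd hO _ hz
  have a2 : ∀ i, dtt (fun y => w y i) z = dtt (fun y => w' y i) z := fun i =>
    ((hw i).pd hO _).pd hO _ hz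
  have a3 : ∀ i, slap (fun y => v y i) z = slap (fun y => v' y i) z := fun i =>
    Finset.sum_congr rfl fun j _ => ((hv i).pd hO _).pd hO _ hz
  have a4 : ∀ i j, pd (fun y => v y i) (ex j) z = pd (fun y => v' y i) (ex j) z :=
    fun i j => (hv i).pd hO _ hz
  have a5 : ∀ i, pd (sdiv v) (ex i) z = pd (sdiv v') (ex i) z := fun i =>
    (eqOn_sdiv hO hv).pd hO _ hz
  constructor
  · funext i
    simp only [row1, lameOp, a1, a2, a3, a4, a5, eqOn_sdiv hO hv hz,
      eqOn_pd_coef_sdiv c.q hO hw i hz]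
  · funext i
    simp only [row2, a1, a2, eqOn_pd_coef_sdiv c.q hO hv i hz, eqOn_pd_coef_sdiv c.r hO hw i hz]

theorem rows_zero (z : P4) :
    c.row1 (fun _ => 0) (fun _ => 0) z = 0 ∧ c.row2 (fun _ => 0) (fun _ => 0) z = 0 := by
  have h0 : ∀ d, pd (fun _ => (0 : ℝ)) d = fun _ => 0 := fun d => by
    funext z; simp [pd]
  have h1 : sdiv (fun _ => (0 : V3)) = fun _ => 0 := by
    funext z; simp [_root_.sdiv, h0]
  constructor <;> funext i <;>
    simp [row1, row2, lameOp, dtt, slap, h0, h1]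

theorem vanOff_rows (c : Coefs) (hZ : IsClosed Z) (ov : ∀ i, VanOff Z fun y => v y i)
    (ow : ∀ i, VanOff Z fun y => w y i) :
    (∀ i, VanOff Z fun y => c.row1 v w y i) ∧ ∀ i, VanOff Z fun y => c.row2 v w y i := by
  have h := eqOn_rows c (v' := fun _ => 0) (w' := fun _ => 0) hZ.isOpen_compl
    (fun i z hz => ov i z hz) fun i z hz => ow i z hz
  exact ⟨fun i z hz => by simp [(h z hz).1, rows_zero z],
    fun i z hz => by simp [(h z hz).2, rows_zero z]⟩

theorem Smooth.timeDeriv_rows (h : c.Smooth) (hv : ∀ i, ContDiff ℝ 3 fun y => v y i)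
    (hw : ∀ i, ContDiff ℝ 3 fun y => w y i) (i : Fin 3) :
    pd (fun z => c.row1 v w z i) et = (fun z => c.row1 (Dt v) (Dt w) z i) ∧
      pd (fun z => c.row2 v w z i) et = fun z => c.row2 (Dt v) (Dt w) z i := by
  have le32 : (2 : WithTop ℕ∞) ≤ 3 := by norm_num
  have hv2 := fun i => (hv i).of_le le32
  have hw2 := fun i => (hw i).of_le le32
  have tv : ∀ i, TimeDeriv (fun y => v y i) fun y => Dt v y i := fun i =>
    .of_differentiable ((hv2 i).differentiable two_ne_zero)
  have tq : ∀ {a : V3 → ℝ} {u : P4 → V3}, ContDiff ℝ 2 a → (∀ i, ContDiff ℝ 3 fun y => u y i) →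
      TimeDeriv (pd (fun y => a y.2 * sdiv u y) (ex i))
        (pd (fun y => a y.2 * sdiv (Dt u) y) (ex i)) := fun {a u} ha hu =>
    ((TimeDeriv.sdiv fun i => (hu i).of_le le32).coef_mul a).pd (contDiff_coef_sdiv ha hu) _
  have tl : TimeDeriv (fun z => lameOp c.μ c.lam v z i) fun z => lameOp c.μ c.lam (Dt v) z i :=
    ((((TimeDeriv.slap (hv i)).coef_mul c.μ).add
      (((TimeDeriv.sdiv hv2).pd (ContDiff.sdiv (n := 2) hv) (ex i)).coef_mul
        fun x => c.μ x + c.lam x)).add ((TimeDeriv.sdiv hv2).mul_coef (pdx c.lam i))).add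
      (TimeDeriv.sum fun j => (((tv i).pd (hv2 i) (ex j)).add ((tv j).pd (hv2 j) (ex i))).mul_coef
        (pdx c.μ j))
  constructor
  · exact TimeDeriv.pd_eq ((h.contDiff_row1 hv hw i).differentiable one_ne_zero)
      (((((TimeDeriv.dtt (hv i)).coef_mul c.ρ11).add ((TimeDeriv.dtt (hw i)).coef_mul c.ρ12)).sub
        tl).sub (tq h.sq hw))
  · exact TimeDeriv.pd_eq ((h.contDiff_row2 hv hw i).differentiable one_ne_zero)
      (((((TimeDeriv.dtt (hv i)).coef_mul c.ρ12).add ((TimeDeriv.dtt (hw i)).coef_mul c.ρ22)).sub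
        (tq h.sq hv)).sub (tq h.sr hw))

theorem Smooth.biot_Dt (h : c.Smooth) (hv : ∀ i, ContDiff ℝ 3 fun y => v y i)
    (hw : ∀ i, ContDiff ℝ 3 fun y => w y i) {F1 F2 : P4 → V3} (hO : IsOpen O)
    (hB : c.Biot v w F1 F2 O) : c.Biot (Dt v) (Dt w) (Dt F1) (Dt F2) O := fun z hz i => by
  have h1 : EqOn (fun z => c.row1 v w z i) (fun z => F1 z i) O := fun z hz => (hB z hz i).1
  have h2 : EqOn (fun z => c.row2 v w z i) (fun z => F2 z i) O := fun z hz => (hB z hz i).2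
  obtain ⟨e1, e2⟩ := h.timeDeriv_rows hv hw i
  exact ⟨(congrFun e1 z).symm.trans (h1.pd hO et hz), (congrFun e2 z).symm.trans (h2.pd hO et hz)⟩

theorem Smooth.rows_initial (h : c.Smooth) (hv : ∀ i, ContDiff ℝ 3 fun y => v y i)
    (hw : ∀ i, ContDiff ℝ 3 fun y => w y i) {Ω : Set V3} (hΩ : IsOpen Ω) {t : ℝ}
    (v0 : ∀ x ∈ Ω, v (t, x) = 0) (w0 : ∀ x ∈ Ω, w (t, x) = 0) (i : Fin 3) {x : V3} (hx : x ∈ Ω) :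
    c.row1 v w (t, x) i = c.ρ11 x * dtt (fun y => v y i) (t, x) +
        c.ρ12 x * dtt (fun y => w y i) (t, x) ∧
      c.row2 v w (t, x) i = c.ρ12 x * dtt (fun y => v y i) (t, x) +
        c.ρ22 x * dtt (fun y => w y i) (t, x) := by
  have a1 : ∀ {u : P4 → V3}, (∀ i, ContDiff ℝ 3 fun y => u y i) → (∀ x ∈ Ω, u (t, x) = 0) →
      ∀ i j, ∀ x ∈ Ω, pd (fun y => u y i) (ex j) (t, x) = 0 := fun hu u0 i j =>
    pd_ex_eq_zero_of_slice hΩ ((hu i).differentiable three_ne_zero)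
      (fun x hx => congrFun (u0 x hx) i) j
  have a2 : ∀ {u : P4 → V3}, (∀ i, ContDiff ℝ 3 fun y => u y i) → (∀ x ∈ Ω, u (t, x) = 0) →
      ∀ x ∈ Ω, sdiv u (t, x) = 0 := fun hu u0 x hx =>
    Finset.sum_eq_zero fun i _ => a1 hu u0 i i x hx
  have a3 : ∀ {u : P4 → V3} {a : V3 → ℝ}, ContDiff ℝ 2 a → (∀ i, ContDiff ℝ 3 fun y => u y i) →
      (∀ x ∈ Ω, u (t, x) = 0) → pd (fun y => a y.2 * sdiv u y) (ex i) (t, x) = 0 :=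
    fun {u a} ha hu u0 => pd_ex_eq_zero_of_slice hΩ
      ((contDiff_coef_sdiv ha hu).differentiable two_ne_zero)
      (fun x hx => by simp [a2 hu u0 x hx]) i x hx
  have a4 : pd (sdiv v) (ex i) (t, x) = 0 := pd_ex_eq_zero_of_slice hΩ
    ((ContDiff.sdiv (n := 2) hv).differentiable two_ne_zero) (a2 hv v0) i x hx
  have a5 : slap (fun y => v y i) (t, x) = 0 := Finset.sum_eq_zero fun j _ =>
    pd_ex_eq_zero_of_slice hΩ ((ContDiff.pd (n := 2) (hv i) _).differentiable two_ne_zero)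
      (a1 hv v0 i j) j x hx
  have a6 : lameOp c.μ c.lam v (t, x) i = 0 := by
    simp [lameOp, a5, a4, a2 hv v0 x hx, fun i j => a1 hv v0 i j x hx]
  simp [row1, row2, a6, a3 h.sq hv v0, a3 h.sq hw w0, a3 h.sr hw w0]

end Coefs

/-! ### Cut-off solutions -/

/-- The field `χ(t) u(t, x)` on `Ω`, extended by zero. -/
def cutExt (χ : ℝ → ℝ) (Ω : Set V3) (u : P4 → V3) : P4 → V3 :=
  (Prod.snd ⁻¹' Ω).indicator fun y => χ y.1 • u y

section CutExt

variable {χ : ℝ → ℝ} {Ω K : Set V3} {u : P4 → V3} {T T1 : ℝ}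

theorem cutExt_of_mem {z : P4} (hz : z.2 ∈ Ω) : cutExt χ Ω u z = χ z.1 • u z :=
  indicator_of_mem (s := Prod.snd ⁻¹' Ω) hz _

theorem cutExt_of_notMem {z : P4} (hz : z.2 ∉ Ω) : cutExt χ Ω u z = 0 :=
  indicator_of_notMem (s := Prod.snd ⁻¹' Ω) hz _

theorem cutExt_eq_zero (hχ : ∀ t, t ∉ Icc (-T1) T1 → χ t = 0) (hT : T1 < T)
    (hu : ∀ z ∈ Ioo (-T) T ×ˢ (Ω \ K), u z = 0) {z : P4} (hz : z ∉ Icc (-T1) T1 ×ˢ K) :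
    cutExt χ Ω u z = 0 := by
  by_cases hΩ : z.2 ∈ Ω
  · rw [cutExt_of_mem hΩ]
    by_cases ht : z.1 ∈ Icc (-T1) T1
    · have hK : z.2 ∉ K := fun h => hz ⟨ht, h⟩
      rw [hu z ⟨⟨by linarith [ht.1], by linarith [ht.2]⟩, hΩ, hK⟩, smul_zero]
    · rw [hχ _ ht, zero_smul]
  · exact cutExt_of_notMem hΩ

theorem vanOff_cutExt (hχ : ∀ t, t ∉ Icc (-T1) T1 → χ t = 0) (hT : T1 < T)
    (hu : ∀ z ∈ Ioo (-T) T ×ˢ (Ω \ K), u z = 0) (i : Fin 3) :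
    VanOff (Icc (-T1) T1 ×ˢ K) fun y => cutExt χ Ω u y i := fun z hz => by
  simp [cutExt_eq_zero hχ hT hu hz]

theorem contDiff_cutExt {n : ℕ∞} (hχn : ContDiff ℝ n χ) (hχ : ∀ t, t ∉ Icc (-T1) T1 → χ t = 0)
    (hT : T1 < T) (hΩ : IsOpen Ω) (hK : IsClosed K) (hKΩ : K ⊆ Ω)
    (hun : ∀ i, ContDiff ℝ n fun y => u y i)
    (hu : ∀ z ∈ Ioo (-T) T ×ˢ (Ω \ K), u z = 0) (i : Fin 3) :
    ContDiff ℝ n fun y => cutExt χ Ω u y i := by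
  refine contDiff_of_eq_zero_off (U := Prod.snd ⁻¹' Ω) (isClosed_Icc.prod hK)
    (fun z hz => hKΩ hz.2) (fun z hz => ?_) (vanOff_cutExt hχ hT hu i)
  have h1 : ContDiff ℝ n fun y : P4 => χ y.1 * u y i := by
    have := hun i
    fun_prop
  refine h1.contDiffAt.congr_of_eventuallyEq ?_
  filter_upwards [(hΩ.preimage continuous_snd).mem_nhds hz] with y hy
  rw [cutExt_of_mem (show y.2 ∈ Ω from hy)]
  rfl

theorem eqOn_cutExt {W : Set ℝ} (hW : ∀ t ∈ W, χ t = 1) (i : Fin 3) :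
    EqOn (fun y => cutExt χ Ω u y i) (fun y => u y i) (W ×ˢ Ω) := fun z hz => by
  simp [cutExt_of_mem hz.2, hW z.1 hz.1]

end CutExt

theorem exists_time_cutoff {T0 T1 : ℝ} (hT : T0 < T1) (n : ℕ∞) :
    ∃ χ : ℝ → ℝ, ContDiff ℝ n χ ∧ (∀ t, t ∉ Icc (-T1) T1 → χ t = 0) ∧
      ∃ W, IsOpen W ∧ Icc (-T0) T0 ⊆ W ∧ ∀ t ∈ W, χ t = 1 := by
  obtain ⟨χ, h1, K', W, -, hK', hW, hKW, hone, hzero⟩ := exists_cutoff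
    (isCompact_Icc (a := -T0) (b := T0)) (isOpen_Ioo (a := -T1) (b := T1))
    (Icc_subset_Ioo (by linarith) hT) n
  exact ⟨χ, h1, fun t ht => hzero t fun h => ht (Ioo_subset_Icc_self (hK' h)), W, hW, hKW, hone⟩

theorem contDiff_Dt {n : ℕ} {u : P4 → V3} (hu : ∀ i, ContDiff ℝ (n + 1 : ℕ) fun y => u y i)
    (i : Fin 3) : ContDiff ℝ n fun y => Dt u y i := ContDiff.pd (hu i) et

theorem Dt_eq_zero {O : Set P4} {u : P4 → V3} (hO : IsOpen O) (hu : ∀ z ∈ O, u z = 0) :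
    ∀ z ∈ O, Dt u z = 0 := fun z hz => by
  funext i
  have h : EqOn (fun y => u y i) (fun _ => 0) O := fun y hy => congrFun (hu y hy) i
  have := h.pd hO et hz
  rw [pd_const] at this
  exact this

theorem Dt_coef_mul {p : V3 → ℝ} {R : P4 → V3} (hp : Differentiable ℝ p)
    (hR : ∀ i, Differentiable ℝ fun y => R y i) :
    Dt (fun z i => p z.2 * R z i) = fun z i => p z.2 * Dt R z i := by
  funext z i
  exact congrFun (pd_et_coef_mul hp (hR i)) z

theorem source_le {O : Set P4} {F A : P4 → V3} {p : V3 → ℝ} {P C : ℝ} {z : P4} (hO : IsOpen O)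
    (hz : z ∈ O) (hp : Differentiable ℝ p) (hA : ∀ i, Differentiable ℝ fun y => A y i)
    (hF : ∀ i, EqOn (fun y => F y i) (fun y => p y.2 * A y i) O) (h0 : p z.2 ^ 2 ≤ P)
    (h1 : ∀ j, pdx p j z.2 ^ 2 ≤ P) (hC : n2 (A z) + vGradX2 A z ≤ C) :
    n2 (F z) + vGradX2 F z ≤ 7 * C * P := by
  have hP : 0 ≤ P := (sq_nonneg _).trans h0
  have a0 := n2_nonneg (A z)
  have a1 := vGradX2_nonneg A z
  have e0 : n2 (F z) = p z.2 ^ 2 * n2 (A z) := by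
    rw [n2, n2, Finset.mul_sum]
    refine Finset.sum_congr rfl fun i _ => ?_
    rw [show F z i = p z.2 * A z i from hF i hz]
    ring
  have e1 : ∀ i j, pd (fun y => F y i) (ex j) z ^ 2 ≤
      2 * P * (A z i ^ 2 + pd (fun y => A y i) (ex j) z ^ 2) := fun i j => by
    rw [(hF i).pd hO _ hz, pd_ex_coef_mul hp (hA i)]
    have b1 := mul_le_mul_of_nonneg_right h0 (sq_nonneg (pd (fun y => A y i) (ex j) z))
    have b2 := mul_le_mul_of_nonneg_right (h1 j) (sq_nonneg (A z i))
    nlinarith [sq_nonneg (pdx p j z.2 * A z i - p z.2 * pd (fun y => A y i) (ex j) z)]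
  have e2 : vGradX2 F z ≤ 2 * P * (3 * n2 (A z) + vGradX2 A z) := by
    have : 2 * P * (3 * n2 (A z) + vGradX2 A z) =
        ∑ i, ∑ j : Fin 3, 2 * P * (A z i ^ 2 + pd (fun y => A y i) (ex j) z ^ 2) := by
      simp only [n2, vGradX2, gradX2, Fin.sum_univ_three]
      ring
    rw [this]
    exact Finset.sum_le_sum fun i _ => Finset.sum_le_sum fun j _ => e1 i j
  have e3 := mul_le_mul_of_nonneg_right h0 a0
  rw [e0]
  nlinarith [mul_le_mul_of_nonneg_left hC hP, mul_nonneg hP a0, mul_nonneg hP a1]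

namespace Coefs

variable {c : Coefs} {Ω K : Set V3} {b1 b2 b3 : V3 → ℝ} {us uf R1 R2 : P4 → V3}

theorem Good.smooth {Z : Set P4} (h : c.Good Z b1 b2 b3) : c.Smooth :=
  ⟨h.sρ11, h.sρ12, h.sρ22, h.sμ, h.slam, h.sq, h.sr⟩

theorem contDiff_indicator {p : V3 → ℝ} (hΩ : IsOpen Ω) (hK : IsClosed K) (hKΩ : K ⊆ Ω)
    (hp : ContDiff ℝ 2 p) (h0 : ∀ x ∈ Ω \ K, p x = 0) :
    ContDiff ℝ 2 (Ω.indicator p) ∧ VanOff K (Ω.indicator p) := by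
  have h1 : VanOff K (Ω.indicator p) := fun x hx => by
    by_cases hxΩ : x ∈ Ω
    · rw [indicator_of_mem hxΩ, h0 x ⟨hxΩ, hx⟩]
    · exact indicator_of_notMem hxΩ _
  refine ⟨contDiff_of_eq_zero_off (n := 2) hK hKΩ (fun x hx => ?_) h1, h1⟩
  refine hp.contDiffAt.congr_of_eventuallyEq ?_
  filter_upwards [hΩ.mem_nhds hx] with y hy using indicator_of_mem hy _

theorem source_eq_zero_of_sum_ne {p : ℝ} {a y : Fin 3 → ℝ} (h : ∑ i, a i * y i ≠ 0)
    (h0 : ∀ i, p * a i = 0) : p = 0 := by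
  by_contra hp
  exact h (Finset.sum_eq_zero fun i _ => by
    rw [(mul_eq_zero.1 (h0 i)).resolve_left hp, zero_mul])

theorem Good.sources_eq_zero {x0 : V3} {p1 p2 : V3 → ℝ} {β T0 T1 T d D CR : ℝ}
    (h : c.Good (Icc (-T1) T1 ×ˢ K) b1 b2 b3)
    (hspeed : ∀ k, CarlemanSpeed x0 β (Icc (-T1) T1 ×ˢ K) (speed b1 b2 b3 k))
    (hΩ : IsOpen Ω) (hK : IsCompact K) (hKΩ : K ⊆ Ω) (hβ : 0 < β) (hT0 : 0 < T0) (hT01 : T0 < T1)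
    (hT1 : T1 < T) (hus : ∀ i, ContDiff ℝ 5 fun y => us y i)
    (huf : ∀ i, ContDiff ℝ 5 fun y => uf y i) (hR1 : ∀ i, ContDiff ℝ 4 fun y => R1 y i)
    (hR2 : ∀ i, ContDiff ℝ 4 fun y => R2 y i) (hp1 : ContDiff ℝ 2 p1) (hp2 : ContDiff ℝ 2 p2)
    (hB : c.Biot us uf (fun z i => p1 z.2 * R1 z i) (fun z i => p2 z.2 * R2 z i)
      (Ioo (-T) T ×ˢ Ω))
    (us0 : ∀ x ∈ Ω, us (0, x) = 0) (uf0 : ∀ x ∈ Ω, uf (0, x) = 0)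
    (usK : ∀ z ∈ Ioo (-T) T ×ˢ (Ω \ K), us z = 0) (ufK : ∀ z ∈ Ioo (-T) T ×ˢ (Ω \ K), uf z = 0)
    (ne1 : ∀ x ∈ Ω, ∑ i, R1 (0, x) i * (x i - x0 i) ≠ 0)
    (ne2 : ∀ x ∈ Ω, ∑ i, R2 (0, x) i * (x i - x0 i) ≠ 0) (hCR : 0 ≤ CR)
    (bR1 : ∀ z ∈ Ioo (-T) T ×ˢ Ω, n2 (Dt (Dt R1) z) + vGradX2 (Dt (Dt R1)) z ≤ CR)
    (bR2 : ∀ z ∈ Ioo (-T) T ×ˢ Ω, n2 (Dt (Dt R2) z) + vGradX2 (Dt (Dt R2)) z ≤ CR)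
    (hd : ∀ x ∈ K, d ^ 2 ≤ sqd x0 x) (hD : ∀ x ∈ K, sqd x0 x ≤ D ^ 2)
    (hκ : D ^ 2 - β * T0 ^ 2 < d ^ 2) : ∀ x ∈ Ω, p1 x = 0 ∧ p2 x = 0 := by
  have hO : IsOpen (Ioo (-T) T ×ˢ Ω) := isOpen_Ioo.prod hΩ
  have hOK : IsOpen (Ioo (-T) T ×ˢ (Ω \ K)) := isOpen_Ioo.prod (hΩ.sdiff hK.isClosed)
  have z0 : (0 : ℝ) ∈ Ioo (-T) T := ⟨by linarith, by linarith⟩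
  have hs := h.smooth
  have us3 := fun i => (hus i).of_le (show (3 : WithTop ℕ∞) ≤ 5 by norm_num)
  have uf3 := fun i => (huf i).of_le (show (3 : WithTop ℕ∞) ≤ 5 by norm_num)
  have us4 : ∀ i, ContDiff ℝ 4 fun y => Dt us y i := contDiff_Dt (n := 4) hus
  have uf4 : ∀ i, ContDiff ℝ 4 fun y => Dt uf y i := contDiff_Dt (n := 4) huf
  have vs3 : ∀ i, ContDiff ℝ 3 fun y => Dt (Dt us) y i := contDiff_Dt (n := 3) us4
  have vf3 : ∀ i, ContDiff ℝ 3 fun y => Dt (Dt uf) y i := contDiff_Dt (n := 3) uf4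
  have vsK := Dt_eq_zero hOK (Dt_eq_zero hOK usK)
  have vfK := Dt_eq_zero hOK (Dt_eq_zero hOK ufK)
  have rel : ∀ x ∈ Ω, ∀ i,
      p1 x * R1 (0, x) i = c.ρ11 x * Dt (Dt us) (0, x) i + c.ρ12 x * Dt (Dt uf) (0, x) i ∧
      p2 x * R2 (0, x) i = c.ρ12 x * Dt (Dt us) (0, x) i + c.ρ22 x * Dt (Dt uf) (0, x) i :=
    fun x hx i => by
      obtain ⟨e1, e2⟩ := hs.rows_initial us3 uf3 hΩ us0 uf0 i hx
      obtain ⟨f1, f2⟩ := hB (0, x) ⟨z0, hx⟩ i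
      exact ⟨f1.symm.trans e1, f2.symm.trans e2⟩
  have pK : ∀ x ∈ Ω \ K, p1 x = 0 ∧ p2 x = 0 := fun x hx => by
    have e := rel x hx.1
    simp only [vsK _ (mk_mem_prod z0 hx), vfK _ (mk_mem_prod z0 hx), Pi.zero_apply, mul_zero,
      add_zero] at e
    exact ⟨source_eq_zero_of_sum_ne (ne1 x hx.1) fun i => (e i).1,
      source_eq_zero_of_sum_ne (ne2 x hx.1) fun i => (e i).2⟩
  obtain ⟨hq1, oq1⟩ := contDiff_indicator hΩ hK.isClosed hKΩ hp1 fun x hx => (pK x hx).1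
  obtain ⟨hq2, oq2⟩ := contDiff_indicator hΩ hK.isClosed hKΩ hp2 fun x hx => (pK x hx).2
  obtain ⟨χ, hχ, χ0, W, hW, hTW, χ1⟩ := exists_time_cutoff hT01 3
  set v := cutExt χ Ω (Dt (Dt us)) with hv
  set w := cutExt χ Ω (Dt (Dt uf)) with hw
  have cv : ∀ i, ContDiff ℝ 3 fun y => v y i :=
    contDiff_cutExt (n := 3) hχ χ0 hT1 hΩ hK.isClosed hKΩ vs3 vsK
  have cw : ∀ i, ContDiff ℝ 3 fun y => w y i :=
    contDiff_cutExt (n := 3) hχ χ0 hT1 hΩ hK.isClosed hKΩ vf3 vfK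
  have ov := vanOff_cutExt χ0 hT1 vsK
  have ow := vanOff_cutExt χ0 hT1 vfK
  have hZ : IsClosed (Icc (-T1) T1 ×ˢ K) := isClosed_Icc.prod hK.isClosed
  obtain ⟨o1, o2⟩ := vanOff_rows c hZ ov ow
  have hR1' := fun i => (hR1 i).differentiable four_ne_zero
  have hR2' := fun i => (hR2 i).differentiable four_ne_zero
  have cR1 : ∀ i, ContDiff ℝ 3 fun y => Dt R1 y i := contDiff_Dt (n := 3) hR1
  have cR2 : ∀ i, ContDiff ℝ 3 fun y => Dt R2 y i := contDiff_Dt (n := 3) hR2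
  have dR1 : ∀ i, Differentiable ℝ fun y => Dt (Dt R1) y i := fun i =>
    (contDiff_Dt (n := 2) cR1 i).differentiable two_ne_zero
  have dR2 : ∀ i, Differentiable ℝ fun y => Dt (Dt R2) y i := fun i =>
    (contDiff_Dt (n := 2) cR2 i).differentiable two_ne_zero
  have hB2 : c.Biot (Dt (Dt us)) (Dt (Dt uf)) (fun z i => p1 z.2 * Dt (Dt R1) z i)
      (fun z i => p2 z.2 * Dt (Dt R2) z i) (Ioo (-T) T ×ˢ Ω) := by
    have := hs.biot_Dt (fun i => (us4 i).of_le (by norm_num)) (fun i => (uf4 i).of_le (by norm_num))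
      hO (hs.biot_Dt us3 uf3 hO hB)
    rwa [Dt_coef_mul (hp1.differentiable two_ne_zero) hR1',
      Dt_coef_mul (hp2.differentiable two_ne_zero) hR2',
      Dt_coef_mul (hp1.differentiable two_ne_zero) fun i => (cR1 i).differentiable three_ne_zero,
      Dt_coef_mul (hp2.differentiable two_ne_zero) fun i =>
        (cR2 i).differentiable three_ne_zero] at this
  set O' : Set P4 := (W ∩ Ioo (-T) T) ×ˢ Ω with hO'
  have oO' : IsOpen O' := (hW.inter isOpen_Ioo).prod hΩ
  have rows := eqOn_rows c (v := v) (w := w) (v' := Dt (Dt us)) (w' := Dt (Dt uf)) oO'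
    (eqOn_cutExt fun t ht => χ1 t ht.1) (eqOn_cutExt fun t ht => χ1 t ht.1)
  have F1 : ∀ i, EqOn (fun y => c.row1 v w y i)
      (fun y => Ω.indicator p1 y.2 * Dt (Dt R1) y i) O' := fun i z hz => by
    simp only [(rows z hz).1, indicator_of_mem hz.2]
    exact (hB2 z ⟨hz.1.2, hz.2⟩ i).1
  have F2 : ∀ i, EqOn (fun y => c.row2 v w y i)
      (fun y => Ω.indicator p2 y.2 * Dt (Dt R2) y i) O' := fun i z hz => by
    simp only [(rows z hz).2, indicator_of_mem hz.2]
    exact (hB2 z ⟨hz.1.2, hz.2⟩ i).2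
  have hsrc : ∀ z, |z.1| ≤ T0 → src (c.row1 v w) (c.row2 v w) z ≤
      14 * CR * jetSq (Ω.indicator p1) (Ω.indicator p2) z.2 := fun z hz => by
    by_cases hzΩ : z.2 ∈ Ω
    · rw [abs_le] at hz
      have hzO : z ∈ O' := ⟨⟨hTW hz, by linarith [hz.1], by linarith [hz.2]⟩, hzΩ⟩
      have j := sq_jet1_le (Ω.indicator p1) (Ω.indicator p2) z.2
      have j1 := fun o => (le_add_of_nonneg_right (sq_nonneg _)).trans (j o)
      have j2 := fun o => (le_add_of_nonneg_left (sq_nonneg _)).trans (j o)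
      have s1 := source_le oO' hzO (hq1.differentiable two_ne_zero) dR1 F1 (j1 none)
        (fun k => j1 (some k)) (bR1 z ⟨hzO.1.2, hzΩ⟩)
      have s2 := source_le oO' hzO (hq2.differentiable two_ne_zero) dR2 F2 (j2 none)
        (fun k => j2 (some k)) (bR2 z ⟨hzO.1.2, hzΩ⟩)
      unfold src
      linarith
    · rw [VanOff.src hZ o1 o2 z fun hzZ => hzΩ (hKΩ hzZ.2)]
      exact mul_nonneg (by positivity) (jetSq_nonneg _ _ _)
  have χz : χ 0 = 1 := χ1 0 (hTW ⟨by linarith, hT0.le⟩)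
  have slice : ∀ {R : P4 → V3}, (∀ i, ContDiff ℝ 4 fun y => R y i) →
      ∀ i, ContDiff ℝ 2 fun x => R (0, x) i := fun hR i =>
    contDiff_slice ((hR i).of_le (by norm_num)) 0
  have fin := h.sources_vanish hK hβ hT0.le (hT0.trans hT01).le hspeed cv cw ov ow
    (hs.contDiff_row1 cv cw) (hs.contDiff_row2 cv cw) o1 o2 (biot_rows _) hq1 hq2 oq1 oq2
    (slice hR1) (slice hR2) (fun x hx => ne1 x (hKΩ hx)) (fun x hx => ne2 x (hKΩ hx))
    (fun i x => by
      by_cases hx : x ∈ Ω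
      · simpa [hv, hw, cutExt_of_mem (z := ((0 : ℝ), x)) hx, χz, hx] using (rel x hx i).1
      · simp [hv, hw, cutExt_of_notMem (z := ((0 : ℝ), x)) hx, hx])
    (fun i x => by
      by_cases hx : x ∈ Ω
      · simpa [hv, hw, cutExt_of_mem (z := ((0 : ℝ), x)) hx, χz, hx] using (rel x hx i).2
      · simp [hv, hw, cutExt_of_notMem (z := ((0 : ℝ), x)) hx, hx])
    (by positivity) hsrc hd hD hκ
  intro x hx
  have := fin x
  rwa [indicator_of_mem hx, indicator_of_mem hx] at this

end Coefs

/-! ### Vanishing of the displacements in the absence of sources -/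

theorem TimeDeriv.eq_zero {f g : P4 → ℝ} {s : ℝ} {x : V3} (h : TimeDeriv f g)
    (hg : ∀ t ∈ Ioo (-s) s, g (t, x) = 0) (h0 : f (0, x) = 0) :
    ∀ t ∈ Ioo (-s) s, f (t, x) = 0 := fun t ht => by
  have hs : (0 : ℝ) ∈ Ioo (-s) s := by
    have := ht.1.trans ht.2
    exact ⟨by linarith, by linarith⟩
  have := isOpen_Ioo.is_const_of_deriv_eq_zero (f := fun t => f (t, x)) isPreconnected_Ioo
    (fun t _ => (h t x).differentiableAt.differentiableWithinAt)
    (fun t ht => (h t x).deriv.trans (hg t ht)) ht hs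
  exact this.trans h0

/-- The Cauchy data of `f` vanish at `t = 0`. -/
def ZeroData (f : P4 → ℝ) : Prop := ∀ x, f (0, x) = 0 ∧ pd f et (0, x) = 0

namespace ZeroData

variable {f g : P4 → ℝ}

theorem pd_ex (hf : ContDiff ℝ 2 f) (h : ZeroData f) (i : Fin 3) : ZeroData (pd f (ex i)) :=
  fun x => ⟨pd_ex_eq_zero_of_slice isOpen_univ (hf.differentiable two_ne_zero)
    (fun x _ => (h x).1) i x (mem_univ x), by
    rw [pd_comm hf]
    exact pd_ex_eq_zero_of_slice isOpen_univ
      ((ContDiff.pd (n := 1) hf et).differentiable one_ne_zero) (fun x _ => (h x).2) i x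
      (mem_univ x)⟩

theorem sdiv {v : P4 → V3} (hv : ∀ i, ContDiff ℝ 2 fun y => v y i)
    (h : ∀ i, ZeroData fun y => v y i) : ZeroData (sdiv v) := fun x => by
  have hd : ∀ i, Differentiable ℝ (pd (fun y => v y i) (ex i)) := fun i =>
    (ContDiff.pd (n := 1) (hv i) _).differentiable one_ne_zero
  have h1 := fun i => (h i).pd_ex (hv i) i x
  unfold _root_.sdiv
  rw [pd_sum _ hd]
  exact ⟨Finset.sum_eq_zero fun i _ => (h1 i).1, Finset.sum_eq_zero fun i _ => (h1 i).2⟩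

theorem rot {v : P4 → V3} (hv : ∀ i, ContDiff ℝ 2 fun y => v y i)
    (h : ∀ i, ZeroData fun y => v y i) (k i : Fin 3) : ZeroData (Coefs.rot v k i) := fun x => by
  have hd : ∀ i j, Differentiable ℝ (pd (fun y => v y i) (ex j)) := fun i j =>
    (ContDiff.pd (n := 1) (hv i) _).differentiable one_ne_zero
  have h1 := fun i j => (h i).pd_ex (hv i) j x
  unfold Coefs.rot
  rw [pd_sub (hd _ _) (hd _ _)]
  simp [h1]

theorem comb {P Q : V3 → ℝ} {v w : P4 → V3} (hP : ContDiff ℝ 2 P) (hQ : ContDiff ℝ 2 Q)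
    (hv : ∀ i, ContDiff ℝ 3 fun y => v y i) (hw : ∀ i, ContDiff ℝ 3 fun y => w y i)
    (h : ZeroData (_root_.sdiv v)) (h' : ZeroData (_root_.sdiv w)) :
    ZeroData (comb P Q v w) := fun x => by
  have d : ∀ {v : P4 → V3}, (∀ i, ContDiff ℝ 3 fun y => v y i) →
      Differentiable ℝ (_root_.sdiv v) := fun hv =>
    (ContDiff.sdiv (n := 2) hv).differentiable two_ne_zero
  have e : pd (_root_.comb P Q v w) et = _ :=
    (((TimeDeriv.of_differentiable (d hv)).coef_mul P).add
      ((TimeDeriv.of_differentiable (d hw)).coef_mul Q)).pd_eq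
      ((ContDiff.comb hP hQ hv hw).differentiable two_ne_zero)
  rw [e]
  simp [_root_.comb, h x, h' x]

end ZeroData

namespace Coefs

variable {c : Coefs} {Ω K : Set V3} {Z O : Set P4} {b1 b2 b3 : V3 → ℝ} {v w us uf : P4 → V3}

theorem Good.zeroData_fam (h : c.Good Z b1 b2 b3) (hv : ∀ i, ContDiff ℝ 3 fun y => v y i)
    (hw : ∀ i, ContDiff ℝ 3 fun y => w y i) (v0 : ∀ i, ZeroData fun y => v y i)
    (w0 : ∀ i, ZeroData fun y => w y i) (k) : ZeroData (c.fam v w k) := by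
  have le32 : (2 : WithTop ℕ∞) ≤ 3 := by norm_num
  have sv := ZeroData.sdiv (fun i => (hv i).of_le le32) v0
  have sw := ZeroData.sdiv (fun i => (hw i).of_le le32) w0
  have sϱ := h.sϱ
  have s2 := h.sμ2
  have s3 := h.sμ3
  have s11 := h.sM11
  have s22 := h.sM22
  rcases k with (i | p) | k
  · exact v0 i
  · exact ZeroData.rot (fun i => (hv i).of_le le32) v0 _ _
  · exact divFam_cases (p := fun _ f => ZeroData f)
      (.comb (by fun_prop) h.sM12 hv hw sv sw) (.comb h.sM21 (by fun_prop) hv hw sv sw)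
      (.comb (by fun_prop) h.sM12 hv hw sv sw) (.comb h.sM21 (by fun_prop) hv hw sv sw) k

theorem src_eq_zero {F1 F2 : P4 → V3} (hO : IsOpen O) (h : ∀ z ∈ O, F1 z = 0 ∧ F2 z = 0) :
    ∀ z ∈ O, src F1 F2 z = 0 := fun z hz => by
  have e1 : ∀ i j, pd (fun y => F1 y i) (ex j) z = 0 := fun i j => by
    rw [EqOn.pd (g := fun _ => 0) (fun y hy => congrFun (h y hy).1 i) hO _ hz, pd_const]
  have e2 : ∀ i j, pd (fun y => F2 y i) (ex j) z = 0 := fun i j => by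
    rw [EqOn.pd (g := fun _ => 0) (fun y hy => congrFun (h y hy).2 i) hO _ hz, pd_const]
  simp [src, n2, vGradX2, gradX2, e1, e2, h z hz]

theorem Good.fam_eq_zero (h : c.Good Z b1 b2 b3) (hZ : IsCompact Z) {bmin s : ℝ}
    (hbm : 0 < bmin) (hb : ∀ k, ContDiff ℝ 2 (speed b1 b2 b3 k))
    (hbZ : ∀ k, ∀ z ∈ Z, bmin ≤ speed b1 b2 b3 k z.2)
    (hv : ∀ i, ContDiff ℝ 3 fun y => v y i) (hw : ∀ i, ContDiff ℝ 3 fun y => w y i)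
    (ov : ∀ i, VanOff Z fun y => v y i) (ow : ∀ i, VanOff Z fun y => w y i)
    (v0 : ∀ i, ZeroData fun y => v y i) (w0 : ∀ i, ZeroData fun y => w y i)
    (hO : IsOpen O) (hsO : ∀ z : P4, |z.1| ≤ s → z ∈ O)
    (hr : ∀ z ∈ O, c.row1 v w z = 0 ∧ c.row2 v w z = 0) :
    ∀ k z, |z.1| ≤ s → c.fam v w k z = 0 := by
  obtain ⟨C, hC, hw'⟩ := h.reduction hZ hv hw ov ow (h.smooth.contDiff_row1 hv hw)
    (h.smooth.contDiff_row2 hv hw) (biot_rows univ)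
  refine wave_system_unique hZ (fun k => (hb k).of_le one_le_two) hbm hbZ (h.contDiff_fam hv hw)
    (vanOff_fam hZ.isClosed ov ow) hC (fun k z hz => ?_)
    (fun k x => (h.zeroData_fam hv hw v0 w0 k x).1) fun k x => (h.zeroData_fam hv hw v0 w0 k x).2
  have := hw' k z
  rwa [src_eq_zero hO hr z (hsO z hz), add_zero] at this

theorem Good.cut_eq_zero {T1 s s' bmin : ℝ} (h : ∀ I : Set ℝ, c.Good (I ×ˢ K) b1 b2 b3)
    (hK : IsCompact K) (hs : s < s') (hbm : 0 < bmin) (hb : ∀ k, ContDiff ℝ 2 (speed b1 b2 b3 k))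
    (hbK : ∀ k, ∀ x ∈ K, bmin ≤ speed b1 b2 b3 k x)
    (hv : ∀ i, ContDiff ℝ 3 fun y => v y i) (hw : ∀ i, ContDiff ℝ 3 fun y => w y i)
    (ov : ∀ i, VanOff (Icc (-T1) T1 ×ˢ K) fun y => v y i)
    (ow : ∀ i, VanOff (Icc (-T1) T1 ×ˢ K) fun y => w y i)
    (v0 : ∀ i, ZeroData fun y => v y i) (w0 : ∀ i, ZeroData fun y => w y i)
    (hO : IsOpen O) (hsO : ∀ z : P4, |z.1| ≤ s' → z ∈ O)
    (hr : ∀ z ∈ O, c.row1 v w z = 0 ∧ c.row2 v w z = 0) :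
    ∀ z : P4, z.1 ∈ Ioo (-s) s → v z = 0 ∧ w z = 0 := by
  have hZ : IsCompact (Icc (-T1) T1 ×ˢ K) := isCompact_Icc.prod hK
  have fam0 := (h _).fam_eq_zero hZ hbm hb (fun k z hz => hbK k _ hz.2) hv hw ov ow v0 w0 hO hsO hr
  have oS : IsOpen {z : P4 | |z.1| < s'} := isOpen_lt continuous_fst.abs continuous_const
  have oI : IsOpen (Prod.fst ⁻¹' Ioo (-s) s : Set P4) := isOpen_Ioo.preimage continuous_fst
  have hIs : ∀ {t : ℝ}, t ∈ Icc (-s) s → |t| < s' := fun ht => (abs_le.2 ht).trans_lt hs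
  have fam1 : ∀ k d (z : P4), z.1 ∈ Icc (-s) s → pd (c.fam v w k) d z = 0 := fun k d z hz => by
    rw [EqOn.pd (g := fun _ => 0) (fun y hy => fam0 k y (le_of_lt hy)) oS d (hIs hz), pd_const]
  have lo : ∀ {X : P4 → ℝ}, (∀ z : P4, z.1 ∈ Icc (-s) s → X z = 0) →
      LO (Icc (-s) s ×ˢ K) (fun _ => 0) X := fun hX => ⟨0, fun z hz => by simp [hX z hz.1]⟩
  obtain ⟨⟨⟨_, lv⟩, -⟩, ⟨_, lw⟩, -⟩ := (h (Icc (-s) s)).div_LO (isCompact_Icc.prod hK) hv hw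
    (fun k => lo fun z hz => fam0 (Sum.inr k) z (hIs hz).le) fun k j => lo (fam1 (Sum.inr k) (ex j))
  have div0 : ∀ {u : P4 → V3} {C : ℝ}, (∀ i, VanOff (Icc (-T1) T1 ×ˢ K) fun y => u y i) →
      (∀ z ∈ Icc (-s) s ×ˢ K, |sdiv u z| ≤ C * 0) →
      EqOn (sdiv u) (fun _ => 0) (Prod.fst ⁻¹' Ioo (-s) s) := fun ou hu z hz => by
    by_cases hzK : z.2 ∈ K
    · have := hu z ⟨Ioo_subset_Icc_self hz, hzK⟩
      rwa [mul_zero, abs_nonpos_iff] at this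
    · exact vanOff_sdiv hZ.isClosed ou z fun hz' => hzK hz'.2
  have dv := div0 ov lv
  have dw := div0 ow lw
  have ve : ∀ i, EqOn (fun y => v y i) (fun _ => 0) (Prod.fst ⁻¹' Ioo (-s) s) := fun i z hz =>
    fam0 (Sum.inl (Sum.inl i)) z (hIs (Ioo_subset_Icc_self hz)).le
  have coef0 : ∀ {a : V3 → ℝ} {u : P4 → V3},
      EqOn (sdiv u) (fun _ => 0) (Prod.fst ⁻¹' Ioo (-s) s) → ∀ i, ∀ z ∈ Prod.fst ⁻¹' Ioo (-s) s,
        pd (fun y => a y.2 * sdiv u y) (ex i) z = 0 := fun {a u} hu i z hz => by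
    rw [EqOn.pd (g := fun _ => 0) (fun y hy => by simp [hu hy]) oI _ hz, pd_const]
  have w2 : ∀ i, ∀ z : P4, z.1 ∈ Ioo (-s) s → z.2 ∈ K → dtt (fun y => w y i) z = 0 :=
    fun i z hz hzK => by
      have h1 := congrFun (hr z (hsO z (hIs (Ioo_subset_Icc_self hz)).le)).2 i
      have h2 : dtt (fun y => v y i) z = 0 := by
        have := ((ve i).pd oI et).pd oI et hz
        rwa [pd_const, pd_const] at this
      simp only [row2, h2, coef0 dv i z hz, coef0 dw i z hz, mul_zero, zero_add, sub_zero,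
        Pi.zero_apply] at h1
      exact (mul_eq_zero.1 h1).resolve_left
        (left_ne_zero_of_mul ((h univ).ρμ0 z ⟨mem_univ _, hzK⟩))
  intro z hz
  refine ⟨funext fun i => ve i hz, funext fun i => ?_⟩
  by_cases hzK : z.2 ∈ K
  · have dw1 : Differentiable ℝ (pd (fun y => w y i) et) :=
      (ContDiff.pd (n := 2) (hw i) et).differentiable two_ne_zero
    have w1 := (TimeDeriv.of_differentiable dw1).eq_zero
      (fun t ht => w2 i (t, z.2) ht hzK) (w0 i z.2).2
    exact (TimeDeriv.of_differentiable ((hw i).differentiable three_ne_zero)).eq_zero w1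
      (w0 i z.2).1 z.1 hz
  · exact ow i z fun hz' => hzK hz'.2

theorem zeroData_cutExt {χ : ℝ → ℝ} {W : Set ℝ} {u : P4 → V3} {T1 : ℝ} (hΩ : IsOpen Ω)
    (hK : IsClosed K) (hKΩ : K ⊆ Ω) (hW : IsOpen W) (h0W : (0 : ℝ) ∈ W) (χ1 : ∀ t ∈ W, χ t = 1)
    (u0 : ∀ x ∈ Ω, u (0, x) = 0) (ut0 : ∀ x ∈ Ω, Dt u (0, x) = 0)
    (ou : ∀ i, VanOff (Icc (-T1) T1 ×ˢ K) fun y => cutExt χ Ω u y i) (i : Fin 3) :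
    ZeroData fun y => cutExt χ Ω u y i := fun x => by
  have hZ : IsClosed (Icc (-T1) T1 ×ˢ K) := isClosed_Icc.prod hK
  by_cases hx : x ∈ Ω
  · have h1 := eqOn_cutExt (Ω := Ω) (u := u) χ1 i
    have hz : ((0 : ℝ), x) ∈ W ×ˢ Ω := ⟨h0W, hx⟩
    exact ⟨(h1 hz).trans (congrFun (u0 x hx) i),
      (h1.pd (hW.prod hΩ) et hz).trans (congrFun (ut0 x hx) i)⟩
  · have hz : ((0 : ℝ), x) ∉ Icc (-T1) T1 ×ˢ K := fun h => hx (hKΩ h.2)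
    exact ⟨ou i _ hz, (ou i).pd hZ et _ hz⟩

theorem Good.fields_eq_zero {T bmin : ℝ} (h : ∀ I : Set ℝ, c.Good (I ×ˢ K) b1 b2 b3)
    (hΩ : IsOpen Ω) (hK : IsCompact K) (hKΩ : K ⊆ Ω)
    (hbm : 0 < bmin) (hb : ∀ k, ContDiff ℝ 2 (speed b1 b2 b3 k))
    (hbK : ∀ k, ∀ x ∈ K, bmin ≤ speed b1 b2 b3 k x)
    (hus : ∀ i, ContDiff ℝ 3 fun y => us y i) (huf : ∀ i, ContDiff ℝ 3 fun y => uf y i)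
    (hB : ∀ z ∈ Ioo (-T) T ×ˢ Ω, c.row1 us uf z = 0 ∧ c.row2 us uf z = 0)
    (us0 : ∀ x ∈ Ω, us (0, x) = 0) (uf0 : ∀ x ∈ Ω, uf (0, x) = 0)
    (ust0 : ∀ x ∈ Ω, Dt us (0, x) = 0) (uft0 : ∀ x ∈ Ω, Dt uf (0, x) = 0)
    (usK : ∀ z ∈ Ioo (-T) T ×ˢ (Ω \ K), us z = 0) (ufK : ∀ z ∈ Ioo (-T) T ×ˢ (Ω \ K), uf z = 0) :
    ∀ z ∈ Ioo (-T) T ×ˢ Ω, us z = 0 ∧ uf z = 0 := fun z hz => by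
  obtain ⟨s, hzs, hsT⟩ := exists_between (abs_lt.2 hz.1)
  obtain ⟨s', hss', hsT'⟩ := exists_between hsT
  obtain ⟨T1, hT1, hT1T⟩ := exists_between hsT'
  have hs'0 : 0 < s' := ((abs_nonneg _).trans_lt hzs).trans hss'
  obtain ⟨χ, hχ, χ0, W, hW, hTW, χ1⟩ := exists_time_cutoff hT1 3
  have cv := contDiff_cutExt (n := 3) hχ χ0 hT1T hΩ hK.isClosed hKΩ hus usK
  have cw := contDiff_cutExt (n := 3) hχ χ0 hT1T hΩ hK.isClosed hKΩ huf ufK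
  have ov := vanOff_cutExt χ0 hT1T usK
  have ow := vanOff_cutExt χ0 hT1T ufK
  have h0W : (0 : ℝ) ∈ W := hTW ⟨by linarith, hs'0.le⟩
  have oW : IsOpen (W ∩ Ioo (-T) T) := hW.inter isOpen_Ioo
  obtain ⟨o1, o2⟩ := vanOff_rows c (isClosed_Icc.prod hK.isClosed) ov ow
  have rows := eqOn_rows c (oW.prod hΩ) (eqOn_cutExt (u := us) fun t ht => χ1 t ht.1)
    (eqOn_cutExt (u := uf) fun t ht => χ1 t ht.1)
  have hzI : z.1 ∈ Ioo (-s) s := abs_lt.1 hzs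
  have hzW : z ∈ W ×ˢ Ω := ⟨hTW ⟨by linarith [hzI.1], by linarith [hzI.2]⟩, hz.2⟩
  obtain ⟨e1, e2⟩ := Good.cut_eq_zero h hK hss' hbm hb hbK cv cw ov ow
    (zeroData_cutExt hΩ hK.isClosed hKΩ hW h0W χ1 us0 ust0 ov)
    (zeroData_cutExt hΩ hK.isClosed hKΩ hW h0W χ1 uf0 uft0 ow)
    (oW.preimage continuous_fst)
    (fun y hy => ⟨hTW (abs_le.1 hy), abs_lt.1 (hy.trans_lt hsT')⟩)
    (fun y hy => by
      by_cases hyΩ : y.2 ∈ Ω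
      · rw [(rows y ⟨hy, hyΩ⟩).1, (rows y ⟨hy, hyΩ⟩).2]
        exact hB y ⟨hy.2, hyΩ⟩
      · have hyZ : y ∉ Icc (-T1) T1 ×ˢ K := fun h => hyΩ (hKΩ h.2)
        exact ⟨funext fun i => o1 i y hyZ, funext fun i => o2 i y hyZ⟩) z hzI
  exact ⟨funext fun i => (eqOn_cutExt χ1 i hzW).symm.trans (congrFun e1 i),
    funext fun i => (eqOn_cutExt χ1 i hzW).symm.trans (congrFun e2 i)⟩

end Coefs

/-! ### The uniqueness theorem -/

theorem CClass.inv_le {Ω : Set V3} {x0 : V3} {m θ cs : ℝ} {g b : V3 → ℝ}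
    (h : CClass Ω x0 m θ cs g) {x : V3} (hx : x ∈ closure Ω) (hb : b x * g x = 1) :
    1 / m ≤ b x := by
  have h1 : 0 < g x := h.2.1.trans (h.2.2.1 x hx)
  rw [eq_one_div_of_mul_eq_one_left hb]
  exact one_div_le_one_div_of_le h1 ((le_abs_self _).trans (h.2.2.2.1 x hx).1)

/-- uniqueness in the inverse source problem: if the solution of Biot's
system with sources p_ℓR_ℓ and zero initial data vanishes on ω×(-T,T), then p₁ = p₂ = 0
on Ω and u = 0 in Q. -/
theorem biot_inverse_uniqueness (Ω ω : Set V3) (x0 : V3) (ν : V3 → V3)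
    (ρ11 ρ12 ρ22 μ lam q r μ2 μ3 : V3 → ℝ) (R1 R2 : P4 → V3)
    (m θ c1 c2 c3 c0 d D β γ T M0 CR M : ℝ)
    (hΩopen : IsOpen Ω) (hΩbd : Bornology.IsBounded Ω) (hΩne : Ω.Nonempty)
    (hx0 : x0 ∉ closure Ω) (hm : 0 < m) (hθ : θ ∈ Set.Ioo (0 : ℝ) 1)
    (hγ : 0 < γ)
    (hω : ∃ V : Set V3, IsOpen V ∧ frontier Ω ⊆ V ∧ ω = Ω ∩ V)
    (hA1 : AssumpA1 Ω ρ11 ρ12 ρ22 μ lam q r)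
    (hA2 : AssumpA2 Ω x0 ρ11 ρ12 ρ22 μ lam q r μ2 μ3 m θ c1 c2 c3)
    (hgeom : dGeom Ω x0 d D) (hc0 : 0 < c0)
    (hc0min : c0 ≤ c1 ∧ c0 ≤ c2 ∧ c0 ≤ c3)
    (hβ : BetaCond m θ c0 d D β)
    (hT : Real.sqrt (D ^ 2 - d ^ 2) / Real.sqrt β < T)
    (hν : ∀ x ∈ frontier Ω, n2 (ν x) = 1)
    (hRreg : ContDiff ℝ 4 (fun z : P4 => R1 z) ∧ ContDiff ℝ 4 (fun z : P4 => R2 z))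
    (hCR : 0 < CR)
    (hRbd : ∀ z ∈ Set.Ioo (-T) T ×ˢ Ω,
      n2 (Dt (Dt R1) z) + vGradX2 (Dt (Dt R1)) z
        + n2 (Dt (Dt (Dt R1)) z) + vGradX2 (Dt (Dt (Dt R1))) z
        + n2 (Dt (Dt R2) z) + vGradX2 (Dt (Dt R2)) z
        + n2 (Dt (Dt (Dt R2)) z) + vGradX2 (Dt (Dt (Dt R2))) z ≤ CR)
    (hΦ1 : ∀ x ∈ closure Ω, (∑ i, R1 ((0 : ℝ), x) i * (x i - x0 i)) ≠ 0)
    (hΦ2 : ∀ x ∈ closure Ω, (∑ i, R2 ((0 : ℝ), x) i * (x i - x0 i)) ≠ 0)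
    (hM0 : 0 < M0)
    (hM : 0 < M) :
      ∀ p1 p2 : V3 → ℝ, ∀ us uf : P4 → V3,
        ContDiff ℝ 2 p1 → ContDiff ℝ 2 p2 →
        (∫ x in Ω, ((p1 x) ^ 2 + ‖fderiv ℝ p1 x‖ ^ 2 + ‖iteratedFDeriv ℝ 2 p1 x‖ ^ 2)
          ≤ M ^ 2) →
        (∫ x in Ω, ((p2 x) ^ 2 + ‖fderiv ℝ p2 x‖ ^ 2 + ‖iteratedFDeriv ℝ 2 p2 x‖ ^ 2)
          ≤ M ^ 2) →
        (∀ x ∈ frontier Ω, p1 x = 0 ∧ ∀ i, pdx p1 i x = 0) →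
        (∀ x ∈ frontier Ω, p2 x = 0 ∧ ∀ i, pdx p2 i x = 0) →
        ContDiff ℝ 5 (fun z : P4 => us z) → ContDiff ℝ 5 (fun z : P4 => uf z) →
        (∫ z in Set.Ioo (-T) T ×ˢ Ω, ∑ k ∈ Finset.range 6,
            (‖iteratedFDeriv ℝ k us z‖ ^ 2 + ‖iteratedFDeriv ℝ k uf z‖ ^ 2) ≤ M0 ^ 2) →
        BiotSystem ρ11 ρ12 ρ22 μ lam q r us uf
          (fun z i => p1 z.2 * R1 z i) (fun z i => p2 z.2 * R2 z i)
          (Set.Ioo (-T) T ×ˢ Ω) →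
        (∀ t ∈ Set.Icc (-T) T, ∀ x ∈ frontier Ω,
          us (t, x) = 0 ∧ (∑ i, uf (t, x) i * ν x i) = 0) →
        (∀ x ∈ Ω, us ((0 : ℝ), x) = 0 ∧ uf ((0 : ℝ), x) = 0 ∧
          Dt us ((0 : ℝ), x) = 0 ∧ Dt uf ((0 : ℝ), x) = 0) →
        (∀ z ∈ Set.Ioo (-T) T ×ˢ ω, us z = 0 ∧ uf z = 0) →
        (∀ x ∈ Ω, p1 x = 0 ∧ p2 x = 0) ∧
          (∀ z ∈ Set.Ioo (-T) T ×ˢ Ω, us z = 0 ∧ uf z = 0) := by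
  intro p1 p2 us uf hp1 hp2 _ _ _ _ hus huf _ hB _ h0 hωu
  obtain ⟨V, hV, hFV, rfl⟩ := hω
  have hd := hgeom.pos hx0
  set K := closure Ω \ V with hKdef
  have hK : IsCompact K := hΩbd.isCompact_closure.diff hV
  have hKc : K ⊆ closure Ω := sdiff_subset
  have hKΩ : K ⊆ Ω := fun x hx => by
    have := hx.1
    rw [closure_eq_interior_union_frontier, hΩopen.interior_eq] at this
    exact this.resolve_right fun h => hx.2 (hFV h)
  have hΩK : ∀ {x}, x ∈ Ω \ K → x ∈ Ω ∩ V := fun {x} hx =>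
    ⟨hx.1, by_contra fun h => hx.2 ⟨subset_closure hx.1, h⟩⟩
  obtain ⟨b1, b2, b3, V', hV', hKV', ⟨s1, s2, s3⟩, hbg, hgood⟩ :=
    Coefs.exists_good hA1 hA2 hK hKc
  have sd : ∀ x ∈ closure Ω, d ^ 2 ≤ sqd x0 x ∧ sqd x0 x ≤ D ^ 2 := fun x hx =>
    ⟨hgeom.2.2.1.2 ⟨x, hx, rfl⟩, hgeom.2.2.2.2 ⟨x, hx, rfl⟩⟩
  obtain ⟨y, hy⟩ := hΩne
  have hdD : d ^ 2 ≤ D ^ 2 :=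
    (sd y (subset_closure hy)).1.trans (sd y (subset_closure hy)).2
  obtain ⟨T0, T1, hT0, hT01, hT1T, hT1, hTD, hκ⟩ := exists_times hβ hdD hd hT
  have hT10 := hT0.trans hT01
  obtain ⟨-, k1, k2, k3⟩ := hA2
  have hspeed : ∀ k, CarlemanSpeed x0 β (Icc (-T1) T1 ×ˢ K) (Coefs.speed b1 b2 b3 k)
    | Sum.inl _ => carlemanSpeed_of_class k1 hc0 hc0min.1 hgeom hd hm hθ.2 hβ.1 hβ.2.2 hT10.le hT1
        hTD hKc s1 hV' hKV' fun x hx => (hbg x hx).1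
    | Sum.inr (Sum.inl _) => carlemanSpeed_of_class k2 hc0 hc0min.2.1 hgeom hd hm hθ.2 hβ.1 hβ.2.2
        hT10.le hT1 hTD hKc s2 hV' hKV' fun x hx => (hbg x hx).2.1
    | Sum.inr (Sum.inr _) => carlemanSpeed_of_class k3 hc0 hc0min.2.2 hgeom hd hm hθ.2 hβ.1 hβ.2.2
        hT10.le hT1 hTD hKc s3 hV' hKV' fun x hx => (hbg x hx).2.2
  have hsmooth : ∀ k, ContDiff ℝ 2 (Coefs.speed b1 b2 b3 k)
    | Sum.inl _ => s1
    | Sum.inr (Sum.inl _) => s2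
    | Sum.inr (Sum.inr _) => s3
  have hlow : ∀ k, ∀ x ∈ K, 1 / m ≤ Coefs.speed b1 b2 b3 k x
    | Sum.inl _ => fun x hx => k1.inv_le (hKc hx) (hbg x (hKV' hx)).1
    | Sum.inr (Sum.inl _) => fun x hx => k2.inv_le (hKc hx) (hbg x (hKV' hx)).2.1
    | Sum.inr (Sum.inr _) => fun x hx => k3.inv_le (hKc hx) (hbg x (hKV' hx)).2.2
  have cus := contDiff_pi.1 hus
  have cuf := contDiff_pi.1 huf
  have le35 : (3 : WithTop ℕ∞) ≤ 5 := by norm_num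
  have usK : ∀ z ∈ Ioo (-T) T ×ˢ (Ω \ K), us z = 0 := fun z hz =>
    (hωu z ⟨hz.1, hΩK hz.2⟩).1
  have ufK : ∀ z ∈ Ioo (-T) T ×ˢ (Ω \ K), uf z = 0 := fun z hz =>
    (hωu z ⟨hz.1, hΩK hz.2⟩).2
  have hR : ∀ z ∈ Ioo (-T) T ×ˢ Ω, n2 (Dt (Dt R1) z) + vGradX2 (Dt (Dt R1)) z ≤ CR ∧
      n2 (Dt (Dt R2) z) + vGradX2 (Dt (Dt R2)) z ≤ CR := fun z hz => by
    have := hRbd z hz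
    have a1 := n2_nonneg (Dt (Dt R1) z)
    have a2 := n2_nonneg (Dt (Dt R2) z)
    have a3 := n2_nonneg (Dt (Dt (Dt R1)) z)
    have a4 := n2_nonneg (Dt (Dt (Dt R2)) z)
    have a5 := vGradX2_nonneg (Dt (Dt R1)) z
    have a6 := vGradX2_nonneg (Dt (Dt R2)) z
    have a7 := vGradX2_nonneg (Dt (Dt (Dt R1))) z
    have a8 := vGradX2_nonneg (Dt (Dt (Dt R2))) z
    constructor <;> linarith
  have hp := (hgood (Icc (-T1) T1)).sources_eq_zero hspeed hΩopen hK hKΩ hβ.1 hT0 hT01 hT1T cus cuf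
    (contDiff_pi.1 hRreg.1) (contDiff_pi.1 hRreg.2) hp1 hp2 hB (fun x hx => (h0 x hx).1)
    (fun x hx => (h0 x hx).2.1) usK ufK (fun x hx => hΦ1 x (subset_closure hx))
    (fun x hx => hΦ2 x (subset_closure hx)) hCR.le (fun z hz => (hR z hz).1)
    (fun z hz => (hR z hz).2) (fun x hx => (sd x (hKc hx)).1) (fun x hx => (sd x (hKc hx)).2) hκ
  refine ⟨hp, Coefs.Good.fields_eq_zero hgood hΩopen hK hKΩ (one_div_pos.2 hm) hsmooth hlow
    (fun i => (cus i).of_le le35) (fun i => (cuf i).of_le le35) (fun z hz => ?_)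
    (fun x hx => (h0 x hx).1) (fun x hx => (h0 x hx).2.1) (fun x hx => (h0 x hx).2.2.1)
    (fun x hx => (h0 x hx).2.2.2) usK ufK⟩
  have e := hB z hz
  simp only [(hp z.2 hz.2).1, (hp z.2 hz.2).2, zero_mul] at e
  exact ⟨funext fun i => (e i).1, funext fun i => (e i).2⟩

end
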